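/- Let Q satisfy Assumption (A). There exists M₀ > 0 such that for every M ≥ M₀ and every ε > 0 there exists η > 0 with the following property. Let f₀ ∈ E_rad and let f : [0,∞) → E_rad satisfy f(0) = f₀, t ↦ ∇φ_{f(t)} continuous from [0,∞) into L²(ℝ³), and, for every t ≥ 0, f(t) ∈ Eq(f₀) and H(f(t)) = H(f₀) (these properties hold for global strong spherically symmetric solutions of the gravitational Vlasov–Poisson system ∂_t f + v·∇_x f − ∇φ_f·∇_v f = 0). If |f₀ − Q|_{L¹(ℝ⁶)} < η, |f₀|_{L∞(ℝ⁶)} < M and H(f₀) < H(Q) + η, then for all t ≥ 0: |f(t) − Q|_{L¹(ℝ⁶)} + | |v|²(f(t) − Q) |_{L¹(ℝ⁶)} < ε and |f(t)|_{L∞(ℝ⁶)} < M. -/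

import Mathlib

noncomputable section

open MeasureTheory Real Filter Set Topology
open scoped ENNReal NNReal

abbrev E3 : Type := EuclideanSpace ℝ (Fin 3)
abbrev Phase : Type := E3 × E3

/-- Spherical symmetry: invariance under all rotations of `ℝ³` acting jointly on `x` and `v`. -/
def SphSym (f : Phase → ℝ) : Prop :=
  ∀ R : E3 ≃ₗᵢ[ℝ] E3, LinearMap.det (R.toLinearEquiv : E3 →ₗ[ℝ] E3) = 1 →
    ∀ z : Phase, f (R z.1, R z.2) = f z

/-- `|x × v|²`, via the Lagrange identity. -/
def ellOf (z : Phase) : ℝ := ‖z.1‖ ^ 2 * ‖z.2‖ ^ 2 - (inner ℝ z.1 z.2 : ℝ) ^ 2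

/-- Spatial density. -/
def rhoF (f : Phase → ℝ) (x : E3) : ℝ := ∫ v : E3, f (x, v)

/-- Poisson field. -/
def phiF (f : Phase → ℝ) (x : E3) : ℝ := - ∫ y : E3, rhoF f y / (4 * π * ‖x - y‖)

/-- Radial representation of the Poisson field. -/
def phiRad (f : Phase → ℝ) (r : ℝ) : ℝ :=
  phiF f (r • (EuclideanSpace.single (0 : Fin 3) (1:ℝ)))

def mass (f : Phase → ℝ) : ℝ := ∫ z : Phase, f z

def kineticE (f : Phase → ℝ) : ℝ := ∫ z : Phase, ‖z.2‖ ^ 2 * f z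

def gradPhi (f : Phase → ℝ) (x : E3) : E3 := gradient (phiF f) x

def fieldSq (f : Phase → ℝ) : ℝ := ∫ x : E3, ‖gradPhi f x‖ ^ 2

/-- `L²` distance between the force fields of `f` and `g`. -/
def fieldDist (f g : Phase → ℝ) : ℝ :=
  Real.sqrt (∫ x : E3, ‖gradPhi f x - gradPhi g x‖ ^ 2)

/-- The Hamiltonian. -/
def Ham (f : Phase → ℝ) : ℝ := kineticE f / 2 - fieldSq f / 2

/-- The norm of the energy space. -/
def eNormE (f : Phase → ℝ) : ℝ≥0∞ :=
  eLpNorm f 1 volume + eLpNorm f ⊤ volume +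
    ∫⁻ z : Phase, (‖z.2‖₊ : ℝ≥0∞) ^ 2 * (‖f z‖₊ : ℝ≥0∞)

def memE (f : Phase → ℝ) : Prop := Measurable f ∧ (∀ z, 0 ≤ f z) ∧ eNormE f < ⊤

def memErad (f : Phase → ℝ) : Prop := memE f ∧ SphSym f

/-- Density of the measure `ν_ℓ`. -/
def nuDens (ℓ : ℝ) (p : ℝ × ℝ) : ℝ≥0∞ :=
  if 0 < p.1 ∧ ℓ < p.1 ^ 2 * p.2 ^ 2 then
    ENNReal.ofReal (4 * π ^ 2 * p.1 * |p.2| / Real.sqrt (p.1 ^ 2 * p.2 ^ 2 - ℓ))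
  else 0

def nuMeas (ℓ : ℝ) : Measure (ℝ × ℝ) := volume.withDensity (nuDens ℓ)

/-- Representative phase point with `|x| = r`, `|v| = |u|`, `|x×v|² = ℓ` and
`x·v = sign u · √(r²u²-ℓ)`. -/
def radPoint (r u ℓ : ℝ) : Phase :=
  (r • (EuclideanSpace.single (0 : Fin 3) (1:ℝ)),
   (Real.sign u * Real.sqrt (r ^ 2 * u ^ 2 - ℓ) / r) • (EuclideanSpace.single (0 : Fin 3) (1:ℝ))
     + (Real.sqrt ℓ / r) • (EuclideanSpace.single (1 : Fin 3) (1:ℝ)))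

/-- Distribution function of `f` at kinetic momentum `ℓ`. -/
def muDist (f : Phase → ℝ) (s ℓ : ℝ) : ℝ≥0∞ :=
  nuMeas ℓ {p : ℝ × ℝ | s < f (radPoint p.1 p.2 ℓ)}

/-- `g ∈ Eq(f)` : `g` is nonnegative, spherically symmetric and equimeasurable to `f`
at (almost) every kinetic momentum `ℓ`. -/
def EqMeas (f g : Phase → ℝ) : Prop :=
  (∀ z, 0 ≤ g z) ∧ SphSym g ∧
    ∀ s : ℝ, 0 < s →
      ∀ᵐ ℓ ∂(volume.restrict (Ioi (0:ℝ))), muDist g s ℓ = muDist f s ℓ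

/-- Schwarz symmetrization of `f` at fixed `ℓ`. -/
def schwarz (f : Phase → ℝ) (t ℓ : ℝ) : ℝ :=
  if ENNReal.ofReal t < muDist f 0 ℓ then
    sSup {s : ℝ | 0 ≤ s ∧ ENNReal.ofReal t < muDist f s ℓ}
  else 0

/-- Effective potential. -/
def psiPot (φ : ℝ → ℝ) (ℓ r : ℝ) : ℝ := φ r + ℓ / (2 * r ^ 2)

def eMinPot (φ : ℝ → ℝ) (ℓ : ℝ) : ℝ := sInf (psiPot φ ℓ '' Ioi 0)

def r1Pot (φ : ℝ → ℝ) (e ℓ : ℝ) : ℝ := sInf {r : ℝ | 0 < r ∧ psiPot φ ℓ r < e}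

def r2Pot (φ : ℝ → ℝ) (e ℓ : ℝ) : ℝ := sSup {r : ℝ | 0 < r ∧ psiPot φ ℓ r < e}

/-- The Jacobian `a_φ(e, ℓ)` (meaningful for `e < 0`). -/
def aPot (φ : ℝ → ℝ) (e ℓ : ℝ) : ℝ :=
  8 * π ^ 2 * Real.sqrt 2 * ∫ r in Ioi (0:ℝ), Real.sqrt (max (e - psiPot φ ℓ r) 0)

/-- Inverse of the bijection `e ↦ a_φ(e,ℓ)` from `(e_{φ,ℓ},0)` onto `(0,∞)`. -/
def aPotInv (φ : ℝ → ℝ) (s ℓ : ℝ) : ℝ :=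
  sSup {e : ℝ | eMinPot φ ℓ < e ∧ e < 0 ∧ aPot φ e ℓ < s}

/-- Microscopic energy w.r.t. the Poisson field of `g`. -/
def microE (g : Phase → ℝ) (z : Phase) : ℝ := ‖z.2‖ ^ 2 / 2 + phiF g z.1

/-- Rearrangement of `f` with respect to the microscopic energy of the field of `g`. -/
def rearr (f g : Phase → ℝ) (z : Phase) : ℝ :=
  if microE g z < 0 then
    schwarz f (aPot (phiRad g) (microE g z) (ellOf z)) (ellOf z)
  else 0

/-- Assumption (A). -/
structure AssumptionA (Q : Phase → ℝ) (F : ℝ → ℝ → ℝ) (e₀ : ℝ) : Prop where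
  contQ : Continuous Q
  nonneg : ∀ z, 0 ≤ Q z
  nonzero : Q ≠ 0
  cpt : HasCompactSupport Q
  sph : SphSym Q
  eqF : ∀ z : Phase, Q z = F (microE Q z) (ellOf z)
  Fnonneg : ∀ e ℓ, 0 ≤ ℓ → 0 ≤ F e ℓ
  Fcont : ContinuousOn (fun p : ℝ × ℝ => F p.1 p.2) {p : ℝ × ℝ | 0 ≤ p.2}
  e₀neg : e₀ < 0
  Fsupp : ∀ e ℓ, 0 ≤ ℓ → 0 < F e ℓ → e < e₀
  FC1 : ContDiffOn ℝ 1 (fun p : ℝ × ℝ => F p.1 p.2) {p : ℝ × ℝ | 0 ≤ p.2 ∧ 0 < F p.1 p.2}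
  FeNeg : ∀ e ℓ, 0 ≤ ℓ → 0 < F e ℓ → deriv (fun e' => F e' ℓ) e < 0

/-- The reduced functional `J_{f^*}(φ_g) = H(f^{*φ_g}) + ½|∇φ_g − ∇φ_{f^{*φ_g}}|²`. -/
def Jred (f g : Phase → ℝ) : ℝ :=
  Ham (rearr f g) + (∫ x : E3, ‖gradPhi g x - gradPhi (rearr f g) x‖ ^ 2) / 2

def distL1 (f g : Phase → ℝ) : ℝ := ∫ z : Phase, |f z - g z|

def distL1v (f g : Phase → ℝ) : ℝ := ∫ z : Phase, ‖z.2‖ ^ 2 * |f z - g z|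


section
def cRf : ℝ := 4 * √2 / 3
def Rf (y k : ℝ) : ℝ := cRf * (√(y + k)) ^ 3 - cRf * (√y) ^ 3 - 2 * √2 * √y * k
def tInt (y k w : ℝ) : ℝ := max (y + k - w ^ 2 / 2) 0 - (if w ^ 2 / 2 < y then y + k - w ^ 2 / 2 else 0)

lemma tInt_nonneg (y k w : ℝ) : 0 ≤ tInt y k w := by
  unfold tInt
  split_ifs
  · have := le_max_left (y + k - w ^ 2 / 2) 0
    linarith
  · have := le_max_right (y + k - w ^ 2 / 2) 0
    linarith

lemma half_sq_lt_iff (y w : ℝ) : w ^ 2 / 2 < y ↔ w ∈ Ioo (-√(2 * y)) (√(2 * y)) := by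
  rw [mem_Ioo, ← abs_lt, Real.lt_sqrt (abs_nonneg w), sq_abs]
  constructor <;> intro h <;> linarith

lemma int_ind (y z : ℝ) : Integrable (fun w : ℝ => if w ^ 2 / 2 < y then z - w ^ 2 / 2 else 0) ∧
    ∫ w : ℝ, (if w ^ 2 / 2 < y then z - w ^ 2 / 2 else 0) = 2 * √2 * √y * z - cRf / 2 * √y ^ 3 := by
  have e : (fun w : ℝ => if w ^ 2 / 2 < y then z - w ^ 2 / 2 else 0)
      = indicator (Ioo (-√(2 * y)) (√(2 * y))) (fun w => z - w ^ 2 / 2) := by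
    ext w
    simp only [indicator, half_sq_lt_iff]
  have hc : Continuous (fun w : ℝ => z - w ^ 2 / 2) := by fun_prop
  rw [e]
  constructor
  · rw [integrable_indicator_iff measurableSet_Ioo]
    exact (hc.integrableOn_Icc).mono_set Ioo_subset_Icc_self
  · rw [integral_indicator measurableSet_Ioo, ← integral_Ioc_eq_integral_Ioo,
      ← intervalIntegral.integral_of_le (by linarith [Real.sqrt_nonneg (2 * y)])]
    have : ∫ w in (-√(2 * y))..(√(2 * y)), (z - w ^ 2 / 2)
      = (z * √(2 * y) - √(2 * y) ^ 3 / 6) - (z * (-√(2 * y)) - (-√(2 * y)) ^ 3 / 6) := by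
      apply intervalIntegral.integral_eq_sub_of_hasDerivAt (f := fun w => z * w - w ^ 3 / 6)
      · intro x _
        have h1 := ((hasDerivAt_id x).const_mul z).sub (((hasDerivAt_id x).pow 3).div_const 6)
        exact h1.congr_deriv (by simp; ring)
      · exact hc.intervalIntegrable _ _
    rw [this, Real.sqrt_mul (by norm_num)]
    have h2 : √2 ^ 2 = 2 := Real.sq_sqrt (by norm_num)
    unfold cRf
    have h3 : √2 ^ 3 = 2 * √2 := by rw [pow_succ, h2]
    ring_nf
    rw [h3]; ring

lemma int_pos (z : ℝ) : Integrable (fun w : ℝ => max (z - w ^ 2 / 2) 0) ∧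
    ∫ w : ℝ, max (z - w ^ 2 / 2) 0 = cRf * √z ^ 3 := by
  have e : (fun w : ℝ => max (z - w ^ 2 / 2) 0) = (fun w : ℝ => if w ^ 2 / 2 < z then z - w ^ 2 / 2 else 0) := by
    ext w
    split_ifs with h
    · exact max_eq_left (by linarith)
    · exact max_eq_right (by linarith)
  rw [e]
  refine ⟨(int_ind z z).1, ?_⟩
  rw [(int_ind z z).2]
  unfold cRf
  rcases le_total 0 z with h | h
  · have h2 : √z ^ 3 = z * √z := by rw [pow_succ, Real.sq_sqrt h]
    rw [h2]; ring
  · rw [Real.sqrt_eq_zero_of_nonpos h]; ring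

lemma lint_tInt (y k : ℝ) : ∫⁻ w : ℝ, ENNReal.ofReal (tInt y k w) = ENNReal.ofReal (Rf y k) := by
  rw [← ofReal_integral_eq_lintegral_ofReal]
  · congr 1
    unfold tInt
    rw [integral_sub (int_pos _).1 (int_ind _ _).1, (int_pos _).2, (int_ind _ _).2]
    unfold Rf
    rcases le_total 0 y with h | h
    · have h2 : √y ^ 3 = y * √y := by rw [pow_succ, Real.sq_sqrt h]
      rw [h2]; unfold cRf; ring
    · rw [Real.sqrt_eq_zero_of_nonpos h]; ring
  · exact (int_pos _).1.sub (int_ind _ _).1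
  · exact Eventually.of_forall (fun w => tInt_nonneg _ _ _)

lemma Rf_b3 {y k : ℝ} (hy : y ≤ 0) (h : y + k ≤ 0) : Rf y k = 0 := by
  unfold Rf
  rw [Real.sqrt_eq_zero_of_nonpos hy, Real.sqrt_eq_zero_of_nonpos h]; ring

lemma sqrt2_bd : 1.414 < √2 ∧ √2 < 1.415 := by
  constructor
  · rw [Real.lt_sqrt] <;> norm_num
  · rw [Real.sqrt_lt'] <;> norm_num

lemma Rf_b1 {y k θ : ℝ} (hy : 0 < y) (hθ : θ ≤ 1 / 2) (h : |k| ≤ θ * y) :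
    Rf y k ≤ (1 + θ) * (k ^ 2 / √(2 * y)) := by
  obtain ⟨h1, h2⟩ := abs_le.1 h
  set A := √(y + k) with hA
  set b := √y with hb
  have hyk : 0 ≤ y + k := by nlinarith
  have hA2 : A ^ 2 = y + k := Real.sq_sqrt hyk
  have hb2 : b ^ 2 = y := Real.sq_sqrt hy.le
  have hb0 : 0 < b := Real.sqrt_pos.2 hy
  have hA0 : 0 ≤ A := Real.sqrt_nonneg _
  have hk : k = (A - b) * (A + b) := by nlinarith
  have hθ0 : 0 ≤ θ := by
    by_contra hh
    nlinarith [abs_nonneg k, mul_neg_of_neg_of_pos (not_le.1 hh) hy]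
  have s2 : √2 ^ 2 = 2 := Real.sq_sqrt (by norm_num)
  have s0 : 0 < √2 := by positivity
  rw [Real.sqrt_mul (by norm_num), ← mul_div_assoc, le_div_iff₀ (by positivity)]
  unfold Rf
  rw [← hA, ← hb]
  have e1 : (cRf * A ^ 3 - cRf * b ^ 3 - 2 * √2 * b * k) * (√2 * b) = 8 / 3 * b * (A - b) ^ 2 * (A + b / 2) := by
    rw [hk]; unfold cRf
    linear_combination (4 / 3 * A ^ 3 * b - 4 / 3 * b ^ 4 - 2 * b * ((A - b) * (A + b)) * b) * s2
  rw [e1, hk]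
  have hAb : (1 - θ) * b ≤ A := by
    apply Real.le_sqrt_of_sq_le
    have : 0 ≤ θ * (1 - θ) * y := mul_nonneg (mul_nonneg hθ0 (by linarith)) hy.le
    rw [mul_pow, hb2]
    nlinarith
  have key : 8 / 3 * b * (A + b / 2) ≤ (1 + θ) * (A + b) ^ 2 := by
    obtain ⟨d, hd⟩ : ∃ d, A = (1 - θ) * b + d := ⟨A - (1 - θ) * b, by ring⟩
    have hd0 : 0 ≤ d := by linarith
    rw [hd]
    have := mul_nonneg hb0.le hd0
    have h3 : 0 ≤ b * d * θ := by positivity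
    have h4 : 0 ≤ b ^ 2 * θ := by positivity
    have h5 : 0 ≤ b ^ 2 * θ ^ 2 := by positivity
    have h6 : 0 ≤ b ^ 2 * θ * (1 / 2 - θ) := mul_nonneg h4 (by linarith)
    have h7 : 0 ≤ b ^ 2 * θ ^ 2 * (1 / 2 - θ) := mul_nonneg h5 (by linarith)
    have h8 : 0 ≤ b * d * θ * (1 / 2 - θ) := mul_nonneg h3 (by linarith)
    have h9 : 0 ≤ d ^ 2 * θ := by positivity
    nlinarith [sq_nonneg d]
  have := mul_le_mul_of_nonneg_right key (sq_nonneg (A - b))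
  calc _ = 8 / 3 * b * (A + b / 2) * (A - b) ^ 2 := by ring
    _ ≤ _ := this
    _ = _ := by ring

lemma Rf_b2 {y k : ℝ} (hy : y ≠ 0) : Rf y k ≤ 4 * (k ^ 2 / √|y|) := by
  have s2 : √2 ^ 2 = 2 := Real.sq_sqrt (by norm_num)
  have s0 : 0 < √2 := by positivity
  have sb := sqrt2_bd
  have hbp : 0 < √|y| := Real.sqrt_pos.2 (abs_pos.2 hy)
  rw [← mul_div_assoc, le_div_iff₀ hbp]
  rcases lt_or_gt_of_ne hy with h | h
  · have hy0 : √y = 0 := Real.sqrt_eq_zero_of_nonpos h.le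
    rcases le_total (y + k) 0 with h2 | h2
    · rw [Rf_b3 h.le h2, zero_mul]; positivity
    · unfold Rf
      rw [hy0, abs_of_neg h]
      set A := √(y + k)
      set B := √(-y)
      have hA2 : A ^ 2 = y + k := Real.sq_sqrt h2
      have hB2 : B ^ 2 = -y := Real.sq_sqrt (by linarith)
      have hA0 : 0 ≤ A := Real.sqrt_nonneg _
      have hB0 : 0 ≤ B := Real.sqrt_nonneg _
      have hk : k = A ^ 2 + B ^ 2 := by linarith
      rw [hk]; unfold cRf
      have : A ^ 3 * B ≤ (A ^ 2 + B ^ 2) ^ 2 := by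
        nlinarith [sq_nonneg (A ^ 2 - A * B), sq_nonneg (A * B), sq_nonneg (B ^ 2)]
      have h4 : 0 ≤ A ^ 3 * B := by positivity
      nlinarith
  · rw [abs_of_pos h]
    unfold Rf
    set b := √y
    have hb2 : b ^ 2 = y := Real.sq_sqrt h.le
    have hb0 : 0 < b := hbp.trans_eq (by rw [abs_of_pos h])
    rcases le_total (y + k) 0 with h2 | h2
    · rw [Real.sqrt_eq_zero_of_nonpos h2]
      have hk : b ^ 2 ≤ -k := by linarith
      unfold cRf
      have h3 : b ^ 2 * (-k) ≤ k ^ 2 := by nlinarith [sq_nonneg b]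
      have h4 : 0 ≤ b ^ 4 := by positivity
      nlinarith [sq_nonneg k, mul_nonneg s0.le h4]
    · set A := √(y + k)
      have hA2 : A ^ 2 = y + k := Real.sq_sqrt h2
      have hA0 : 0 ≤ A := Real.sqrt_nonneg _
      have hk : k = (A - b) * (A + b) := by nlinarith
      rw [hk]; unfold cRf
      have h5 : 0 ≤ (A - b) ^ 2 * (A + b / 2) * b := by positivity
      have h6 : (A - b) ^ 2 * ((A + b / 2) * b) ≤ (A - b) ^ 2 * (A + b) ^ 2 :=
        mul_le_mul_of_nonneg_left (by nlinarith) (sq_nonneg _)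
      have e1 : (4 * √2 / 3 * A ^ 3 - 4 * √2 / 3 * b ^ 3 - 2 * √2 * b * ((A - b) * (A + b))) * b
        = √2 * (4 / 3) * ((A - b) ^ 2 * (A + b / 2) * b) := by ring
      rw [e1]
      nlinarith
end

section
structure PotData (Φ m n : ℝ → ℝ) (C0 R e0 : ℝ) : Prop where
  hm : ∀ r, 0 < r → HasDerivAt m (n r) r
  hn0 : ∀ r, 0 < r → 0 ≤ n r
  hnc : ContinuousOn n (Ioi 0)
  hm0 : ∀ r, 0 < r → 0 ≤ m r
  hΦ : ∀ r, 0 < r → HasDerivAt Φ (m r / (4 * π * r ^ 2)) r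
  hΦl : ∀ r, 0 < r → -C0 ≤ Φ r
  R0 : 0 < R
  hΦR : ∀ r, R ≤ r → e0 / 2 ≤ Φ r
  e0neg : e0 < 0

def yF (Φ : ℝ → ℝ) (E l r : ℝ) : ℝ := E - Φ r - l / (2 * r ^ 2)
def ypF (m : ℝ → ℝ) (l r : ℝ) : ℝ := - (m r / (4 * π * r ^ 2)) + l / r ^ 3
def betaF (R r : ℝ) : ℝ := r - r ^ 2 / (8 * R)
def WF (Φ m : ℝ → ℝ) (R E l r : ℝ) : ℝ := 2 * (1 - r / (4 * R)) * yF Φ E l r + betaF R r * ypF m l r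
def GamF (Φ m n : ℝ → ℝ) (R E l r : ℝ) : ℝ :=
  betaF R r * (n r / (4 * π * r ^ 2)) + (1 - r / (2 * R)) * (m r / (4 * π * r ^ 2)) + l / (8 * R * r ^ 2)
    + (E - Φ r) / (2 * R)

section
variable {Φ m n : ℝ → ℝ} {C0 R e0 E l : ℝ}

lemma PotData.mono (P : PotData Φ m n C0 R e0) {a b : ℝ} (ha : 0 < a) (hab : a ≤ b) : m a ≤ m b := by
  have : MonotoneOn m (Ioi 0) := by
    apply monotoneOn_of_deriv_nonneg (convex_Ioi 0)
    · exact fun r hr => (P.hm r hr).continuousAt.continuousWithinAt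
    · rw [interior_Ioi]; exact fun r hr => (P.hm r hr).differentiableAt.differentiableWithinAt
    · rw [interior_Ioi]; intro r hr; rw [(P.hm r hr).deriv]; exact P.hn0 r hr
  exact this ha (ha.trans_le hab) hab

lemma yF_deriv (P : PotData Φ m n C0 R e0) {r : ℝ} (hr : 0 < r) :
    HasDerivAt (yF Φ E l) (ypF m l r) r := by
  have h1 : HasDerivAt (fun r : ℝ => l / (2 * r ^ 2)) (- (l / r ^ 3)) r := by
    have h2 : HasDerivAt (fun r : ℝ => 2 * r ^ 2) (4 * r) r :=
      ((hasDerivAt_pow 2 r).const_mul 2).congr_deriv (by simp; ring)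
    refine ((hasDerivAt_const r l).div h2 (by positivity)).congr_deriv ?_
    field_simp; ring
  refine (((hasDerivAt_const r E).sub (P.hΦ r hr)).sub h1).congr_deriv ?_
  unfold ypF; ring

lemma ypF_deriv (P : PotData Φ m n C0 R e0) {r : ℝ} (hr : 0 < r) :
    HasDerivAt (ypF m l) (-(n r / (4 * π * r ^ 2)) + 2 * m r / (4 * π * r ^ 3) - 3 * l / r ^ 4) r := by
  have h2 : HasDerivAt (fun r : ℝ => 4 * π * r ^ 2) (8 * π * r) r :=
    ((hasDerivAt_pow 2 r).const_mul (4 * π)).congr_deriv (by simp; ring)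
  have h3 : HasDerivAt (fun r : ℝ => r ^ 3) (3 * r ^ 2) r :=
    ((hasDerivAt_pow 3 r)).congr_deriv (by simp)
  refine (((P.hm r hr).div h2 (by positivity)).neg.add
    ((hasDerivAt_const r l).div h3 (by positivity))).congr_deriv ?_
  field_simp; ring

lemma betaF_deriv (r : ℝ) : HasDerivAt (betaF R) (1 - r / (4 * R)) r := by
  refine ((hasDerivAt_id r).sub ((hasDerivAt_pow 2 r).div_const (8 * R))).congr_deriv ?_
  simp; ring

lemma WF_deriv (P : PotData Φ m n C0 R e0) {r : ℝ} (hr : 0 < r) :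
    HasDerivAt (WF Φ m R E l) (-GamF Φ m n R E l r) r := by
  have hR := P.R0
  have h1 : HasDerivAt (fun r : ℝ => 2 * (1 - r / (4 * R))) (- (1 / (2 * R))) r := by
    refine (((hasDerivAt_const r (1:ℝ)).sub ((hasDerivAt_id r).div_const (4 * R))).const_mul 2).congr_deriv ?_
    field_simp; ring
  refine ((h1.mul (yF_deriv (E := E) (l := l) P hr)).add
    ((betaF_deriv (R := R) r).mul (ypF_deriv (l := l) P hr))).congr_deriv ?_
  unfold GamF yF ypF betaF
  field_simp; ring

lemma yF_pos_lt (P : PotData Φ m n C0 R e0) (hE : E ≤ e0) (hl : 0 < l) {r : ℝ} (hr : 0 < r)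
    (hy : 0 ≤ yF Φ E l r) : r < R ∧ l / (2 * C0) ≤ r ^ 2 ∧ 0 < C0 := by
  unfold yF at hy
  have h1 : 0 < l / (2 * r ^ 2) := by positivity
  have e0n := P.e0neg
  refine ⟨?_, ?_⟩
  · by_contra h
    have := P.hΦR r (not_lt.1 h)
    linarith
  · have h2 := P.hΦl r hr
    have h3 : l / (2 * r ^ 2) ≤ C0 := by linarith
    have hC : 0 < C0 := by linarith
    refine ⟨?_, hC⟩
    rw [div_le_iff₀ (by positivity)] at h3 ⊢
    linarith

lemma beta_pos (hR : 0 < R) {r : ℝ} (hr : 0 < r) (h : r ≤ R) : 0 < betaF R r ∧ betaF R r ≤ R := by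
  unfold betaF
  have : r ^ 2 / (8 * R) ≤ r / 8 := by
    rw [div_le_div_iff₀ (by positivity) (by positivity)]; nlinarith
  have h2 : 0 ≤ r ^ 2 / (8 * R) := by positivity
  constructor <;> linarith

lemma Gam_lower (P : PotData Φ m n C0 R e0) (hl : 0 < l) {r : ℝ} (hr : 0 < r) (hrR : r ≤ R)
    (hy : 0 < yF Φ E l r) : 0 < E - Φ r ∧ 0 < GamF Φ m n R E l r ∧
      betaF R r * (n r / (4 * π * r ^ 2) + (E - Φ r) / (2 * R ^ 2)) ≤ GamF Φ m n R E l r := by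
  have hR := P.R0
  obtain ⟨hb, hb2⟩ := beta_pos hR hr hrR
  have h1 : 0 < l / (2 * r ^ 2) := by positivity
  have hEP : 0 < E - Φ r := by unfold yF at hy; linarith
  have hn := P.hn0 r hr
  have hm := P.hm0 r hr
  have h2 : 0 ≤ (1 - r / (2 * R)) * (m r / (4 * π * r ^ 2)) := by
    apply mul_nonneg _ (by positivity)
    rw [sub_nonneg, div_le_one (by positivity)]; linarith
  have h3 : 0 < l / (8 * R * r ^ 2) := by positivity
  have h4 : betaF R r * ((E - Φ r) / (2 * R ^ 2)) ≤ (E - Φ r) / (2 * R) := by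
    calc _ ≤ R * ((E - Φ r) / (2 * R ^ 2)) := by gcongr
      _ = _ := by field_simp
  have h5 : 0 ≤ betaF R r * (n r / (4 * π * r ^ 2)) := by positivity
  have h6 : 0 < (E - Φ r) / (2 * R) := by positivity
  refine ⟨hEP, ?_, ?_⟩ <;> unfold GamF <;> linarith [mul_add (betaF R r) (n r / (4 * π * r ^ 2)) ((E - Φ r) / (2 * R ^ 2))]

lemma conc (P : PotData Φ m n C0 R e0) : ConcaveOn ℝ (Ioi 0) (fun u : ℝ => E - Φ (1 / u)) := by
  have hd : ∀ u : ℝ, 0 < u → HasDerivAt (fun u : ℝ => E - Φ (1 / u)) (m (1 / u) / (4 * π)) u := by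
    intro u hu
    have h1 : HasDerivAt (fun u : ℝ => 1 / u) (- (1 / u ^ 2)) u := by
      refine ((hasDerivAt_const u (1:ℝ)).div (hasDerivAt_id u) hu.ne').congr_deriv ?_
      simp; ring
    have h2 := (P.hΦ (1 / u) (by positivity))
    refine ((hasDerivAt_const u E).sub (h2.comp u h1)).congr_deriv ?_
    field_simp; ring
  apply AntitoneOn.concaveOn_of_deriv (convex_Ioi 0)
  · exact fun u hu => (hd u hu).continuousAt.continuousWithinAt
  · rw [interior_Ioi]; exact fun u hu => (hd u hu).differentiableAt.differentiableWithinAt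
  · rw [interior_Ioi]
    intro u hu v hv huv
    rw [(hd u hu).deriv, (hd v hv).deriv]
    have : m (1 / v) ≤ m (1 / u) := P.mono (by simpa using hv) (one_div_le_one_div_of_le hu huv)
    gcongr

lemma chord (P : PotData Φ m n C0 R e0) (hl : 0 < l) {r1 r2 : ℝ} (h1 : 0 < r1) (h12 : r1 < r2)
    (hy1 : yF Φ E l r1 = 0) (hy2 : yF Φ E l r2 = 0) {r : ℝ} (hr : 0 < r) :
    (r < r1 → yF Φ E l r ≤ l / 2 * ((1 / r1 - 1 / r) * (1 / r - 1 / r2))) ∧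
    (r1 < r → r < r2 → l / 2 * ((1 / r1 - 1 / r) * (1 / r - 1 / r2)) ≤ yF Φ E l r) ∧
    (r2 < r → yF Φ E l r ≤ l / 2 * ((1 / r1 - 1 / r) * (1 / r - 1 / r2))) := by
  have hc := conc (E := E) P
  have h2 : 0 < r2 := h1.trans h12
  have p1 : (0:ℝ) < 1 / r1 := by positivity
  have p2 : (0:ℝ) < 1 / r2 := by positivity
  have p : (0:ℝ) < 1 / r := by positivity
  have q : ∀ t : ℝ, 0 < t → E - Φ (1 / (1 / t)) = yF Φ E l t + l / 2 * (1 / t) ^ 2 := by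
    intro t ht
    unfold yF; rw [one_div_one_div]; field_simp; ring
  have q1 := q r1 h1
  have q2 := q r2 h2
  have q0 := q r hr
  rw [hy1] at q1
  rw [hy2] at q2
  have u12 : 1 / r2 < 1 / r1 := one_div_lt_one_div_of_lt h1 h12
  set u1 := 1 / r1
  set u2 := 1 / r2
  set u := 1 / r
  set Y := yF Φ E l r
  refine ⟨fun h => ?_, fun h h' => ?_, fun h => ?_⟩
  · have hu : u1 < u := one_div_lt_one_div_of_lt hr h
    have := hc.slope_anti_adjacent p2 p u12 hu
    simp only [q1, q2, q0] at this
    rw [div_le_div_iff₀ (by linarith) (by linarith)] at this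
    by_contra hh
    nlinarith [mul_pos (sub_pos.2 u12) (sub_pos.2 (not_le.1 hh))]
  · have hu : u < u1 := one_div_lt_one_div_of_lt h1 h
    have hu' : u2 < u := one_div_lt_one_div_of_lt hr h'
    have := hc.slope_anti_adjacent p2 p1 hu' hu
    simp only [q1, q2, q0] at this
    rw [div_le_div_iff₀ (by linarith) (by linarith)] at this
    by_contra hh
    nlinarith [mul_pos (sub_pos.2 u12) (sub_pos.2 (not_le.1 hh))]
  · have hu : u < u2 := one_div_lt_one_div_of_lt h2 h
    have := hc.slope_anti_adjacent p p1 hu u12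
    simp only [q1, q2, q0] at this
    rw [div_le_div_iff₀ (by linarith) (by linarith)] at this
    by_contra hh
    nlinarith [mul_pos (sub_pos.2 u12) (sub_pos.2 (not_le.1 hh))]

end

structure WellS (Φ m : ℝ → ℝ) (C0 R E l r1 r0 r2 : ℝ) : Prop where
  h1 : 0 < r1
  h10 : r1 < r0
  h02 : r0 < r2
  h2R : r2 ≤ R
  hl1 : l / (2 * C0) ≤ r1 ^ 2
  C0p : 0 < C0
  well : ∀ r, 0 < r → (0 < yF Φ E l r ↔ r ∈ Ioo r1 r2)
  W0 : WF Φ m R E l r0 = 0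
  Wl : ∀ r ∈ Ioo r1 r0, 0 < WF Φ m R E l r
  Wr : ∀ r ∈ Ioo r0 r2, WF Φ m R E l r < 0
  low : ∀ r, 0 < r → l / 2 * (|1 / r1 - 1 / r| * |1 / r - 1 / r2|) ≤ |yF Φ E l r|

lemma well_struct {Φ m n : ℝ → ℝ} {C0 R e0 E l : ℝ} (P : PotData Φ m n C0 R e0) (hE : E ≤ e0)
    (hl : 0 < l) {rp : ℝ} (hrp : 0 < rp) (hyp : 0 < yF Φ E l rp) :
    ∃ r1 r0 r2, WellS Φ m C0 R E l r1 r0 r2 := by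
  have hR := P.R0
  obtain ⟨hpR, hpl, hC0⟩ := yF_pos_lt P hE hl hrp hyp.le
  have ycont : ∀ r, 0 < r → ContinuousAt (yF Φ E l) r := fun r hr => (yF_deriv P hr).continuousAt
  -- left root
  obtain ⟨r1, ⟨hr1, hr1'⟩, hy1⟩ : ∃ r1, (0 < r1 ∧ r1 < rp) ∧ yF Φ E l r1 = 0 := by
    set ra := min (rp / 2) (√(l / (2 * C0)) / 2) with hra
    have hs : 0 < √(l / (2 * C0)) := Real.sqrt_pos.2 (by positivity)
    have hra0 : 0 < ra := lt_min (by positivity) (by positivity)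
    have hrap : ra < rp := (min_le_left _ _).trans_lt (by linarith)
    have hya : yF Φ E l ra ≤ 0 := by
      by_contra hh
      have := (yF_pos_lt P hE hl hra0 (not_le.1 hh).le).2.1
      have h2 : ra ≤ √(l / (2 * C0)) / 2 := min_le_right _ _
      have h3 := Real.sq_sqrt (show 0 ≤ l / (2 * C0) by positivity)
      nlinarith
    have := intermediate_value_Icc hrap.le (f := yF Φ E l)
      (fun r hr => (ycont r (hra0.trans_le hr.1)).continuousWithinAt)
    obtain ⟨r, hr, hr'⟩ := this ⟨hya, hyp.le⟩
    refine ⟨r, ⟨hra0.trans_le hr.1, lt_of_le_of_ne hr.2 ?_⟩, hr'⟩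
    rintro rfl; linarith
  obtain ⟨r2, ⟨hr2, hr2'⟩, hy2⟩ : ∃ r2, (rp < r2 ∧ r2 ≤ R) ∧ yF Φ E l r2 = 0 := by
    have hyR : yF Φ E l R ≤ 0 := by
      by_contra hh
      exact lt_irrefl _ (yF_pos_lt P hE hl hR (not_le.1 hh).le).1
    have := intermediate_value_Icc' hpR.le (f := yF Φ E l)
      (fun r hr => (ycont r (hrp.trans_le hr.1)).continuousWithinAt)
    obtain ⟨r, hr, hr'⟩ := this ⟨hyR, hyp.le⟩
    refine ⟨r, ⟨lt_of_le_of_ne hr.1 ?_, hr.2⟩, hr'⟩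
    rintro rfl; linarith
  have h12 : r1 < r2 := hr1'.trans hr2
  have hr2p : 0 < r2 := hr1.trans h12
  have hch := fun r (hr : 0 < r) => chord (E := E) P hl hr1 h12 hy1 hy2 hr
  have hpos : ∀ r, r1 < r → r < r2 → 0 < yF Φ E l r := by
    intro r h h'
    have hr := hr1.trans h
    refine lt_of_lt_of_le ?_ ((hch r hr).2.1 h h')
    have := sub_pos.2 (one_div_lt_one_div_of_lt hr1 h)
    have := sub_pos.2 (one_div_lt_one_div_of_lt hr h')
    positivity
  have hnegl : ∀ r, 0 < r → r < r1 → yF Φ E l r ≤ l / 2 * ((1 / r1 - 1 / r) * (1 / r - 1 / r2)) ∧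
      l / 2 * ((1 / r1 - 1 / r) * (1 / r - 1 / r2)) < 0 := by
    intro r hr h
    refine ⟨(hch r hr).1 h, ?_⟩
    have a1 := sub_neg.2 (one_div_lt_one_div_of_lt hr h)
    have a2 := sub_pos.2 (one_div_lt_one_div_of_lt hr (h.trans h12))
    exact mul_neg_of_pos_of_neg (by positivity) (mul_neg_of_neg_of_pos a1 a2)
  have hnegr : ∀ r, r2 < r → yF Φ E l r ≤ l / 2 * ((1 / r1 - 1 / r) * (1 / r - 1 / r2)) ∧
      l / 2 * ((1 / r1 - 1 / r) * (1 / r - 1 / r2)) < 0 := by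
    intro r h
    have hr := hr2p.trans h
    refine ⟨(hch r hr).2.2 h, ?_⟩
    have a1 := sub_pos.2 (one_div_lt_one_div_of_lt hr1 (h12.trans h))
    have a2 := sub_neg.2 (one_div_lt_one_div_of_lt hr2p h)
    exact mul_neg_of_pos_of_neg (by positivity) (mul_neg_of_pos_of_neg a1 a2)
  -- derivative signs at the ends
  have Danti : ∀ a b, 0 < a → a < b → ypF m l b * b ^ 2 < ypF m l a * a ^ 2 := by
    intro a b ha hab
    have hb := ha.trans hab
    have e : ∀ t, 0 < t → ypF m l t * t ^ 2 = l / t - m t / (4 * π) := by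
      intro t ht; unfold ypF; field_simp; ring
    rw [e a ha, e b hb]
    have := P.mono ha hab.le
    have h3 : m a / (4 * π) ≤ m b / (4 * π) := by gcongr
    have h4 : l / b < l / a := div_lt_div_of_pos_left hl ha hab
    linarith
  have hyc : ContinuousOn (yF Φ E l) (Icc r1 r2) :=
    fun r hr => (ycont r (hr1.trans_le hr.1)).continuousWithinAt
  have hp1 : 0 < ypF m l r1 := by
    obtain ⟨c, hc, hc'⟩ := exists_hasDerivAt_eq_slope (yF Φ E l) (ypF m l) hr1'
      (hyc.mono (Icc_subset_Icc_right hr2.le)) (fun x hx => yF_deriv P (hr1.trans hx.1))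
    have : 0 < ypF m l c := by
      rw [hc', hy1]; apply div_pos <;> linarith
    have hcp := hr1.trans hc.1
    have h3 := Danti r1 c hr1 hc.1
    have : 0 < ypF m l r1 * r1 ^ 2 := lt_trans (by positivity) h3
    exact pos_of_mul_pos_left this (by positivity)
  have hp2 : ypF m l r2 < 0 := by
    obtain ⟨c, hc, hc'⟩ := exists_hasDerivAt_eq_slope (yF Φ E l) (ypF m l) hr2
      (hyc.mono (Icc_subset_Icc_left hr1'.le)) (fun x hx => yF_deriv P (hrp.trans hx.1))
    have : ypF m l c < 0 := by
      rw [hc', hy2]; apply div_neg_of_neg_of_pos <;> linarith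
    have hcp := hrp.trans hc.1
    have h3 := Danti c r2 hcp hc.2
    have : ypF m l r2 * r2 ^ 2 < 0 := lt_trans h3 (mul_neg_of_neg_of_pos this (by positivity))
    by_contra hh
    have := mul_nonneg (not_lt.1 hh) (sq_nonneg r2)
    linarith
  have hW1 : 0 < WF Φ m R E l r1 := by
    unfold WF; rw [hy1]
    have := (beta_pos hR hr1 (by linarith)).1
    simp; positivity
  have hW2 : WF Φ m R E l r2 < 0 := by
    unfold WF; rw [hy2]
    have := (beta_pos hR hr2p hr2').1
    simp only [mul_zero, zero_add]; exact mul_neg_of_pos_of_neg this hp2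
  have hWc : ContinuousOn (WF Φ m R E l) (Icc r1 r2) :=
    fun r hr => (WF_deriv P (hr1.trans_le hr.1)).continuousAt.continuousWithinAt
  have hWa : StrictAntiOn (WF Φ m R E l) (Icc r1 r2) := by
    apply strictAntiOn_of_deriv_neg (convex_Icc _ _) hWc
    rw [interior_Icc]
    intro r hr
    have hr0 := hr1.trans hr.1
    rw [(WF_deriv P hr0).deriv]
    have := (Gam_lower P hl hr0 (hr.2.le.trans hr2') (hpos r hr.1 hr.2)).2.1
    linarith
  obtain ⟨r0, hr0, hW0⟩ := intermediate_value_Icc' h12.le hWc ⟨hW2.le, hW1.le⟩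
  have h10 : r1 < r0 := lt_of_le_of_ne hr0.1 (by rintro rfl; linarith)
  have h02 : r0 < r2 := lt_of_le_of_ne hr0.2 (by rintro rfl; linarith)
  refine ⟨r1, r0, r2, hr1, h10, h02, hr2', ?_, hC0, ?_, hW0, ?_, ?_, ?_⟩
  · exact (yF_pos_lt P hE hl hr1 hy1.ge).2.1
  · intro r hr
    constructor
    · intro h
      constructor
      · by_contra hh
        rcases (not_lt.1 hh).lt_or_eq with h3 | h3
        · linarith [(hnegl r hr h3).1, (hnegl r hr h3).2]
        · rw [h3] at h; linarith
      · by_contra hh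
        rcases (not_lt.1 hh).lt_or_eq with h3 | h3
        · linarith [(hnegr r h3).1, (hnegr r h3).2]
        · rw [← h3] at h; linarith
    · exact fun h => hpos r h.1 h.2
  · intro r hr
    have := hWa ⟨hr.1.le, hr.2.le.trans h02.le⟩ hr0 hr.2
    rwa [hW0] at this
  · intro r hr
    have := hWa hr0 ⟨h10.le.trans hr.1.le, hr.2.le⟩ hr.1
    rwa [hW0] at this
  · intro r hr
    rw [← abs_mul]
    rcases lt_trichotomy r r1 with h | h | h
    · obtain ⟨a, b⟩ := hnegl r hr h
      have hh := neg_of_mul_neg_right b (by positivity)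
      rw [abs_of_neg hh, abs_of_neg (a.trans_lt b)]; linarith
    · rw [h]; simp
    · rcases lt_trichotomy r r2 with h' | h' | h'
      · have a := (hch r hr).2.1 h h'
        have b := hpos r h h'
        have b1 := sub_pos.2 (one_div_lt_one_div_of_lt hr1 h)
        have b2 := sub_pos.2 (one_div_lt_one_div_of_lt hr h')
        rw [abs_of_pos b, abs_of_pos (by positivity)]; exact a
      · rw [h']; simp
      · obtain ⟨a, b⟩ := hnegr r h'
        have hh := neg_of_mul_neg_right b (by positivity)
        rw [abs_of_neg hh, abs_of_neg (a.trans_lt b)]; linarith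
end

section
section
variable {Φ m n : ℝ → ℝ} {C0 R e0 E l r1 r0 r2 : ℝ} {h hp : ℝ → ℝ}

lemma uF_deriv (P : PotData Φ m n C0 R e0) (hh : ∀ r, 0 < r → HasDerivAt h (hp r) r)
    {r : ℝ} (hr : 0 < r) (hy : 0 < yF Φ E l r) (hW : WF Φ m R E l r ≠ 0) :
    HasDerivAt (fun r => betaF R r * √(2 * yF Φ E l r) * (h r0 - h r) ^ 2 / WF Φ m R E l r)
      ((h r0 - h r) ^ 2 / √(2 * yF Φ E l r)
        - 2 * betaF R r * √(2 * yF Φ E l r) * (h r0 - h r) * hp r / WF Φ m R E l r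
        + betaF R r * √(2 * yF Φ E l r) * (h r0 - h r) ^ 2 * GamF Φ m n R E l r / WF Φ m R E l r ^ 2) r := by
  have hp2 : 0 < 2 * yF Φ E l r := by linarith
  have h1 : HasDerivAt (fun r => √(2 * yF Φ E l r)) (ypF m l r / √(2 * yF Φ E l r)) r := by
    refine (((yF_deriv P hr).const_mul 2).sqrt hp2.ne').congr_deriv ?_
    rw [mul_div_mul_left _ _ (by norm_num)]
  have h2 : HasDerivAt (fun r => (h r0 - h r) ^ 2) (- 2 * (h r0 - h r) * hp r) r := by
    refine (((hasDerivAt_const r (h r0)).sub (hh r hr)).pow 2).congr_deriv ?_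
    simp
  have hs : √(2 * yF Φ E l r) ^ 2 = 2 * yF Φ E l r := Real.sq_sqrt hp2.le
  have hs0 : 0 < √(2 * yF Φ E l r) := Real.sqrt_pos.2 hp2
  refine ((((betaF_deriv (R := R) r).mul h1).mul h2).div (WF_deriv P hr) hW).congr_deriv ?_
  have hWe : (1 - r / (4 * R)) * √(2 * yF Φ E l r) ^ 2 + betaF R r * ypF m l r = WF Φ m R E l r := by
    rw [hs]; unfold WF; ring
  simp only [Pi.mul_apply]
  generalize √(2 * yF Φ E l r) = p at *
  generalize WF Φ m R E l r = W at *
  generalize GamF Φ m n R E l r = G at *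
  generalize betaF R r = b at *
  generalize ypF m l r = y' at *
  generalize 1 - r / (4 * R) = b' at *
  generalize h r0 - h r = k at *
  field_simp
  linear_combination k ^ 2 * W * hWe

lemma hardy_int (P : PotData Φ m n C0 R e0) (hl : 0 < l) (S : WellS Φ m C0 R E l r1 r0 r2)
    (hh : ∀ r, 0 < r → HasDerivAt h (hp r) r) (hpc : ContinuousOn hp (Ioi 0)) {a b : ℝ}
    (ha : r1 < a) (ha0 : a < r0) (hb0 : r0 < b) (hb : b < r2) :
    ∫⁻ r in Ioc a b, ENNReal.ofReal ((h r0 - h r) ^ 2 / √(2 * yF Φ E l r)) ≤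
    ∫⁻ r in Ioc a b, ENNReal.ofReal (hp r ^ 2 * (√(2 * yF Φ E l r) / (n r / (4 * π * r ^ 2) + (E - Φ r) / (2 * R ^ 2)))) := by
  have hR := P.R0
  have r1p := S.h1
  have pos : ∀ r ∈ Icc a b, 0 < r := fun r hr => (r1p.trans ha).trans_le hr.1
  have rR : ∀ r ∈ Icc a b, r ≤ R := fun r hr => hr.2.trans (hb.le.trans S.h2R)
  have ypos : ∀ r ∈ Icc a b, 0 < yF Φ E l r := fun r hr =>
    (S.well r (pos r hr)).2 ⟨ha.trans_le hr.1, hr.2.trans_lt hb⟩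
  have Gp : ∀ r ∈ Icc a b, 0 < GamF Φ m n R E l r := fun r hr =>
    (Gam_lower P hl (pos r hr) (rR r hr) (ypos r hr)).2.1
  have hsub : Icc a b ⊆ Ioi 0 := fun r hr => pos r hr
  have cy : ContinuousOn (yF Φ E l) (Icc a b) :=
    fun r hr => (yF_deriv P (pos r hr)).continuousAt.continuousWithinAt
  have cp : ContinuousOn (fun r => √(2 * yF Φ E l r)) (Icc a b) := (cy.const_smul (2:ℝ)).sqrt
  have ppos : ∀ r ∈ Icc a b, 0 < √(2 * yF Φ E l r) := fun r hr => Real.sqrt_pos.2 (by linarith [ypos r hr])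
  have ch : ContinuousOn h (Icc a b) := fun r hr => (hh r (pos r hr)).continuousAt.continuousWithinAt
  have cm : ContinuousOn m (Icc a b) := fun r hr => (P.hm r (pos r hr)).continuousAt.continuousWithinAt
  have cΦ : ContinuousOn Φ (Icc a b) := fun r hr => (P.hΦ r (pos r hr)).continuousAt.continuousWithinAt
  have cn : ContinuousOn n (Icc a b) := P.hnc.mono hsub
  have chp : ContinuousOn hp (Icc a b) := hpc.mono hsub
  have cb : Continuous (betaF R) := by unfold betaF; fun_prop
  have cW : ContinuousOn (WF Φ m R E l) (Icc a b) :=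
    fun r hr => (WF_deriv P (pos r hr)).continuousAt.continuousWithinAt
  have c4 : ∀ r ∈ Icc a b, 4 * π * r ^ 2 ≠ 0 := fun r hr => by have := pos r hr; positivity
  have c5 : ContinuousOn (fun r : ℝ => 4 * π * r ^ 2) (Icc a b) := by fun_prop
  have cG : ContinuousOn (GamF Φ m n R E l) (Icc a b) := by
    unfold GamF
    refine (((cb.continuousOn.mul (cn.div c5 c4)).add ((by fun_prop : Continuous (fun r : ℝ => 1 - r / (2 * R))).continuousOn.mul (cm.div c5 c4))).add
      (continuousOn_const.div (by fun_prop) ?_)).add ((continuousOn_const.sub cΦ).div_const _)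
    intro r hr; have := pos r hr; positivity
  set f1 : ℝ → ℝ := fun r => (h r0 - h r) ^ 2 / √(2 * yF Φ E l r) with hf1
  set f2 : ℝ → ℝ := fun r => hp r ^ 2 * √(2 * yF Φ E l r) * betaF R r / GamF Φ m n R E l r with hf2
  have c1 : ContinuousOn f1 (Icc a b) := ((continuousOn_const.sub ch).pow 2).div cp (fun r hr => (ppos r hr).ne')
  have c2 : ContinuousOn f2 (Icc a b) := (((chp.pow 2).mul cp).mul cb.continuousOn).div cG (fun r hr => (Gp r hr).ne')
  set u : ℝ → ℝ := fun r => betaF R r * √(2 * yF Φ E l r) * (h r0 - h r) ^ 2 / WF Φ m R E l r with hu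
  have r0m : r0 ∈ Icc a b := ⟨ha0.le, hb0.le⟩
  have r0p := pos r0 r0m
  have u0 : u r0 = 0 := by simp [hu]
  have Wne : ∀ r ∈ Icc a b, r ≠ r0 → WF Φ m R E l r ≠ 0 := by
    intro r hr hne
    rcases lt_or_gt_of_ne hne with h1 | h1
    · exact (S.Wl r ⟨ha.trans_le hr.1, h1⟩).ne'
    · exact (S.Wr r ⟨h1, hr.2.trans_lt hb⟩).ne
  have u0c : ContinuousAt u r0 := by
    have hd := WF_deriv (E := E) (l := l) P r0p
    have t1 := hasDerivAt_iff_tendsto_slope.1 hd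
    have t2 := hasDerivAt_iff_tendsto_slope.1 (hh r0 r0p)
    have t3 := t1.inv₀ (neg_ne_zero.2 (Gp r0 r0m).ne')
    have t4 : Tendsto (fun r => r - r0) (𝓝[≠] r0) (𝓝 0) := by
      have : Tendsto (fun r => r - r0) (𝓝 r0) (𝓝 (r0 - r0)) := by
        exact (continuous_id.sub continuous_const).tendsto r0
      rw [sub_self] at this
      exact this.mono_left nhdsWithin_le_nhds
    have t5 : Tendsto (fun r => betaF R r * √(2 * yF Φ E l r)) (𝓝[≠] r0) (𝓝 (betaF R r0 * √(2 * yF Φ E l r0))) := by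
      have : ContinuousAt (fun r => betaF R r * √(2 * yF Φ E l r)) r0 :=
        cb.continuousAt.mul ((continuousAt_const.mul (yF_deriv P r0p).continuousAt).sqrt)
      exact this.tendsto.mono_left nhdsWithin_le_nhds
    have t6 := ((t5.mul (t2.pow 2)).mul t3).mul t4
    rw [mul_zero] at t6
    rw [continuousAt_iff_punctured_nhds, u0]
    refine t6.congr' ?_
    filter_upwards [self_mem_nhdsWithin] with r hr
    have hr' : r - r0 ≠ 0 := sub_ne_zero.2 hr
    simp only [slope_def_field, hu, S.W0, sub_zero]
    by_cases hWz : WF Φ m R E l r = 0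
    · simp [hWz]
    · field_simp; ring
  have cu : ContinuousOn u (Icc a b) := by
    intro r hr
    by_cases hne : r = r0
    · rw [hne]; exact u0c.continuousWithinAt
    · exact (uF_deriv P hh (pos r hr) (ypos r hr) (Wne r hr hne)).continuousAt.continuousWithinAt
  have ptw : ∀ r ∈ Icc a b, r ≠ r0 → f1 r - f2 r ≤ ((h r0 - h r) ^ 2 / √(2 * yF Φ E l r)
        - 2 * betaF R r * √(2 * yF Φ E l r) * (h r0 - h r) * hp r / WF Φ m R E l r
        + betaF R r * √(2 * yF Φ E l r) * (h r0 - h r) ^ 2 * GamF Φ m n R E l r / WF Φ m R E l r ^ 2) := by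
    intro r hr hne
    have g0 := Gp r hr
    have w0 := Wne r hr hne
    have b0 := (beta_pos hR (pos r hr) (rR r hr)).1
    have p0 := ppos r hr
    have : 0 ≤ betaF R r * √(2 * yF Φ E l r) / GamF Φ m n R E l r *
      (hp r - (h r0 - h r) * GamF Φ m n R E l r / WF Φ m R E l r) ^ 2 := by positivity
    rw [hf1, hf2]
    simp only
    rw [← sub_nonneg]
    convert this using 1
    field_simp
    ring
  have fint : ∀ s ⊆ Icc a b, ∀ c d, s = Icc c d → IntegrableOn (fun r => f1 r - f2 r) s := by
    intro s hs c d e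
    rw [e] at hs ⊢
    exact ((c1.sub c2).mono hs).integrableOn_Icc
  have sl : Icc a r0 ⊆ Icc a b := Icc_subset_Icc_right hb0.le
  have sr : Icc r0 b ⊆ Icc a b := Icc_subset_Icc_left ha0.le
  have L := intervalIntegral.integral_le_sub_of_hasDeriv_right_of_le ha0.le (cu.mono sl)
    (fun x hx => (uF_deriv P hh (pos x (sl (Ioo_subset_Icc_self hx))) (ypos x (sl (Ioo_subset_Icc_self hx)))
      (Wne x (sl (Ioo_subset_Icc_self hx)) hx.2.ne)).hasDerivWithinAt) (fint _ sl a r0 rfl)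
    (fun x hx => ptw x (sl (Ioo_subset_Icc_self hx)) hx.2.ne)
  have Rr := intervalIntegral.integral_le_sub_of_hasDeriv_right_of_le hb0.le (cu.mono sr)
    (fun x hx => (uF_deriv P hh (pos x (sr (Ioo_subset_Icc_self hx))) (ypos x (sr (Ioo_subset_Icc_self hx)))
      (Wne x (sr (Ioo_subset_Icc_self hx)) hx.1.ne')).hasDerivWithinAt) (fint _ sr r0 b rfl)
    (fun x hx => ptw x (sr (Ioo_subset_Icc_self hx)) hx.1.ne')
  have am : a ∈ Icc a b := ⟨le_rfl, (ha0.trans hb0).le⟩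
  have bm : b ∈ Icc a b := ⟨(ha0.trans hb0).le, le_rfl⟩
  have ua : 0 ≤ u a := by
    have h1 := (beta_pos hR (pos a am) (rR a am)).1
    have h2 := S.Wl a ⟨ha, ha0⟩
    have h3 := ppos a am
    simp only [hu]; positivity
  have ub : u b ≤ 0 := by
    have h1 := (beta_pos hR (pos b bm) (rR b bm)).1
    have h2 := S.Wr b ⟨hb0, hb⟩
    have h3 := ppos b bm
    simp only [hu]; exact div_nonpos_of_nonneg_of_nonpos (by positivity) h2.le
  have i1 : ∀ c d, c ≤ d → Icc c d ⊆ Icc a b → IntervalIntegrable (fun r => f1 r - f2 r) volume c d := by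
    intro c d hcd hs
    exact ((c1.sub c2).mono (by rwa [uIcc_of_le hcd])).intervalIntegrable
  have tot : ∫ r in a..b, (f1 r - f2 r) ≤ 0 := by
    rw [← intervalIntegral.integral_add_adjacent_intervals (i1 a r0 ha0.le sl) (i1 r0 b hb0.le sr)]
    have e1 : u r0 = betaF R r0 * √(2 * yF Φ E l r0) * (h r0 - h r0) ^ 2 / WF Φ m R E l r0 := rfl
    linarith [L, Rr, ua, ub, u0]
  have hab := (ha0.trans hb0).le
  rw [intervalIntegral.integral_of_le hab, integral_sub
    (c1.integrableOn_Icc.mono_set Ioc_subset_Icc_self) (c2.integrableOn_Icc.mono_set Ioc_subset_Icc_self)] at tot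
  have f1n : ∀ r ∈ Ioc a b, 0 ≤ f1 r := fun r hr => by simp only [hf1]; positivity
  have f2n : ∀ r ∈ Ioc a b, 0 ≤ f2 r := fun r hr => by
    have hr' := Ioc_subset_Icc_self hr
    have h1 := (beta_pos hR (pos r hr') (rR r hr')).1
    have h2 := Gp r hr'
    simp only [hf2]; positivity
  have step : ∫⁻ r in Ioc a b, ENNReal.ofReal (f1 r) ≤ ∫⁻ r in Ioc a b, ENNReal.ofReal (f2 r) := by
    rw [← ofReal_integral_eq_lintegral_ofReal (c1.integrableOn_Icc.mono_set Ioc_subset_Icc_self)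
      ((ae_restrict_iff' measurableSet_Ioc).2 (Eventually.of_forall f1n)),
      ← ofReal_integral_eq_lintegral_ofReal (c2.integrableOn_Icc.mono_set Ioc_subset_Icc_self)
      ((ae_restrict_iff' measurableSet_Ioc).2 (Eventually.of_forall f2n))]
    exact ENNReal.ofReal_le_ofReal (by linarith)
  refine step.trans (setLIntegral_mono' measurableSet_Ioc (fun r hr => ENNReal.ofReal_le_ofReal ?_))
  have hr' := Ioc_subset_Icc_self hr
  obtain ⟨q1, q2, q3⟩ := Gam_lower P hl (pos r hr') (rR r hr') (ypos r hr')
  have b0 := (beta_pos hR (pos r hr') (rR r hr')).1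
  have hn0 := P.hn0 r (pos r hr')
  have hr0 := pos r hr'
  have D0 : 0 < n r / (4 * π * r ^ 2) + (E - Φ r) / (2 * R ^ 2) := by positivity
  simp only [hf2]
  rw [mul_assoc, mul_div_assoc]
  refine mul_le_mul_of_nonneg_left ?_ (sq_nonneg _)
  rw [div_le_div_iff₀ q2 D0]
  nlinarith [mul_le_mul_of_nonneg_left q3 (ppos r hr').le]

lemma hardy (P : PotData Φ m n C0 R e0) (hl : 0 < l) (S : WellS Φ m C0 R E l r1 r0 r2)
    (hh : ∀ r, 0 < r → HasDerivAt h (hp r) r) (hpc : ContinuousOn hp (Ioi 0)) :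
    ∫⁻ r in Ioo r1 r2, ENNReal.ofReal ((h r0 - h r) ^ 2 / √(2 * yF Φ E l r)) ≤
    ∫⁻ r in Ioo r1 r2, ENNReal.ofReal (hp r ^ 2 * (√(2 * yF Φ E l r) / (n r / (4 * π * r ^ 2) + (E - Φ r) / (2 * R ^ 2)))) := by
  have d1 : 0 < r0 - r1 := sub_pos.2 S.h10
  have d2 : 0 < r2 - r0 := sub_pos.2 S.h02
  set a : ℕ → ℝ := fun i => r1 + (r0 - r1) / (i + 2) with ha
  set b : ℕ → ℝ := fun i => r2 - (r2 - r0) / (i + 2) with hb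
  have lt : ∀ (d : ℝ) (i : ℕ), 0 < d → 0 < d / (i + 2) ∧ d / (i + 2) < d := by
    intro d i hd
    have : (0:ℝ) ≤ i := Nat.cast_nonneg i
    refine ⟨by positivity, ?_⟩
    rw [div_lt_iff₀ (by positivity)]; nlinarith
  have hU : Ioo r1 r2 = ⋃ i, Ioc (a i) (b i) := by
    ext r
    simp only [mem_iUnion, mem_Ioo, mem_Ioc]
    constructor
    · rintro ⟨h1, h2⟩
      have t : Tendsto (fun i : ℕ => ((i:ℝ) + 2)) atTop atTop :=
        tendsto_natCast_atTop_atTop.atTop_add tendsto_const_nhds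
      have t1 : Tendsto a atTop (𝓝 (r1 + 0)) := tendsto_const_nhds.add (t.const_div_atTop _)
      have t2 : Tendsto b atTop (𝓝 (r2 - 0)) := tendsto_const_nhds.sub (t.const_div_atTop _)
      rw [add_zero] at t1
      rw [sub_zero] at t2
      obtain ⟨i, hi1, hi2⟩ := ((t1.eventually (gt_mem_nhds h1)).and (t2.eventually (lt_mem_nhds h2))).exists
      exact ⟨i, hi1, hi2.le⟩
    · rintro ⟨i, h1, h2⟩
      have := lt _ i d1
      have := lt _ i d2
      simp only [ha, hb] at h1 h2
      constructor <;> linarith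
  have mono : Monotone (fun i => Ioc (a i) (b i)) := by
    intro i j hij
    have hij' : (i:ℝ) ≤ j := by exact_mod_cast hij
    have : (0:ℝ) ≤ i := Nat.cast_nonneg i
    apply Ioc_subset_Ioc
    · simp only [ha]; gcongr
    · simp only [hb]; gcongr
  have key : ∀ i, ∫⁻ r in Ioc (a i) (b i), ENNReal.ofReal ((h r0 - h r) ^ 2 / √(2 * yF Φ E l r)) ≤
      ∫⁻ r in Ioo r1 r2, ENNReal.ofReal (hp r ^ 2 * (√(2 * yF Φ E l r) / (n r / (4 * π * r ^ 2) + (E - Φ r) / (2 * R ^ 2)))) := by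
    intro i
    have q1 := lt _ i d1
    have q2 := lt _ i d2
    refine (hardy_int P hl S hh hpc (a := a i) (b := b i) ?_ ?_ ?_ ?_).trans (lintegral_mono_set ?_)
    · simp only [ha]; linarith
    · simp only [ha]; linarith
    · simp only [hb]; linarith
    · simp only [hb]; linarith
    · rw [hU]; exact subset_iUnion (fun i => Ioc (a i) (b i)) i
  conv_lhs => rw [hU]
  rw [setLIntegral_iUnion_of_directed _ mono.directed_le]
  exact iSup_le key
end

section
lemma aux_max {D d1 d2 R : ℝ} (h1 : 0 < d1) (h2 : 0 < d2) (h1R : d1 ≤ R) (h2R : d2 ≤ R)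
    (hD : D ≤ max d1 d2) :
    D * (d1 ^ (-(3/4) : ℝ) * d2 ^ (-(3/4) : ℝ)) ≤ R ^ (1/4 : ℝ) * (d1 ^ (-(3/4) : ℝ) + d2 ^ (-(3/4) : ℝ)) := by
  have key : ∀ d : ℝ, 0 < d → d ≤ R → d * d ^ (-(3/4) : ℝ) ≤ R ^ (1/4 : ℝ) := by
    intro d hd hdR
    have : d * d ^ (-(3/4) : ℝ) = d ^ (1/4 : ℝ) := by
      nth_rewrite 1 [← Real.rpow_one d]
      rw [← Real.rpow_add hd]; norm_num
    rw [this]; exact Real.rpow_le_rpow hd.le hdR (by norm_num)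
  have p1 : 0 < d1 ^ (-(3/4) : ℝ) := by positivity
  have p2 : 0 < d2 ^ (-(3/4) : ℝ) := by positivity
  have hR : 0 < R ^ (1/4 : ℝ) := by have := h1.trans_le h1R; positivity
  rcases le_total d1 d2 with h | h
  · rw [max_eq_right h] at hD
    have := mul_le_mul_of_nonneg_right (key d2 h2 h2R) p1.le
    calc _ ≤ d2 * (d1 ^ (-(3/4) : ℝ) * d2 ^ (-(3/4) : ℝ)) := by gcongr
      _ ≤ _ := by nlinarith
  · rw [max_eq_left h] at hD
    have := mul_le_mul_of_nonneg_right (key d1 h1 h1R) p2.le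
    calc _ ≤ d1 * (d1 ^ (-(3/4) : ℝ) * d2 ^ (-(3/4) : ℝ)) := by gcongr
      _ ≤ _ := by nlinarith

lemma aux_r {r r1 r0 r2 R : ℝ} (hr : 0 < r) (h1 : 0 < r1) (h10 : r1 ≤ r0) (h2 : 0 < r2) (hrR : r ≤ R) (h2R : r2 ≤ R) :
    (r ^ 2 * r1 * r2) ^ (3/4 : ℝ) / (r * r0) ≤ R ^ (5/4 : ℝ) * r1 ^ (-(1/4) : ℝ) := by
  have hR : 0 < R := hr.trans_le hrR
  have h0 : 0 < r0 := h1.trans_le h10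
  rw [div_le_iff₀ (by positivity), Real.mul_rpow (by positivity) h2.le, Real.mul_rpow (by positivity) h1.le]
  have e1 : (r ^ 2) ^ (3/4 : ℝ) = r ^ (1/2 : ℝ) * r := by
    nth_rewrite 3 [← Real.rpow_one r]
    rw [← Real.rpow_natCast, ← Real.rpow_mul hr.le, ← Real.rpow_add hr]; norm_num
  have e2 : r1 ^ (3/4 : ℝ) = r1 ^ (-(1/4) : ℝ) * r1 := by
    nth_rewrite 3 [← Real.rpow_one r1]
    rw [← Real.rpow_add h1]; norm_num
  have e3 : R ^ (5/4 : ℝ) = R ^ (1/2 : ℝ) * R ^ (3/4 : ℝ) := by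
    rw [← Real.rpow_add hR]; norm_num
  rw [e1, e2, e3]
  calc r ^ (1/2 : ℝ) * r * (r1 ^ (-(1/4) : ℝ) * r1) * r2 ^ (3/4 : ℝ)
      ≤ R ^ (1/2 : ℝ) * r * (r1 ^ (-(1/4) : ℝ) * r0) * R ^ (3/4 : ℝ) := by gcongr
    _ = _ := by ring

lemma lint_abs_rpow (R : ℝ) : ∃ K : ℝ, 0 ≤ K ∧ ∀ c, 0 < c → c ≤ R →
    ∫⁻ r in Ioo 0 R, ENNReal.ofReal (|r - c| ^ (-(3/4) : ℝ)) ≤ ENNReal.ofReal K := by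
  set f : ℝ → ℝ≥0∞ := indicator (Ioo 0 R) (fun x => ENNReal.ofReal (x ^ (-(3/4) : ℝ))) with hf
  have fm : Measurable f := by
    apply Measurable.indicator _ measurableSet_Ioo
    fun_prop
  have fin : ∫⁻ x, f x < ⊤ := by
    rw [hf, lintegral_indicator measurableSet_Ioo]
    by_cases hR : 0 ≤ R
    · have : IntegrableOn (fun x : ℝ => x ^ (-(3/4) : ℝ)) (Ioo 0 R) := by
        have := (intervalIntegral.intervalIntegrable_rpow' (a := 0) (b := R) (r := (-(3/4) : ℝ)) (by norm_num))
        rw [intervalIntegrable_iff_integrableOn_Ioo_of_le hR] at this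
        exact this
      exact this.lintegral_lt_top
    · rw [Ioo_eq_empty (by linarith)]; simp
  refine ⟨2 * (∫⁻ x, f x).toReal, by positivity, fun c hc hcR => ?_⟩
  rw [ENNReal.ofReal_mul (by norm_num), ENNReal.ofReal_toReal fin.ne]
  calc ∫⁻ r in Ioo 0 R, ENNReal.ofReal (|r - c| ^ (-(3/4) : ℝ))
      ≤ ∫⁻ r in Ioo 0 R, (f (c - r) + f (r - c)) := by
        apply setLIntegral_mono' measurableSet_Ioo
        intro r hr
        rcases lt_trichotomy r c with h | h | h
        · have : c - r ∈ Ioo 0 R := ⟨by linarith, by linarith [hr.1]⟩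
          rw [abs_of_neg (by linarith), neg_sub]
          simp only [hf, indicator_of_mem this]; exact le_self_add
        · rw [h]; simp
        · have : r - c ∈ Ioo 0 R := ⟨by linarith, by linarith [hr.2]⟩
          rw [abs_of_pos (by linarith)]
          simp only [hf, indicator_of_mem this]; exact le_add_self
    _ ≤ ∫⁻ r, (f (c - r) + f (r - c)) := setLIntegral_le_lintegral _ _
    _ = (∫⁻ r, f (c - r)) + ∫⁻ r, f (r - c) := lintegral_add_left (fm.comp (by fun_prop)) _
    _ = 2 * ∫⁻ x, f x := by
        rw [lintegral_sub_left_eq_self, lintegral_sub_right_eq_self, two_mul]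
    _ = _ := by simp

lemma Z_bound (C0 R : ℝ) : ∃ Cz : ℝ, 0 ≤ Cz ∧ ∀ (Φ m : ℝ → ℝ) (E l r1 r0 r2 : ℝ), 0 < l →
    WellS Φ m C0 R E l r1 r0 r2 →
    ∫⁻ r in Ioo 0 R, ENNReal.ofReal (|1 / r - 1 / r0| * |yF Φ E l r| ^ (-(3/4) : ℝ)) ≤
      ENNReal.ofReal (Cz * l ^ (-(7/8) : ℝ)) := by
  obtain ⟨K, hK, hKb⟩ := lint_abs_rpow R
  by_cases hpos : 0 < C0 ∧ 0 < R
  swap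
  · refine ⟨0, le_rfl, fun Φ m E l r1 r0 r2 hl S => absurd ⟨S.C0p, ?_⟩ hpos⟩
    linarith [S.h1, S.h10, S.h02, S.h2R]
  obtain ⟨hC0, hR⟩ := hpos
  set A : ℝ := (1/2 : ℝ) ^ (-(3/4) : ℝ) * R ^ (5/4 : ℝ) * (1 / (2 * C0)) ^ (-(1/8) : ℝ) * R ^ (1/4 : ℝ) with hA
  refine ⟨A * (2 * K), by positivity, fun Φ m E l r1 r0 r2 hl S => ?_⟩
  have h1 := S.h1
  have h0 := h1.trans S.h10
  have h2 := h0.trans S.h02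
  set B := A * l ^ (-(7/8) : ℝ) with hB
  have hB0 : 0 ≤ B := by positivity
  have ptw : ∀ r ∈ Ioo 0 R, r ≠ r1 → r ≠ r2 → |1 / r - 1 / r0| * |yF Φ E l r| ^ (-(3/4) : ℝ) ≤
      B * (|r - r1| ^ (-(3/4) : ℝ) + |r - r2| ^ (-(3/4) : ℝ)) := by
    intro r hr n1 n2
    have hr0 := hr.1
    have d1 : 0 < |r - r1| := abs_pos.2 (sub_ne_zero.2 n1)
    have d2 : 0 < |r - r2| := abs_pos.2 (sub_ne_zero.2 n2)
    have low : l / 2 * (|r - r1| * |r - r2|) / (r ^ 2 * r1 * r2) ≤ |yF Φ E l r| := by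
      refine le_trans (le_of_eq ?_) (S.low r hr0)
      have e1 : |1 / r1 - 1 / r| = |r - r1| / (r * r1) := by
        rw [← abs_of_pos (show 0 < r * r1 by positivity), ← abs_div]; congr 1
        field_simp
      have e2 : |1 / r - 1 / r2| = |r - r2| / (r * r2) := by
        rw [abs_sub_comm, ← abs_of_pos (show 0 < r * r2 by positivity), ← abs_div]; congr 1
        field_simp
      rw [e1, e2]; field_simp
    have e0 : |1 / r - 1 / r0| = |r - r0| / (r * r0) := by
      rw [abs_sub_comm, ← abs_of_pos (show 0 < r * r0 by positivity), ← abs_div]; congr 1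
      field_simp
    have s1 : |yF Φ E l r| ^ (-(3/4) : ℝ) ≤ (l / 2 * (|r - r1| * |r - r2|) / (r ^ 2 * r1 * r2)) ^ (-(3/4) : ℝ) :=
      Real.rpow_le_rpow_of_nonpos (by positivity) low (by norm_num)
    have s2 : (l / 2 * (|r - r1| * |r - r2|) / (r ^ 2 * r1 * r2)) ^ (-(3/4) : ℝ) =
        l ^ (-(3/4) : ℝ) * (1/2 : ℝ) ^ (-(3/4) : ℝ) * (|r - r1| ^ (-(3/4) : ℝ) * |r - r2| ^ (-(3/4) : ℝ)) * (r ^ 2 * r1 * r2) ^ (3/4 : ℝ) := by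
      rw [Real.div_rpow (by positivity) (by positivity), Real.mul_rpow (by positivity) (by positivity),
        Real.mul_rpow d1.le d2.le, Real.rpow_neg (show 0 ≤ r ^ 2 * r1 * r2 by positivity), div_inv_eq_mul,
        show l / 2 = l * (1/2) by ring, Real.mul_rpow hl.le (by norm_num)]
    have s3 := aux_r hr0 h1 S.h10.le h2 hr.2.le S.h2R
    have s4 : r1 ^ (-(1/4) : ℝ) ≤ (1 / (2 * C0)) ^ (-(1/8) : ℝ) * l ^ (-(1/8) : ℝ) := by
      have e : r1 ^ (-(1/4) : ℝ) = (r1 ^ 2) ^ (-(1/8) : ℝ) := by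
        rw [← Real.rpow_natCast, ← Real.rpow_mul h1.le]; norm_num
      rw [e, ← Real.mul_rpow (by positivity) hl.le]
      apply Real.rpow_le_rpow_of_nonpos (by positivity) _ (by norm_num)
      have := S.hl1
      rwa [div_eq_mul_one_div, mul_comm] at this
    have s5 : |r - r0| * (|r - r1| ^ (-(3/4) : ℝ) * |r - r2| ^ (-(3/4) : ℝ)) ≤
        R ^ (1/4 : ℝ) * (|r - r1| ^ (-(3/4) : ℝ) + |r - r2| ^ (-(3/4) : ℝ)) := by
      have a10 := S.h10
      have a02 := S.h02
      have a2R := S.h2R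
      have ar := hr.2
      apply aux_max d1 d2
      · rw [abs_le]; constructor <;> linarith
      · rw [abs_le]; constructor <;> linarith
      · rcases le_total r r0 with h | h
        · apply le_max_of_le_right
          rw [abs_of_nonpos (by linarith), abs_of_nonpos (by linarith)]; linarith
        · apply le_max_of_le_left
          rw [abs_of_nonneg (by linarith), abs_of_nonneg (by linarith)]; linarith
    have el : l ^ (-(7/8) : ℝ) = l ^ (-(3/4) : ℝ) * l ^ (-(1/8) : ℝ) := by
      rw [← Real.rpow_add hl]; norm_num
    have p0 : 0 ≤ (r ^ 2 * r1 * r2) ^ (3/4 : ℝ) / (r * r0) := by positivity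
    have s34 := s3.trans (mul_le_mul_of_nonneg_left s4 (by positivity : 0 ≤ R ^ (5/4 : ℝ)))
    have s6 := mul_le_mul s34 s5 (by positivity) (by positivity)
    have s7 := mul_le_mul_of_nonneg_left s6 (by positivity : 0 ≤ l ^ (-(3/4) : ℝ) * (1/2 : ℝ) ^ (-(3/4) : ℝ))
    calc |1 / r - 1 / r0| * |yF Φ E l r| ^ (-(3/4) : ℝ)
        ≤ |r - r0| / (r * r0) * (l ^ (-(3/4) : ℝ) * (1/2 : ℝ) ^ (-(3/4) : ℝ) * (|r - r1| ^ (-(3/4) : ℝ) * |r - r2| ^ (-(3/4) : ℝ)) * (r ^ 2 * r1 * r2) ^ (3/4 : ℝ)) := by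
          rw [e0, ← s2]; gcongr
      _ = l ^ (-(3/4) : ℝ) * (1/2 : ℝ) ^ (-(3/4) : ℝ) * ((r ^ 2 * r1 * r2) ^ (3/4 : ℝ) / (r * r0) *
            (|r - r0| * (|r - r1| ^ (-(3/4) : ℝ) * |r - r2| ^ (-(3/4) : ℝ)))) := by ring
      _ ≤ _ := s7
      _ = _ := by rw [hB, hA, el]; ring
  have hae : ∀ᵐ r ∂(volume.restrict (Ioo 0 R)), ENNReal.ofReal (|1 / r - 1 / r0| * |yF Φ E l r| ^ (-(3/4) : ℝ)) ≤
      ENNReal.ofReal B * (ENNReal.ofReal (|r - r1| ^ (-(3/4) : ℝ)) + ENNReal.ofReal (|r - r2| ^ (-(3/4) : ℝ))) := by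
    have n1 : ∀ᵐ r ∂(volume.restrict (Ioo 0 R)), r ≠ r1 := ae_restrict_of_ae (Measure.ae_ne volume r1)
    have n2 : ∀ᵐ r ∂(volume.restrict (Ioo 0 R)), r ≠ r2 := ae_restrict_of_ae (Measure.ae_ne volume r2)
    filter_upwards [n1, n2, ae_restrict_mem measurableSet_Ioo] with r a b hr
    rw [← ENNReal.ofReal_add (by positivity) (by positivity), ← ENNReal.ofReal_mul hB0]
    exact ENNReal.ofReal_le_ofReal (ptw r hr a b)
  refine (lintegral_mono_ae hae).trans ?_
  rw [lintegral_const_mul _ (by fun_prop), lintegral_add_left (by fun_prop)]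
  calc _ ≤ ENNReal.ofReal B * (ENNReal.ofReal K + ENNReal.ofReal K) := by
        gcongr
        · exact hKb r1 h1 (S.h10.le.trans (S.h02.le.trans S.h2R))
        · exact hKb r2 h2 S.h2R
    _ = _ := by
        rw [← ENNReal.ofReal_add hK hK, ← ENNReal.ofReal_mul hB0]; congr 1; rw [hB]; ring

lemma h_holder {h hp : ℝ → ℝ} {N : ℝ} (hN : 0 ≤ N) (hh : ∀ r, 0 < r → HasDerivAt h (hp r) r)
    (hpc : ContinuousOn hp (Ioi 0))
    (hNb : ∫⁻ r in Ioi 0, ENNReal.ofReal (hp r ^ 2 * r ^ 2) ≤ ENNReal.ofReal N) {a b : ℝ} (ha : 0 < a) (hb : 0 < b) :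
    (h a - h b) ^ 2 ≤ N * |1 / a - 1 / b| := by
  wlog hab : a ≤ b generalizing a b
  · have := this hb ha (le_of_not_ge hab)
    rw [abs_sub_comm]; nlinarith
  rcases hab.eq_or_lt with rfl | hlt
  · simp
  have sub : Icc a b ⊆ Ioi 0 := fun r hr => ha.trans_le hr.1
  have cp : ContinuousOn hp (Icc a b) := hpc.mono sub
  have ci : ContinuousOn (fun r : ℝ => 1 / r ^ 2) (Icc a b) :=
    continuousOn_const.div (by fun_prop) (fun r hr => by have := sub hr; simp at this; positivity)
  have u : uIcc a b = Icc a b := uIcc_of_le hab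
  have d0 : 0 < 1 / a - 1 / b := sub_pos.2 (one_div_lt_one_div_of_lt ha hlt)
  have I1 : ∫ r in a..b, hp r = h b - h a := by
    apply intervalIntegral.integral_eq_sub_of_hasDerivAt
    · intro r hr; rw [u] at hr; exact hh r (sub hr)
    · exact (by rwa [u] : ContinuousOn hp (uIcc a b)).intervalIntegrable
  have I2 : ∫ r in a..b, 1 / r ^ 2 = 1 / a - 1 / b := by
    have : ∫ r in a..b, 1 / r ^ 2 = (-(1 / b)) - (-(1 / a)) := by
      apply intervalIntegral.integral_eq_sub_of_hasDerivAt (f := fun r => -(1 / r))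
      · intro r hr; rw [u] at hr
        have hr0 : 0 < r := sub hr
        refine ((hasDerivAt_const r (1:ℝ)).div (hasDerivAt_id r) hr0.ne').neg.congr_deriv ?_
        simp
        ring
      · exact (by rwa [u] : ContinuousOn (fun r : ℝ => 1 / r ^ 2) (uIcc a b)).intervalIntegrable
    rw [this]; ring
  have c3 : ContinuousOn (fun r => hp r ^ 2 * r ^ 2) (Icc a b) := (cp.pow 2).mul (by fun_prop)
  have I3 : ∫ r in a..b, hp r ^ 2 * r ^ 2 ≤ N := by
    rw [intervalIntegral.integral_of_le hab, ← ENNReal.ofReal_le_ofReal_iff hN,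
      ofReal_integral_eq_lintegral_ofReal (c3.integrableOn_Icc.mono_set Ioc_subset_Icc_self)
        (Eventually.of_forall (fun r => by positivity))]
    exact (lintegral_mono_set (fun r hr => ha.trans hr.1)).trans hNb
  set c := (h b - h a) / (1 / a - 1 / b) with hc
  have I4 : ∫ r in a..b, (2 * c * hp r - c ^ 2 * (1 / r ^ 2)) ≤ ∫ r in a..b, hp r ^ 2 * r ^ 2 := by
    apply intervalIntegral.integral_mono_on hab
    · exact (by rw [u]; exact (continuousOn_const.mul cp).sub (continuousOn_const.mul ci) :
        ContinuousOn (fun r => 2 * c * hp r - c ^ 2 * (1 / r ^ 2)) (uIcc a b)).intervalIntegrable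
    · exact (by rwa [u] : ContinuousOn (fun r => hp r ^ 2 * r ^ 2) (uIcc a b)).intervalIntegrable
    · intro r hr
      have hr0 : 0 < r := sub hr
      have : 0 ≤ (hp r * r - c * (1 / r)) ^ 2 := sq_nonneg _
      have e : (hp r * r - c * (1 / r)) ^ 2 = hp r ^ 2 * r ^ 2 - 2 * c * hp r + c ^ 2 * (1 / r ^ 2) := by
        field_simp; ring
      linarith
  rw [intervalIntegral.integral_sub, intervalIntegral.integral_const_mul, intervalIntegral.integral_const_mul, I1, I2] at I4
  · have hcd : c * (1 / a - 1 / b) = h b - h a := by rw [hc]; field_simp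
    rw [abs_of_pos d0]
    have e5 : c ^ 2 * (1 / a - 1 / b) = c * (h b - h a) := by rw [← hcd]; ring
    have : c * (h b - h a) ≤ N := by linarith
    have e6 : c * (h b - h a) * (1 / a - 1 / b) = (h b - h a) ^ 2 := by rw [← hcd]; ring
    nlinarith [mul_le_mul_of_nonneg_right this d0.le]
  · exact (by rw [u]; exact (continuousOn_const.mul cp) : ContinuousOn (fun r => 2 * c * hp r) (uIcc a b)).intervalIntegrable
  · exact (by rw [u]; exact (continuousOn_const.mul ci) : ContinuousOn (fun r => c ^ 2 * (1 / r ^ 2)) (uIcc a b)).intervalIntegrable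

lemma wellT {Φ m n : ℝ → ℝ} {C0 R e0 E l r1 r0 r2 : ℝ} {h hp : ℝ → ℝ} {N θ μ ε1 Cz : ℝ}
    (P : PotData Φ m n C0 R e0) (hE : E ≤ e0) (hl : 0 < l) (S : WellS Φ m C0 R E l r1 r0 r2)
    (hN : 0 ≤ N) (hh : ∀ r, 0 < r → HasDerivAt h (hp r) r) (hpc : ContinuousOn hp (Ioi 0))
    (hNb : ∫⁻ r in Ioi 0, ENNReal.ofReal (hp r ^ 2 * r ^ 2) ≤ ENNReal.ofReal N)
    (hb : ∀ r, 0 < r → |h r| ≤ ε1) (hθ0 : 0 < θ) (hθ : θ ≤ 1 / 2) (hμ : 0 < μ) (hε : 2 * ε1 ≤ θ * μ)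
    (hμe : μ ≤ -e0 / 2)
    (hZ : ∫⁻ r in Ioo 0 R, ENNReal.ofReal (|1 / r - 1 / r0| * |yF Φ E l r| ^ (-(3/4) : ℝ)) ≤
      ENNReal.ofReal (Cz * l ^ (-(7/8) : ℝ))) :
    ∫⁻ r in Ioi 0, ENNReal.ofReal (Rf (yF Φ E l r) (h r0 - h r)) ≤
      ENNReal.ofReal (1 + θ) * (∫⁻ r in Ioo r1 r2, ENNReal.ofReal (hp r ^ 2 * (√(2 * yF Φ E l r) / (n r / (4 * π * r ^ 2) + (E - Φ r) / (2 * R ^ 2))))) +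
      ENNReal.ofReal (4 * N * μ ^ (1/4 : ℝ)) * ENNReal.ofReal (Cz * l ^ (-(7/8) : ℝ)) := by
  have h1 := S.h1
  have h0 := h1.trans S.h10
  have h2 := h0.trans S.h02
  have e0n := P.e0neg
  have hae : ∀ᵐ r ∂(volume.restrict (Ioi (0:ℝ))), ENNReal.ofReal (Rf (yF Φ E l r) (h r0 - h r)) ≤
     ENNReal.ofReal (1 + θ) * (Ioo r1 r2).indicator (fun r => ENNReal.ofReal ((h r0 - h r) ^ 2 / √(2 * yF Φ E l r))) r
      + ENNReal.ofReal (4 * N * μ ^ (1/4 : ℝ)) * (Ioo 0 R).indicator (fun r => ENNReal.ofReal (|1 / r - 1 / r0| * |yF Φ E l r| ^ (-(3/4) : ℝ))) r := by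
    have n1 : ∀ᵐ r ∂(volume.restrict (Ioi (0:ℝ))), r ≠ r1 := ae_restrict_of_ae (Measure.ae_ne volume r1)
    have n2 : ∀ᵐ r ∂(volume.restrict (Ioi (0:ℝ))), r ≠ r2 := ae_restrict_of_ae (Measure.ae_ne volume r2)
    filter_upwards [n1, n2, ae_restrict_mem measurableSet_Ioi] with r a b hr
    have hr : 0 < r := hr
    have hk : |h r0 - h r| ≤ 2 * ε1 := by
      have := abs_sub (h r0) (h r)
      linarith [hb r0 h0, hb r hr]
    rcases lt_or_ge μ (yF Φ E l r) with hy | hy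
    · refine le_trans ?_ le_self_add
      rw [indicator_of_mem ((S.well r hr).1 (hμ.trans hy)), ← ENNReal.ofReal_mul (by positivity)]
      apply ENNReal.ofReal_le_ofReal
      apply Rf_b1 (hμ.trans hy) hθ
      nlinarith
    rcases lt_or_ge (yF Φ E l r) (-μ) with hy' | hy'
    · rw [Rf_b3 (by linarith)]
      · simp
      · have := (abs_le.1 hk).2
        nlinarith
    · have habs : |yF Φ E l r| ≤ μ := abs_le.2 ⟨hy', hy⟩
      have hrR : r < R := by
        by_contra hh
        have := P.hΦR r (not_lt.1 hh)
        unfold yF at hy'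
        have : 0 < l / (2 * r ^ 2) := by positivity
        linarith
      have yne : 0 < |yF Φ E l r| := by
        refine lt_of_lt_of_le ?_ (S.low r hr)
        have q1 : (1 / r1 - 1 / r) ≠ 0 := by
          rw [sub_ne_zero]; intro hh; apply a; field_simp at hh; linarith
        have q2 : (1 / r - 1 / r2) ≠ 0 := by
          rw [sub_ne_zero]; intro hh; apply b; field_simp at hh; linarith
        positivity
      refine le_trans ?_ le_add_self
      rw [indicator_of_mem (show r ∈ Ioo 0 R from ⟨hr, hrR⟩), ← ENNReal.ofReal_mul (by positivity)]
      apply ENNReal.ofReal_le_ofReal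
      refine (Rf_b2 (abs_pos.1 yne)).trans ?_
      have q3 := h_holder hN hh hpc hNb h0 hr
      have q4 : (√|yF Φ E l r|)⁻¹ ≤ μ ^ (1/4 : ℝ) * |yF Φ E l r| ^ (-(3/4) : ℝ) := by
        have e : (√|yF Φ E l r|)⁻¹ = |yF Φ E l r| ^ (1/4 : ℝ) * |yF Φ E l r| ^ (-(3/4) : ℝ) := by
          rw [← Real.rpow_add yne, Real.sqrt_eq_rpow, ← Real.rpow_neg yne.le]; norm_num
        rw [e]; gcongr
      rw [div_eq_mul_inv]
      calc 4 * ((h r0 - h r) ^ 2 * (√|yF Φ E l r|)⁻¹) ≤ 4 * ((N * |1 / r0 - 1 / r|) * (μ ^ (1/4 : ℝ) * |yF Φ E l r| ^ (-(3/4) : ℝ))) := by gcongr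
        _ = _ := by rw [abs_sub_comm]; ring
  have am : ∀ c : ℝ≥0∞, ∀ g : ℝ → ℝ≥0∞, ∀ s : Set ℝ, MeasurableSet s → s ⊆ Ioi 0 → c ≠ ⊤ →
      ∫⁻ r in Ioi (0:ℝ), c * s.indicator g r = c * ∫⁻ r in s, g r := by
    intro c g s hs hs0 hc
    rw [lintegral_const_mul' _ _ hc, lintegral_indicator hs, Measure.restrict_restrict hs,
      inter_eq_left.2 hs0]
  have meas : Measurable (fun r => ENNReal.ofReal (4 * N * μ ^ (1/4 : ℝ)) * (Ioo 0 R).indicator (fun r => ENNReal.ofReal (|1 / r - 1 / r0| * |yF Φ E l r| ^ (-(3/4) : ℝ))) r) := by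
    have cy : ContinuousOn (yF Φ E l) (Ioo 0 R) := fun r hr => (yF_deriv P hr.1).continuousAt.continuousWithinAt
    have : ((Ioo 0 R).indicator (fun r => ENNReal.ofReal (|1 / r - 1 / r0| * |yF Φ E l r| ^ (-(3/4) : ℝ)))) =
      (Ioo 0 R).indicator (fun r => ENNReal.ofReal (|1 / r - 1 / r0| * |(Ioo 0 R).indicator (yF Φ E l) r| ^ (-(3/4) : ℝ))) := by
      ext r
      by_cases hr : r ∈ Ioo 0 R
      · simp [hr]
      · simp [hr]
    rw [this]
    have my : Measurable ((Ioo 0 R).indicator (yF Φ E l)) := by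
      classical
      rw [← piecewise_eq_indicator]
      exact cy.measurable_piecewise continuousOn_const measurableSet_Ioo
    refine Measurable.const_mul (Measurable.indicator ?_ measurableSet_Ioo) _
    apply Measurable.ennreal_ofReal
    refine Measurable.mul (by fun_prop) ?_
    exact (measurable_norm.comp my).pow_const _
  refine (lintegral_mono_ae hae).trans ?_
  rw [lintegral_add_right _ meas, am _ _ _ measurableSet_Ioo (fun r hr => h1.trans hr.1) ENNReal.ofReal_ne_top,
    am _ _ _ measurableSet_Ioo (fun r hr => hr.1) ENNReal.ofReal_ne_top]
  exact add_le_add (mul_le_mul' le_rfl (hardy P hl S hh hpc)) (mul_le_mul' le_rfl hZ)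
end

section
def quad : Set (ℝ × ℝ) := Ioi 0 ×ˢ Ioi 0

lemma meas_quad : MeasurableSet quad := measurableSet_Ioi.prod measurableSet_Ioi

structure LevData (Φ n : ℝ → ℝ) (E : ℝ × ℝ → ℝ) (C0 e0 S ρm : ℝ) : Prop where
  hEm : Measurable E
  hEle : ∀ q, E q ≤ e0
  hEge : ∀ q, -C0 ≤ E q
  hES : ∀ q, S ≤ q.2 → E q = -C0
  hn : ∀ r, 0 < r → ∫⁻ q in quad, ENNReal.ofReal (√(2 * yF Φ (E q) q.1 r)) = ENNReal.ofReal (n r / (8 * π ^ 2))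
  hρ : ∀ r, 0 < r → n r / (4 * π * r ^ 2) ≤ ρm
  S0 : 0 ≤ S

lemma yF_meas {E : ℝ × ℝ → ℝ} (hE : Measurable E) (Φ : ℝ → ℝ) (r : ℝ) : Measurable (fun q => yF Φ (E q) q.1 r) := by
  unfold yF; fun_prop

lemma gap {Φ m n : ℝ → ℝ} {E : ℝ × ℝ → ℝ} {C0 R e0 S ρm : ℝ} (P : PotData Φ m n C0 R e0)
    (L : LevData Φ n E C0 e0 S ρm) : ∃ δ : ℝ, 0 < δ ∧ δ < 1 ∧ ∀ r, 0 < r →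
    ∫⁻ q in quad, ENNReal.ofReal (√(2 * yF Φ (E q) q.1 r) / (n r / (4 * π * r ^ 2) + (E q - Φ r) / (2 * R ^ 2)))
      ≤ ENNReal.ofReal ((1 - δ) * r ^ 2 / (2 * π)) := by
  have hR := P.R0
  have hρ0 : 0 ≤ ρm := le_trans (div_nonneg (P.hn0 1 one_pos) (by positivity)) (L.hρ 1 one_pos)
  have hS := L.S0
  set A : ℝ := 8 * π * √2 * S * √ρm with hA
  have hA0 : 0 ≤ A := by positivity
  set t : ℝ := 1 / (1 + A) with ht
  have t0 : 0 < t := by positivity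
  have t1 : t ≤ 1 := by rw [ht, div_le_one (by positivity)]; linarith
  have tA : A * t ≤ 1 := by rw [ht, mul_one_div, div_le_one (by positivity)]; linarith
  set b : ℝ := 1 / (2 * R ^ 2) with hb
  have b0 : 0 < b := by positivity
  set τ : ℝ := t ^ 2 with hτ
  have τ0 : 0 < τ := by positivity
  set κ : ℝ := b * τ / (1 + b * τ) with hκ
  have κ0 : 0 < κ := by positivity
  have κ1 : κ < 1 := by rw [hκ, div_lt_one (by positivity)]; linarith
  have κe : 1 - κ = 1 / (1 + b * τ) := by rw [hκ]; field_simp; ring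
  refine ⟨κ / 2, by positivity, by linarith, fun r hr => ?_⟩
  set ρ := n r / (4 * π * r ^ 2) with hρd
  have nr : n r = ρ * (4 * π * r ^ 2) := by rw [hρd]; field_simp
  have hn := L.hn r hr
  have hρn : 0 ≤ ρ := div_nonneg (P.hn0 r hr) (by positivity)
  rcases hρn.eq_or_lt with h0 | hρp
  · rw [nr, ← h0] at hn
    simp only [zero_mul, zero_div, ENNReal.ofReal_zero] at hn
    rw [lintegral_eq_zero_iff (by have := yF_meas L.hEm Φ r; fun_prop)] at hn
    have : ∫⁻ q in quad, ENNReal.ofReal (√(2 * yF Φ (E q) q.1 r) / (ρ + (E q - Φ r) / (2 * R ^ 2))) = 0 := by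
      rw [← lintegral_zero (μ := volume.restrict quad)]
      apply lintegral_congr_ae
      filter_upwards [hn] with q hq
      have : √(2 * yF Φ (E q) q.1 r) = 0 := le_antisymm (ENNReal.ofReal_eq_zero.1 hq) (Real.sqrt_nonneg _)
      rw [this]; simp
    rw [this]; exact zero_le
  set box : Set (ℝ × ℝ) := Ioo 0 (2 * (τ * ρ) * r ^ 2) ×ˢ Ioo 0 S with hbox
  have mbox : MeasurableSet box := measurableSet_Ioo.prod measurableSet_Ioo
  have ptw : ∀ q ∈ quad, ENNReal.ofReal (√(2 * yF Φ (E q) q.1 r) / (ρ + (E q - Φ r) / (2 * R ^ 2))) ≤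
      ENNReal.ofReal ((1 - κ) / ρ) * ENNReal.ofReal (√(2 * yF Φ (E q) q.1 r)) +
      box.indicator (fun _ => ENNReal.ofReal (κ / ρ * (t * √2 * √ρ))) q := by
    rintro ⟨l, s⟩ ⟨hl, hs⟩
    simp only [mem_Ioi] at hl hs
    simp only
    rcases le_or_gt (yF Φ (E (l, s)) l r) 0 with hy | hy
    · rw [Real.sqrt_eq_zero_of_nonpos (by linarith)]; simp
    have hl2 : 0 < l / (2 * r ^ 2) := by positivity
    set Q := E (l, s) - Φ r with hQ
    have yQ : yF Φ (E (l, s)) l r = Q - l / (2 * r ^ 2) := by unfold yF; rw [hQ]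
    rw [yQ] at hy ⊢
    have hQ0 : 0 < Q := by linarith
    set p := √(2 * (Q - l / (2 * r ^ 2))) with hp
    have hp0 : 0 ≤ p := Real.sqrt_nonneg _
    have e : Q / (2 * R ^ 2) = b * Q := by rw [hb]; ring
    rw [e, ← ENNReal.ofReal_mul (by apply div_nonneg _ hρn; linarith)]
    rcases le_or_gt Q (τ * ρ) with hq | hq
    · have hsS : s < S := by
        by_contra hh
        have h1 := L.hES (l, s) (not_lt.1 hh)
        have h2 := P.hΦl r hr
        linarith
      have hlb : l < 2 * (τ * ρ) * r ^ 2 := by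
        have : l / (2 * r ^ 2) < τ * ρ := by linarith
        rw [div_lt_iff₀ (by positivity)] at this
        linarith
      rw [indicator_of_mem (show (l, s) ∈ box from ⟨⟨hl, hlb⟩, ⟨hs, hsS⟩⟩), ← ENNReal.ofReal_add (by
        have : 0 ≤ 1 - κ := by linarith
        positivity) (by positivity)]
      apply ENNReal.ofReal_le_ofReal
      have hpb : p ≤ t * √2 * √ρ := by
        have : t * √2 * √ρ = √(2 * (τ * ρ)) := by
          rw [hτ, show 2 * (t ^ 2 * ρ) = t ^ 2 * (2 * ρ) by ring, Real.sqrt_mul (by positivity), Real.sqrt_sq t0.le,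
            Real.sqrt_mul (by norm_num)]; ring
        rw [this]
        apply Real.sqrt_le_sqrt; linarith
      calc p / (ρ + b * Q) ≤ p / ρ := by
            apply div_le_div_of_nonneg_left hp0 hρp
            have : 0 < b * Q := by positivity
            linarith
        _ = (1 - κ) / ρ * p + κ / ρ * p := by ring
        _ ≤ _ := by gcongr
    · refine le_trans (ENNReal.ofReal_le_ofReal ?_) le_self_add
      rw [κe, div_div, one_div, inv_mul_eq_div]
      apply div_le_div_of_nonneg_left hp0 (by positivity)
      nlinarith
  refine (setLIntegral_mono' meas_quad ptw).trans ?_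
  rw [lintegral_add_right _ (measurable_const.indicator mbox), lintegral_const_mul' _ _ ENNReal.ofReal_ne_top, hn,
    lintegral_indicator_const mbox]
  have vb : (volume.restrict quad) box ≤ ENNReal.ofReal (2 * (τ * ρ) * r ^ 2 * S) := by
    refine (Measure.restrict_apply_le _ _).trans ?_
    rw [hbox, Measure.volume_eq_prod, Measure.prod_prod, Real.volume_Ioo, Real.volume_Ioo, sub_zero, sub_zero, ← ENNReal.ofReal_mul (by positivity)]
  have k1 : 0 ≤ 1 - κ := by linarith
  calc _ ≤ ENNReal.ofReal ((1 - κ) / ρ) * ENNReal.ofReal (n r / (8 * π ^ 2)) +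
      ENNReal.ofReal (κ / ρ * (t * √2 * √ρ)) * ENNReal.ofReal (2 * (τ * ρ) * r ^ 2 * S) := by gcongr
    _ = ENNReal.ofReal ((1 - κ) / ρ * (n r / (8 * π ^ 2)) + κ / ρ * (t * √2 * √ρ) * (2 * (τ * ρ) * r ^ 2 * S)) := by
      rw [← ENNReal.ofReal_mul (by positivity), ← ENNReal.ofReal_mul (by positivity), ← ENNReal.ofReal_add]
      · have := P.hn0 r hr
        positivity
      · positivity
    _ ≤ _ := by
      apply ENNReal.ofReal_le_ofReal
      have e1 : (1 - κ) / ρ * (n r / (8 * π ^ 2)) = (1 - κ) * r ^ 2 / (2 * π) := by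
        rw [nr]; field_simp; ring
      have e2 : κ / ρ * (t * √2 * √ρ) * (2 * (τ * ρ) * r ^ 2 * S) = κ * r ^ 2 / (4 * π) * ((8 * π * √2 * S * √ρ * t) * t ^ 2) := by
        rw [hτ]; field_simp; ring
      have e3 : (8 * π * √2 * S * √ρ * t) * t ^ 2 ≤ 1 := by
        have q1 : 8 * π * √2 * S * √ρ * t ≤ 1 := by
          refine le_trans ?_ tA
          rw [hA]
          have := Real.sqrt_le_sqrt (L.hρ r hr)
          gcongr
        have q2 : t ^ 2 ≤ 1 := by nlinarith
        calc _ ≤ 1 * (1:ℝ) := by gcongr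
          _ = 1 := one_mul 1
      rw [e1, e2]
      have q3 : κ * r ^ 2 / (4 * π) * ((8 * π * √2 * S * √ρ * t) * t ^ 2) ≤ κ * r ^ 2 / (4 * π) * 1 := by gcongr
      calc _ ≤ (1 - κ) * r ^ 2 / (2 * π) + κ * r ^ 2 / (4 * π) * 1 := by gcongr
        _ = _ := by field_simp; ring

def r0F (Φ m : ℝ → ℝ) (R : ℝ) (E : ℝ × ℝ → ℝ) (q : ℝ × ℝ) : ℝ :=
  ⨅ i : ℚ, if (0:ℝ) < i ∧ 0 < yF Φ (E q) q.1 i ∧ WF Φ m R (E q) q.1 i < 0 then (i:ℝ) else R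

def goodF (Φ : ℝ → ℝ) (E : ℝ × ℝ → ℝ) : Set (ℝ × ℝ) := {q | ∃ i : ℚ, (0:ℝ) < i ∧ 0 < yF Φ (E q) q.1 i}

lemma r0F_meas {E : ℝ × ℝ → ℝ} (hE : Measurable E) (Φ m : ℝ → ℝ) (R : ℝ) : Measurable (r0F Φ m R E) := by
  unfold r0F
  apply Measurable.iInf
  intro i
  refine Measurable.ite ?_ measurable_const measurable_const
  have h1 := yF_meas hE Φ i
  have h2 : Measurable (fun q : ℝ × ℝ => WF Φ m R (E q) q.1 i) := by
    unfold WF ypF; fun_prop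
  exact (MeasurableSet.const _).inter ((measurableSet_lt measurable_const h1).inter (measurableSet_lt h2 measurable_const))

lemma goodF_meas {E : ℝ × ℝ → ℝ} (hE : Measurable E) (Φ : ℝ → ℝ) : MeasurableSet (goodF Φ E) := by
  have : goodF Φ E = ⋃ i : ℚ, {q | (0:ℝ) < i ∧ 0 < yF Φ (E q) q.1 i} := by ext q; simp [goodF]
  rw [this]
  exact MeasurableSet.iUnion (fun i => (MeasurableSet.const _).inter (measurableSet_lt measurable_const (yF_meas hE Φ i)))

lemma r0F_eq {Φ m : ℝ → ℝ} {C0 R : ℝ} {E : ℝ × ℝ → ℝ} {q : ℝ × ℝ} {r1 r0 r2 : ℝ}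
    (S : WellS Φ m C0 R (E q) q.1 r1 r0 r2) : r0F Φ m R E q = r0 := by
  unfold r0F
  have h0 := S.h1.trans S.h10
  have lb : ∀ i : ℚ, r0 ≤ if (0:ℝ) < i ∧ 0 < yF Φ (E q) q.1 i ∧ WF Φ m R (E q) q.1 i < 0 then (i:ℝ) else R := by
    intro i
    split_ifs with h
    · obtain ⟨a, b, c⟩ := h
      have := (S.well i a).1 b
      by_contra hh
      have hh := not_le.1 hh
      exact absurd (S.Wl i ⟨this.1, hh⟩) (by linarith)
    · exact (S.h02.trans_le S.h2R).le
  apply le_antisymm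
  · apply le_of_forall_gt_imp_ge_of_dense
    intro c hc
    obtain ⟨i, hi1, hi2⟩ := exists_rat_btwn (lt_min hc S.h02)
    have hi2' := hi2.trans_le (min_le_right _ _)
    have hi3 := hi2.trans_le (min_le_left _ _)
    refine (ciInf_le ⟨r0, by rintro _ ⟨j, rfl⟩; exact lb j⟩ i).trans ?_
    rw [if_pos ⟨h0.trans hi1, (S.well i (h0.trans hi1)).2 ⟨S.h10.trans hi1, hi2'⟩, S.Wr i ⟨hi1, hi2'⟩⟩]
    exact hi3.le
  · exact le_ciInf lb

lemma not_good {Φ m n : ℝ → ℝ} {C0 R e0 : ℝ} (P : PotData Φ m n C0 R e0) {E : ℝ × ℝ → ℝ} {q : ℝ × ℝ} (hq : q ∉ goodF Φ E)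
    {r : ℝ} (hr : 0 < r) : yF Φ (E q) q.1 r ≤ 0 := by
  by_contra hy
  apply hq
  have hc : ContinuousAt (yF Φ (E q) q.1) r := (yF_deriv P hr).continuousAt
  have ev : ∀ᶠ x in 𝓝 r, 0 < x ∧ 0 < yF Φ (E q) q.1 x :=
    (lt_mem_nhds hr).and (hc.eventually (lt_mem_nhds (not_le.1 hy)))
  obtain ⟨U, hU, hUo, hrU⟩ := eventually_nhds_iff.1 ev
  obtain ⟨x, hx, i, rfl⟩ := Rat.denseRange_cast (𝕜 := ℝ) |>.inter_open_nonempty U hUo ⟨r, hrU⟩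
  exact ⟨i, hU _ hx⟩

theorem core {Φ m n : ℝ → ℝ} {E : ℝ × ℝ → ℝ} {C0 R e0 S ρm : ℝ} (P : PotData Φ m n C0 R e0)
    (L : LevData Φ n E C0 e0 S ρm) : ∃ ε1 : ℝ, 0 < ε1 ∧ ∃ δ : ℝ, 0 < δ ∧ δ < 1 ∧
    ∀ (h hp : ℝ → ℝ) (N : ℝ), 0 ≤ N → (∀ r, 0 < r → HasDerivAt h (hp r) r) → ContinuousOn hp (Ioi 0) →
      ∫⁻ r in Ioi 0, ENNReal.ofReal (hp r ^ 2 * r ^ 2) ≤ ENNReal.ofReal N →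
      (∀ r, 0 < r → |h r| ≤ ε1) →
      ∃ lam : ℝ × ℝ → ℝ, Measurable lam ∧ (∀ q, |lam q| ≤ ε1) ∧
        ∫⁻ q in quad, ∫⁻ r in Ioi 0, ∫⁻ w : ℝ, ENNReal.ofReal (tInt (yF Φ (E q) q.1 r) (lam q - h r) w) ≤
          ENNReal.ofReal ((1 - δ) * N / (2 * π)) := by
  classical
  obtain ⟨δ, hδ, hδ1, hgap⟩ := gap P L
  obtain ⟨Cz, hCz, hZ⟩ := Z_bound C0 R
  have hR := P.R0
  have hS := L.S0
  have e0n := P.e0neg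
  have hC0 : 0 < C0 := by have := L.hEle (0,0); have := L.hEge (0,0); linarith
  set Lm := 2 * C0 * R ^ 2 with hLm
  set box : Set (ℝ × ℝ) := Ioo 0 Lm ×ˢ Ioo 0 S with hbox
  have mbox : MeasurableSet box := measurableSet_Ioo.prod measurableSet_Ioo
  obtain ⟨I, hI0, hI⟩ : ∃ I : ℝ, 0 ≤ I ∧ ∫⁻ q in box, ENNReal.ofReal (q.1 ^ (-(7/8) : ℝ)) ≤ ENNReal.ofReal I := by
    have fin : ∫⁻ x in Ioo 0 Lm, ENNReal.ofReal (x ^ (-(7/8) : ℝ)) < ⊤ := by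
      have : IntegrableOn (fun x : ℝ => x ^ (-(7/8) : ℝ)) (Ioo 0 Lm) := by
        have := (intervalIntegral.intervalIntegrable_rpow' (a := 0) (b := Lm) (r := (-(7/8) : ℝ)) (by norm_num))
        rw [intervalIntegrable_iff_integrableOn_Ioo_of_le (by positivity)] at this
        exact this
      exact this.lintegral_lt_top
    have hb : ∫⁻ q in box, ENNReal.ofReal (q.1 ^ (-(7/8) : ℝ)) = ENNReal.ofReal S * ∫⁻ x in Ioo 0 Lm, ENNReal.ofReal (x ^ (-(7/8) : ℝ)) := by
      rw [hbox, Measure.volume_eq_prod, ← Measure.prod_restrict, lintegral_prod _ (by fun_prop)]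
      simp only [lintegral_const, Measure.restrict_apply MeasurableSet.univ, univ_inter, Real.volume_Ioo, sub_zero]
      rw [lintegral_mul_const' _ _ ENNReal.ofReal_ne_top, mul_comm]
    refine ⟨(∫⁻ q in box, ENNReal.ofReal (q.1 ^ (-(7/8) : ℝ))).toReal, by positivity, ?_⟩
    rw [ENNReal.ofReal_toReal]
    rw [hb]; exact ENNReal.mul_ne_top ENNReal.ofReal_ne_top fin.ne
  set θ := min (1/2) (δ / 4) with hθ
  have θ0 : 0 < θ := by positivity
  -- choose nu with mu = nu^4
  set B : ℝ := 32 * π * Cz * I with hB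
  have hB0 : 0 ≤ B := by positivity
  set ν : ℝ := min (δ / (1 + B)) 1 with hν
  have ν0 : 0 < ν := by positivity
  have νB : B * ν ≤ δ := by
    calc B * ν ≤ B * (δ / (1 + B)) := by gcongr; exact min_le_left _ _
      _ ≤ δ := by
        rw [mul_div_assoc', div_le_iff₀ (by positivity)]; nlinarith
  set μ : ℝ := min (ν ^ 4) (-e0 / 2) with hμ
  have μ0 : 0 < μ := lt_min (by positivity) (by linarith)
  have μν : μ ^ (1/4 : ℝ) ≤ ν := by
    calc μ ^ (1/4 : ℝ) ≤ (ν ^ 4) ^ (1/4 : ℝ) := Real.rpow_le_rpow μ0.le (min_le_left _ _) (by norm_num)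
      _ = ν := by rw [← Real.rpow_natCast, ← Real.rpow_mul ν0.le]; norm_num
  refine ⟨θ * μ / 2, by positivity, δ / 2, by positivity, by linarith, ?_⟩
  intro h hp N hN hh hpc hNb hhb
  set lam : ℝ × ℝ → ℝ := fun q => (goodF Φ E).piecewise (fun q => (Ioi (0:ℝ)).indicator h (r0F Φ m R E q)) (fun _ => -(θ * μ / 2)) q with hlam
  have mh : Measurable ((Ioi (0:ℝ)).indicator h) := by
    classical
    rw [← piecewise_eq_indicator]
    have ch : ContinuousOn h (Ioi 0) := fun r hr => (hh r hr).continuousAt.continuousWithinAt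
    exact ch.measurable_piecewise continuousOn_const measurableSet_Ioi
  refine ⟨lam, ?_, ?_, ?_⟩
  · exact Measurable.piecewise (goodF_meas L.hEm Φ) (mh.comp (r0F_meas L.hEm Φ m R)) measurable_const
  · intro q
    simp only [hlam]
    by_cases hq : q ∈ goodF Φ E
    · rw [piecewise_eq_of_mem _ _ _ hq]
      by_cases h0 : r0F Φ m R E q ∈ Ioi (0:ℝ)
      · rw [indicator_of_mem h0]; exact hhb _ h0
      · rw [indicator_of_notMem h0]; simp; positivity
    · rw [piecewise_eq_of_notMem _ _ _ hq, abs_neg, abs_of_pos (by positivity)]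
  simp only [lint_tInt]
  set X : ℝ × ℝ → ℝ≥0∞ := fun q => ∫⁻ r in Ioi 0, ENNReal.ofReal (hp r ^ 2 * (√(2 * yF Φ (E q) q.1 r) / (n r / (4 * π * r ^ 2) + (E q - Φ r) / (2 * R ^ 2)))) with hX
  have ptw : ∀ q ∈ quad, ∫⁻ r in Ioi 0, ENNReal.ofReal (Rf (yF Φ (E q) q.1 r) (lam q - h r)) ≤
      ENNReal.ofReal (1 + θ) * X q + box.indicator (fun q => ENNReal.ofReal (4 * N * μ ^ (1/4 : ℝ) * Cz) * ENNReal.ofReal (q.1 ^ (-(7/8) : ℝ))) q := by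
    rintro q ⟨hq1, hq2⟩
    simp only [mem_Ioi] at hq1 hq2
    by_cases hq : q ∈ goodF Φ E
    · obtain ⟨i, hi0, hiy⟩ := id hq
      obtain ⟨r1, r0, r2, Sw⟩ := well_struct P (L.hEle q) hq1 hi0 hiy
      have e1 := r0F_eq Sw
      have h0 := Sw.h1.trans Sw.h10
      have el : lam q = h r0 := by
        simp only [hlam]
        rw [piecewise_eq_of_mem _ _ _ hq, e1, indicator_of_mem (show r0 ∈ Ioi (0:ℝ) from h0)]
      have hbx : q ∈ box := by
        constructor
        · refine ⟨hq1, ?_⟩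
          obtain ⟨a, b, _⟩ := yF_pos_lt P (L.hEle q) hq1 hi0 hiy.le
          rw [div_le_iff₀ (by positivity)] at b
          have : (i:ℝ) ^ 2 < R ^ 2 := by gcongr
          calc q.1 ≤ (i:ℝ) ^ 2 * (2 * C0) := b
            _ < R ^ 2 * (2 * C0) := by gcongr
            _ = Lm := by rw [hLm]; ring
        · refine ⟨hq2, ?_⟩
          by_contra hS'
          have := L.hES q (not_lt.1 hS')
          have h2 := P.hΦl i hi0
          have : 0 < q.1 / (2 * (i:ℝ) ^ 2) := by positivity
          unfold yF at hiy
          linarith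
      rw [el, indicator_of_mem hbx]
      have := wellT (θ := θ) (μ := μ) P (L.hEle q) hq1 Sw hN hh hpc hNb hhb θ0 (min_le_left _ _) μ0 (by linarith) (min_le_right _ _) (hZ Φ m (E q) q.1 r1 r0 r2 hq1 Sw)
      refine this.trans ?_
      refine add_le_add (mul_le_mul' le_rfl (lintegral_mono_set (fun r hr => Sw.h1.trans hr.1))) (le_of_eq ?_)
      rw [← ENNReal.ofReal_mul (by positivity), ← ENNReal.ofReal_mul (by positivity)]; congr 1; ring
    · refine le_trans (le_of_eq ?_) zero_le
      rw [← lintegral_zero (μ := volume.restrict (Ioi (0:ℝ)))]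
      apply setLIntegral_congr_fun measurableSet_Ioi
      intro r hr
      have hy := not_good P hq hr
      have : lam q = -(θ * μ / 2) := by
        simp only [hlam]; rw [piecewise_eq_of_notMem _ _ _ hq]
      have h3 := (abs_le.1 (hhb r hr)).1
      simp only
      rw [Rf_b3 hy (by rw [this]; linarith)]; simp
  refine (setLIntegral_mono' meas_quad ptw).trans ?_
  have mb : Measurable (box.indicator (fun q : ℝ × ℝ => ENNReal.ofReal (4 * N * μ ^ (1/4 : ℝ) * Cz) * ENNReal.ofReal (q.1 ^ (-(7/8) : ℝ)))) :=
    Measurable.indicator (by fun_prop) mbox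
  rw [lintegral_add_right _ mb, lintegral_const_mul' _ _ ENNReal.ofReal_ne_top]
  have T2 : ∫⁻ q in quad, box.indicator (fun q : ℝ × ℝ => ENNReal.ofReal (4 * N * μ ^ (1/4 : ℝ) * Cz) * ENNReal.ofReal (q.1 ^ (-(7/8) : ℝ))) q ≤
      ENNReal.ofReal (4 * N * μ ^ (1/4 : ℝ) * Cz * I) := by
    refine (setLIntegral_le_lintegral _ _).trans ?_
    rw [lintegral_indicator mbox, lintegral_const_mul' _ _ ENNReal.ofReal_ne_top, ENNReal.ofReal_mul (q := I) (by positivity)]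
    gcongr
  have T1 : ∫⁻ q in quad, X q ≤ ENNReal.ofReal ((1 - δ) / (2 * π) * N) := by
    simp only [hX]
    rw [lintegral_lintegral_swap]
    · have : ∀ r ∈ Ioi (0:ℝ), ∫⁻ q in quad, ENNReal.ofReal (hp r ^ 2 * (√(2 * yF Φ (E q) q.1 r) / (n r / (4 * π * r ^ 2) + (E q - Φ r) / (2 * R ^ 2))))
          ≤ ENNReal.ofReal ((1 - δ) / (2 * π)) * ENNReal.ofReal (hp r ^ 2 * r ^ 2) := by
        intro r hr
        simp only [ENNReal.ofReal_mul (sq_nonneg (hp r))]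
        rw [lintegral_const_mul' _ _ ENNReal.ofReal_ne_top]
        calc _ ≤ ENNReal.ofReal (hp r ^ 2) * ENNReal.ofReal ((1 - δ) * r ^ 2 / (2 * π)) := by gcongr; exact hgap r hr
          _ = _ := by
            rw [← ENNReal.ofReal_mul (sq_nonneg (hp r)), ← ENNReal.ofReal_mul (sq_nonneg (hp r)), ← ENNReal.ofReal_mul (div_nonneg (by linarith) (by positivity))]
            congr 1; ring
      refine (setLIntegral_mono' measurableSet_Ioi this).trans ?_
      rw [lintegral_const_mul' _ _ ENNReal.ofReal_ne_top, ENNReal.ofReal_mul (div_nonneg (by linarith) (by positivity))]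
      gcongr
    · have aΦ : AEMeasurable (fun z : (ℝ × ℝ) × ℝ => Φ z.2) ((volume.restrict quad).prod (volume.restrict (Ioi 0))) :=
        (ContinuousOn.aemeasurable (fun r hr => (P.hΦ r hr).continuousAt.continuousWithinAt) measurableSet_Ioi).comp_snd
      have an : AEMeasurable (fun z : (ℝ × ℝ) × ℝ => n z.2) ((volume.restrict quad).prod (volume.restrict (Ioi 0))) :=
        (ContinuousOn.aemeasurable P.hnc measurableSet_Ioi).comp_snd
      have ap : AEMeasurable (fun z : (ℝ × ℝ) × ℝ => hp z.2) ((volume.restrict quad).prod (volume.restrict (Ioi 0))) :=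
        (ContinuousOn.aemeasurable hpc measurableSet_Ioi).comp_snd
      have aE : AEMeasurable (fun z : (ℝ × ℝ) × ℝ => E z.1) ((volume.restrict quad).prod (volume.restrict (Ioi 0))) :=
        (L.hEm.comp measurable_fst).aemeasurable
      have ay : AEMeasurable (fun z : (ℝ × ℝ) × ℝ => yF Φ (E z.1) z.1.1 z.2) ((volume.restrict quad).prod (volume.restrict (Ioi 0))) := by
        unfold yF
        exact (aE.sub aΦ).sub (Measurable.aemeasurable (by fun_prop))
      have aa : AEMeasurable (fun z : (ℝ × ℝ) × ℝ => n z.2 / (4 * π * z.2 ^ 2) + (E z.1 - Φ z.2) / (2 * R ^ 2)) ((volume.restrict quad).prod (volume.restrict (Ioi 0))) :=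
        (an.div (Measurable.aemeasurable (by fun_prop))).add ((aE.sub aΦ).div_const _)
      exact ((ap.pow_const 2).mul (((ay.const_mul 2).sqrt).div aa)).ennreal_ofReal
  calc _ ≤ ENNReal.ofReal (1 + θ) * ENNReal.ofReal ((1 - δ) / (2 * π) * N) + ENNReal.ofReal (4 * N * μ ^ (1/4 : ℝ) * Cz * I) := by gcongr
    _ = ENNReal.ofReal ((1 + θ) * ((1 - δ) / (2 * π) * N) + 4 * N * μ ^ (1/4 : ℝ) * Cz * I) := by
      have : 0 ≤ 1 - δ := by linarith
      rw [← ENNReal.ofReal_mul (by positivity), ← ENNReal.ofReal_add (by positivity) (by positivity)]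
    _ ≤ _ := by
      apply ENNReal.ofReal_le_ofReal
      have t1 : θ ≤ δ / 4 := min_le_right _ _
      have a1 : (1 + θ) * (1 - δ) ≤ 1 - 3 / 4 * δ := by nlinarith
      have a2 : 4 * N * μ ^ (1/4 : ℝ) * Cz * I ≤ δ / 4 * N / (2 * π) := by
        have : 4 * N * μ ^ (1/4 : ℝ) * Cz * I ≤ 4 * N * ν * Cz * I := by gcongr
        refine this.trans ?_
        rw [le_div_iff₀ (by positivity)]
        calc 4 * N * ν * Cz * I * (2 * π) = N / 4 * (B * ν) := by rw [hB]; ring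
          _ ≤ N / 4 * δ := by gcongr
          _ = _ := by ring
      have a3 : (1 + θ) * ((1 - δ) / (2 * π) * N) = (1 + θ) * (1 - δ) * (N / (2 * π)) := by ring
      have a4 : (1 + θ) * (1 - δ) * (N / (2 * π)) ≤ (1 - 3 / 4 * δ) * (N / (2 * π)) := by gcongr
      rw [a3]
      calc _ ≤ (1 - 3 / 4 * δ) * (N / (2 * π)) + δ / 4 * N / (2 * π) := add_le_add a4 a2
        _ = _ := by ring
end

section
abbrev ea : E3 := EuclideanSpace.single (0 : Fin 3) (1:ℝ)
abbrev eb : E3 := EuclideanSpace.single (1 : Fin 3) (1:ℝ)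
abbrev ec : E3 := EuclideanSpace.single (2 : Fin 3) (1:ℝ)

theorem lint_sq (g : ℝ → ℝ≥0∞) : ∫⁻ t in Ioi (0:ℝ), g t = ∫⁻ r in Ioi (0:ℝ), ENNReal.ofReal (2 * r) * g (r ^ 2) := by
  have im : (fun r : ℝ => r ^ 2) '' Ioi 0 = Ioi 0 := by
    ext t; constructor
    · rintro ⟨r, hr, rfl⟩; exact pow_pos (mem_Ioi.1 hr) 2
    · intro ht; exact ⟨√t, Real.sqrt_pos.2 ht, Real.sq_sqrt (le_of_lt ht)⟩
  have := lintegral_image_eq_lintegral_abs_deriv_mul (f := fun r : ℝ => r ^ 2) (f' := fun r => 2 * r) (s := Ioi 0) measurableSet_Ioi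
    (fun x hx => by simpa using (hasDerivAt_pow 2 x).hasDerivWithinAt)
    (fun a ha b hb hab => by
      have ha : 0 < a := ha
      have hb : 0 < b := hb
      exact (pow_left_inj₀ ha.le hb.le two_ne_zero).1 hab) g
  rw [im] at this
  rw [this]
  refine setLIntegral_congr_fun measurableSet_Ioi fun r hr => ?_
  have hr : 0 < r := hr
  simp only [abs_of_pos (show 0 < 2 * r by positivity)]

theorem lint_plane {g : ℝ → ℝ≥0∞} (hg : Measurable g) :
    ∫⁻ p : ℝ × ℝ, g (p.1 ^ 2 + p.2 ^ 2) = ENNReal.ofReal π * ∫⁻ t in Ioi (0:ℝ), g t := by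
  rw [← lintegral_comp_polarCoord_symm, lint_sq]
  have : ∀ p : ℝ × ℝ, ENNReal.ofReal p.1 • g ((polarCoord.symm p).1 ^ 2 + (polarCoord.symm p).2 ^ 2) = ENNReal.ofReal p.1 * g (p.1 ^ 2) := by
    intro p
    simp only [polarCoord_symm_apply, smul_eq_mul]
    congr 2
    nlinarith [Real.sin_sq_add_cos_sq p.2]
  simp only [this, polarCoord_target]
  rw [Measure.volume_eq_prod, ← Measure.prod_restrict, lintegral_prod _ (by fun_prop)]
  simp only [lintegral_const, Measure.restrict_apply MeasurableSet.univ, univ_inter, Real.volume_Ioo]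
  rw [lintegral_mul_const _ (by fun_prop), mul_comm, show π - -π = π * 2 by ring, ENNReal.ofReal_mul pi_pos.le, mul_assoc]
  congr 1
  rw [← lintegral_const_mul _ (by fun_prop)]
  refine setLIntegral_congr_fun measurableSet_Ioi fun r hr => ?_
  simp only [ENNReal.ofReal_mul zero_le_two, mul_assoc]

theorem cyl0 {G : ℝ → ℝ → ℝ≥0∞} (hG : Measurable (Function.uncurry G)) :
    ∫⁻ v : E3, G (v 0) (v 1 ^ 2 + v 2 ^ 2) = ENNReal.ofReal π * ∫⁻ w, ∫⁻ t in Ioi (0:ℝ), G w t := by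
  rw [← (PiLp.volume_preserving_toLp (Fin 3)).lintegral_comp (by fun_prop)]
  simp only []
  rw [← ((volume_preserving_piFinSuccAbove (fun _ : Fin 3 => ℝ) 0).symm _).lintegral_comp (by fun_prop)]
  have e2 : ∀ p : ℝ × (Fin 2 → ℝ), G ((MeasurableEquiv.piFinSuccAbove (fun _ : Fin 3 => ℝ) 0).symm p 0) (((MeasurableEquiv.piFinSuccAbove (fun _ : Fin 3 => ℝ) 0).symm p 1) ^ 2 + ((MeasurableEquiv.piFinSuccAbove (fun _ : Fin 3 => ℝ) 0).symm p 2) ^ 2) = G p.1 (p.2 0 ^ 2 + p.2 1 ^ 2) := by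
    intro p; rfl
  simp only [e2]
  rw [Measure.volume_eq_prod, lintegral_prod _ (by fun_prop), ← lintegral_const_mul _ (by fun_prop)]
  congr 1; ext w
  rw [← lint_plane (by fun_prop), ← ((volume_preserving_finTwoArrow ℝ)).lintegral_comp (by fun_prop)]
  rfl

theorem exists_iso (n : E3) (hn : ‖n‖ = 1) : ∃ R : E3 ≃ₗᵢ[ℝ] E3, R n = ea :=
  ⟨_, Submodule.reflection_sub (by simp [hn])⟩

theorem norm_sq3 (v : E3) : ‖v‖ ^ 2 = v 0 ^ 2 + v 1 ^ 2 + v 2 ^ 2 := by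
  rw [EuclideanSpace.norm_sq_eq, Fin.sum_univ_three]; simp

theorem cyl {G : ℝ → ℝ → ℝ≥0∞} (hG : Measurable (Function.uncurry G)) {n : E3} (hn : ‖n‖ = 1) :
    ∫⁻ v : E3, G (inner ℝ n v) (‖v‖ ^ 2 - (inner ℝ n v : ℝ) ^ 2) = ENNReal.ofReal π * ∫⁻ w, ∫⁻ t in Ioi (0:ℝ), G w t := by
  obtain ⟨R, hR⟩ := exists_iso n hn
  rw [← cyl0 hG, ← R.measurePreserving.lintegral_comp (f := fun v : E3 => G (v 0) (v 1 ^ 2 + v 2 ^ 2)) (by fun_prop)]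
  congr 1; ext v
  have h1 : (inner ℝ n v : ℝ) = (R v) 0 := by
    rw [← R.inner_map_map n v, hR]; simp [EuclideanSpace.inner_single_left]
  rw [h1, ← R.norm_map v, norm_sq3]
  congr 1; ring

theorem cylS {G : ℝ → ℝ → ℝ≥0∞} (hG : Measurable (Function.uncurry G)) {n : E3} (hn : ‖n‖ = 1) :
    ∫⁻ y : E3, G (inner ℝ n y) ‖y‖ =
      ENNReal.ofReal (2 * π) * ∫⁻ σ in Ioi (0:ℝ), ENNReal.ofReal σ * ∫⁻ w in Ioo (-σ) σ, G w σ := by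
  have h1 := cyl (G := fun w t => G w (√(w ^ 2 + t))) (by fun_prop) hn
  have h2 : ∀ y : E3, √((inner ℝ n y : ℝ) ^ 2 + (‖y‖ ^ 2 - (inner ℝ n y : ℝ) ^ 2)) = ‖y‖ := by
    intro y; rw [add_sub_cancel, Real.sqrt_sq (norm_nonneg _)]
  simp only [h2] at h1
  rw [h1]
  have h3 : ∀ w : ℝ, ∫⁻ t in Ioi (0:ℝ), G w (√(w ^ 2 + t)) = ∫⁻ σ in Ioi (0:ℝ), (Ioi |w|).indicator (fun σ => ENNReal.ofReal (2 * σ) * G w σ) σ := by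
    intro w
    have im : (fun σ : ℝ => σ ^ 2 - w ^ 2) '' Ioi |w| = Ioi 0 := by
      ext t; constructor
      · rintro ⟨σ, hσ, rfl⟩
        exact sub_pos.2 (sq_lt_sq.2 (lt_of_lt_of_le hσ (le_abs_self σ)))
      · intro ht
        have ht : 0 < t := ht
        refine ⟨√(w ^ 2 + t), ?_, by simp only; rw [Real.sq_sqrt (by positivity)]; ring⟩
        rw [mem_Ioi, ← Real.sqrt_sq_eq_abs]; exact Real.sqrt_lt_sqrt (sq_nonneg _) (by linarith)
    have := lintegral_image_eq_lintegral_abs_deriv_mul (f := fun r : ℝ => r ^ 2 - w ^ 2) (f' := fun r => 2 * r) (s := Ioi |w|) measurableSet_Ioi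
      (fun x hx => by
        have := ((hasDerivAt_pow 2 x).sub_const (w ^ 2)).hasDerivWithinAt (s := Ioi |w|)
        norm_num at this ⊢; exact this)
      (fun a ha b hb hab => by
        have ha : 0 < a := (abs_nonneg w).trans_lt ha
        have hb : 0 < b := (abs_nonneg w).trans_lt hb
        simp only [sub_left_inj] at hab
        exact (pow_left_inj₀ ha.le hb.le two_ne_zero).1 hab) (fun t => G w (√(w ^ 2 + t)))
    rw [im] at this
    rw [this, lintegral_indicator measurableSet_Ioi, Measure.restrict_restrict measurableSet_Ioi,
      Ioi_inter_Ioi, sup_eq_left.2 (abs_nonneg w)]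
    refine setLIntegral_congr_fun measurableSet_Ioi fun r hr => ?_
    have hr : 0 < r := (abs_nonneg w).trans_lt hr
    simp only [abs_of_pos (show 0 < 2 * r by positivity), add_sub_cancel, Real.sqrt_sq hr.le]
  simp only [h3]
  rw [lintegral_lintegral_swap, ENNReal.ofReal_mul zero_le_two, mul_comm (ENNReal.ofReal 2), mul_assoc]
  · congr 1
    rw [← lintegral_const_mul' _ _ ENNReal.ofReal_ne_top]
    refine setLIntegral_congr_fun measurableSet_Ioi fun σ hσ => ?_
    have hs : ∀ w, (Ioi |w|).indicator (fun σ => ENNReal.ofReal (2 * σ) * G w σ) σ = (Ioo (-σ) σ).indicator (fun w => ENNReal.ofReal (2 * σ) * G w σ) w := by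
      intro w
      by_cases h : |w| < σ
      · rw [indicator_of_mem (by exact h), indicator_of_mem (by exact abs_lt.1 h)]
      · rw [indicator_of_notMem (by exact h), indicator_of_notMem (by rw [mem_Ioo, ← abs_lt]; exact h)]
    simp only [hs]
    rw [lintegral_indicator measurableSet_Ioo, lintegral_const_mul' _ _ ENNReal.ofReal_ne_top, ENNReal.ofReal_mul zero_le_two, mul_assoc]
  · have : (Function.uncurry fun w σ => (Ioi |w|).indicator (fun σ => ENNReal.ofReal (2 * σ) * G w σ) σ) =
        ({p : ℝ × ℝ | |p.1| < p.2}).indicator (fun p => ENNReal.ofReal (2 * p.2) * G p.1 p.2) := by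
      ext p; rfl
    rw [this]
    exact (Measurable.indicator (by fun_prop) (measurableSet_lt (by fun_prop) (by fun_prop))).aemeasurable

theorem radial {g : ℝ → ℝ≥0∞} (hg : Measurable g) :
    ∫⁻ y : E3, g ‖y‖ = ENNReal.ofReal (4 * π) * ∫⁻ σ in Ioi (0:ℝ), ENNReal.ofReal (σ ^ 2) * g σ := by
  rw [cylS (G := fun _ σ => g σ) (by fun_prop) (n := ea) (by simp)]
  simp only [lintegral_const, Measure.restrict_apply MeasurableSet.univ, univ_inter, Real.volume_Ioo]
  rw [show 4 * π = 2 * π * 2 by ring, ENNReal.ofReal_mul (p := 2 * π) (by positivity), mul_assoc]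
  congr 1
  rw [← lintegral_const_mul' _ _ ENNReal.ofReal_ne_top]
  refine setLIntegral_congr_fun measurableSet_Ioi fun σ hσ => ?_
  have hσ : 0 < σ := hσ
  rw [mul_comm (g σ), ← mul_assoc, ← mul_assoc, ← ENNReal.ofReal_mul hσ.le, ← ENNReal.ofReal_mul zero_le_two]
  congr 2; ring
end

section
theorem rot {x v a b : E3} (h1 : ‖x‖ = ‖a‖) (h2 : ‖v‖ = ‖b‖) (h3 : (inner ℝ x v : ℝ) = inner ℝ a b)
    (ha : (inner ℝ ec a : ℝ) = 0) (hb : (inner ℝ ec b : ℝ) = 0) :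
    ∃ R : E3 ≃ₗᵢ[ℝ] E3, LinearMap.det (R.toLinearEquiv : E3 →ₗ[ℝ] E3) = 1 ∧ R x = a ∧ R v = b := by
  set R1 := (Submodule.span ℝ {x - a})ᗮ.reflection with hR1
  have e1 : R1 x = a := Submodule.reflection_sub h1
  set R2 := (Submodule.span ℝ {R1 v - b})ᗮ.reflection with hR2
  have e2 : R2 (R1 v) = b := Submodule.reflection_sub (by rw [R1.norm_map, h2])
  have e3 : R2 a = a := by
    apply Submodule.reflection_mem_subspace_eq_self
    rw [Submodule.mem_orthogonal_singleton_iff_inner_left, inner_sub_right, sub_eq_zero, ← h3, ← R1.inner_map_map x v, e1]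
  set R3 := (Submodule.span ℝ {ec})ᗮ.reflection with hR3
  have e4 : R3 a = a := Submodule.reflection_mem_subspace_eq_self (by rwa [Submodule.mem_orthogonal_singleton_iff_inner_right])
  have e5 : R3 b = b := Submodule.reflection_mem_subspace_eq_self (by rwa [Submodule.mem_orthogonal_singleton_iff_inner_right])
  have d3 : LinearMap.det (R3.toLinearEquiv : E3 →ₗ[ℝ] E3) = -1 := by
    have := Submodule.det_reflection (Submodule.span ℝ {ec})ᗮ
    rw [Submodule.orthogonal_orthogonal, finrank_span_singleton (by simp)] at this
    exact this.trans (pow_one _)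
  have d1 : LinearMap.det (R1.toLinearEquiv : E3 →ₗ[ℝ] E3) = 1 ∨ LinearMap.det (R1.toLinearEquiv : E3 →ₗ[ℝ] E3) = -1 := by
    have := Submodule.det_reflection (Submodule.span ℝ {x - a})ᗮ
    exact (neg_one_pow_eq_or ℝ _).imp this.trans this.trans
  have d2 : LinearMap.det (R2.toLinearEquiv : E3 →ₗ[ℝ] E3) = 1 ∨ LinearMap.det (R2.toLinearEquiv : E3 →ₗ[ℝ] E3) = -1 := by
    have := Submodule.det_reflection (Submodule.span ℝ {R1 v - b})ᗮ
    exact (neg_one_pow_eq_or ℝ _).imp this.trans this.trans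
  have dm : ∀ A B : E3 ≃ₗᵢ[ℝ] E3, LinearMap.det ((A.trans B).toLinearEquiv : E3 →ₗ[ℝ] E3) =
      LinearMap.det (B.toLinearEquiv : E3 →ₗ[ℝ] E3) * LinearMap.det (A.toLinearEquiv : E3 →ₗ[ℝ] E3) := by
    intro A B
    rw [← LinearMap.det_comp]; rfl
  by_cases hd : LinearMap.det ((R1.trans R2).toLinearEquiv : E3 →ₗ[ℝ] E3) = 1
  · exact ⟨R1.trans R2, hd, by simp [e1, e3], by simp [e2]⟩
  · refine ⟨(R1.trans R2).trans R3, ?_, by simp [e1, e3, e4], by simp [e2, e5]⟩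
    rw [dm, d3]
    rw [dm] at hd ⊢
    rcases d1 with d | d <;> rcases d2 with d' | d' <;> rw [d, d'] at hd ⊢ <;> norm_num at *

def PP (r w l : ℝ) : Phase := (r • ea, w • ea + (√l / r) • eb)

theorem ellOf_nonneg (z : Phase) : 0 ≤ ellOf z := by
  unfold ellOf
  have := abs_real_inner_le_norm z.1 z.2
  have h2 := sq_le_sq' (by linarith [neg_abs_le (inner ℝ z.1 z.2 : ℝ), norm_nonneg z.1, norm_nonneg z.2, mul_nonneg (norm_nonneg z.1) (norm_nonneg z.2)]) ((le_abs_self _).trans this)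
  nlinarith

theorem sph_PP {f : Phase → ℝ} (hf : SphSym f) {z : Phase} (hz : z.1 ≠ 0) :
    f z = f (PP ‖z.1‖ (inner ℝ z.1 z.2 / ‖z.1‖) (ellOf z)) := by
  have hr : 0 < ‖z.1‖ := norm_pos_iff.2 hz
  have hl := ellOf_nonneg z
  set a := (PP ‖z.1‖ (inner ℝ z.1 z.2 / ‖z.1‖) (ellOf z)).1 with hA
  set b := (PP ‖z.1‖ (inner ℝ z.1 z.2 / ‖z.1‖) (ellOf z)).2 with hB
  obtain ⟨R, hd, hx, hv⟩ := rot (x := z.1) (v := z.2) (a := a) (b := b) (by simp only [hA, PP]; rw [norm_smul]; simp)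
    (by
      rw [← sq_eq_sq₀ (norm_nonneg _) (norm_nonneg _), norm_sq3 b]
      simp [hB, PP, div_pow, Real.sq_sqrt hl]
      rw [ellOf]; field_simp; ring)
    (by
      simp only [hA, hB, PP]
      rw [inner_smul_left, inner_add_right, inner_smul_right, inner_smul_right]
      simp [EuclideanSpace.inner_single_left]; field_simp)
    (by simp [hA, PP, EuclideanSpace.inner_single_left]) (by simp [hB, PP, EuclideanSpace.inner_single_left])
  rw [← hf R hd z, hx, hv]

theorem phase_lint {G : ℝ → ℝ → ℝ → ℝ≥0∞} (hG : Measurable (fun p : ℝ × ℝ × ℝ => G p.1 p.2.1 p.2.2)) :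
    ∫⁻ z : Phase, G ‖z.1‖ (inner ℝ z.1 z.2 / ‖z.1‖) (ellOf z) =
      ENNReal.ofReal (4 * π ^ 2) * ∫⁻ r in Ioi (0:ℝ), ∫⁻ w, ∫⁻ l in Ioi (0:ℝ), G r w l := by
  have hG2 : Measurable (fun p : (ℝ × ℝ) × ℝ => G p.1.1 p.1.2 p.2) := hG.comp (by fun_prop : Measurable fun p : (ℝ × ℝ) × ℝ => (p.1.1, p.1.2, p.2))
  have m1 : Measurable (fun p : ℝ × ℝ => ∫⁻ l in Ioi (0:ℝ), G p.1 p.2 l) := hG2.lintegral_prod_right'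
  have m2 : Measurable (fun r : ℝ => ∫⁻ w, ∫⁻ l in Ioi (0:ℝ), G r w l) := m1.lintegral_prod_right'
  have mz : Measurable (fun z : Phase => G ‖z.1‖ (inner ℝ z.1 z.2 / ‖z.1‖) (ellOf z)) := by
    unfold ellOf
    exact hG.comp (by fun_prop : Measurable fun z : Phase => (‖z.1‖, (inner ℝ z.1 z.2 : ℝ) / ‖z.1‖, ‖z.1‖ ^ 2 * ‖z.2‖ ^ 2 - (inner ℝ z.1 z.2 : ℝ) ^ 2))
  rw [Measure.volume_eq_prod, lintegral_prod _ mz.aemeasurable]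
  have key : ∀ x : E3, x ≠ 0 → ∫⁻ v : E3, G ‖x‖ (inner ℝ x v / ‖x‖) (ellOf (x, v)) =
      ENNReal.ofReal (π / ‖x‖ ^ 2) * ∫⁻ w, ∫⁻ l in Ioi (0:ℝ), G ‖x‖ w l := by
    intro x hx
    set r := ‖x‖ with hr
    have r0 : 0 < r := norm_pos_iff.2 hx
    have hGr : Measurable (fun p : ℝ × ℝ => G r p.1 p.2) := hG.comp (by fun_prop : Measurable fun p : ℝ × ℝ => (r, p.1, p.2))
    have := cyl (G := fun w t => G r w (r ^ 2 * t)) (n := r⁻¹ • x)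
      (hGr.comp (by fun_prop : Measurable fun p : ℝ × ℝ => (p.1, r ^ 2 * p.2))) (by rw [norm_smul, ← hr, norm_inv, Real.norm_of_nonneg r0.le]; field_simp)
    have e1 : ∀ v : E3, (inner ℝ (r⁻¹ • x) v : ℝ) = inner ℝ x v / r := by
      intro v; rw [inner_smul_left]; simp; ring
    have e2 : ∀ v : E3, r ^ 2 * (‖v‖ ^ 2 - (inner ℝ x v / r) ^ 2) = ellOf (x, v) := by
      intro v; rw [ellOf]; simp only [← hr]; field_simp
    simp only [e1, e2] at this
    rw [this, div_eq_mul_inv, ENNReal.ofReal_mul pi_pos.le, mul_assoc]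
    congr 1
    rw [← lintegral_const_mul' _ _ ENNReal.ofReal_ne_top]
    congr 1; ext w
    have im : (fun t : ℝ => r ^ 2 * t) '' Ioi 0 = Ioi 0 := by
      rw [image_mul_left_Ioi (by positivity), mul_zero]
    have h4 := lintegral_image_eq_lintegral_abs_deriv_mul (f := fun t : ℝ => r ^ 2 * t) (f' := fun _ => r ^ 2) (s := Ioi 0) measurableSet_Ioi
      (fun x hx => by simpa using ((hasDerivAt_id x).const_mul (r ^ 2)).hasDerivWithinAt)
      (fun a ha b hb hab => by
        have : r ^ 2 ≠ 0 := by positivity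
        exact mul_left_cancel₀ this hab) (fun l => G r w l)
    rw [im, lintegral_const_mul' _ _ ENNReal.ofReal_ne_top, abs_of_pos (by positivity)] at h4
    rw [h4, ← mul_assoc, ← ENNReal.ofReal_mul (by positivity), inv_mul_cancel₀ (by positivity)]; simp
  have ae0 : ∀ᵐ x : E3, x ≠ 0 := by
    rw [ae_iff]; simp
  rw [lintegral_congr_ae (ae0.mono fun x hx => key x hx)]
  rw [radial (g := fun r => ENNReal.ofReal (π / r ^ 2) * ∫⁻ w, ∫⁻ l in Ioi (0:ℝ), G r w l) (by fun_prop),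
    show 4 * π ^ 2 = 4 * π * π by ring, ENNReal.ofReal_mul (p := 4 * π) (by positivity), mul_assoc]
  congr 1
  rw [← lintegral_const_mul' _ _ ENNReal.ofReal_ne_top]
  refine setLIntegral_congr_fun measurableSet_Ioi fun σ hσ => ?_
  have hσ : 0 < σ := hσ
  rw [← mul_assoc, ← ENNReal.ofReal_mul (by positivity)]
  congr 2; field_simp
end

section
def chi (s y : ℝ) : ℝ≥0∞ := if s < y then 1 else 0

theorem chi_meas : Measurable (fun p : ℝ × ℝ => chi p.1 p.2) := by
  unfold chi
  exact Measurable.ite (measurableSet_lt (by fun_prop) (by fun_prop)) measurable_const measurable_const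

theorem meas_sign : Measurable Real.sign := by
  unfold Real.sign
  exact Measurable.ite measurableSet_Iio measurable_const (Measurable.ite measurableSet_Ioi measurable_const measurable_const)

theorem subst_u {c : ℝ} (hc : 0 < c) (g : ℝ → ℝ≥0∞) :
    ∫⁻ u in {u : ℝ | c < u ^ 2}, ENNReal.ofReal (|u| / √(u ^ 2 - c)) * g (Real.sign u * √(u ^ 2 - c)) = ∫⁻ w, g w := by
  have ms : MeasurableSet {u : ℝ | c < u ^ 2} := measurableSet_lt (by fun_prop) (by fun_prop)
  have h0 : ∀ u : ℝ, c < u ^ 2 → u ≠ 0 := by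
    rintro u hu rfl; simp at hu; linarith
  have hd : ∀ u ∈ {u : ℝ | c < u ^ 2}, HasDerivWithinAt (fun u => Real.sign u * √(u ^ 2 - c)) (Real.sign u * (u / √(u ^ 2 - c))) {u : ℝ | c < u ^ 2} u := by
    intro u hu
    have hu : c < u ^ 2 := hu
    have h1 : HasDerivAt (fun v : ℝ => √(v ^ 2 - c)) (u / √(u ^ 2 - c)) u := by
      have h2 : HasDerivAt (fun v : ℝ => v ^ 2 - c) (2 * u) u := by
        simpa using (hasDerivAt_pow 2 u).sub_const c
      have := h2.sqrt (by linarith)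
      convert this using 1
      rw [mul_div_mul_left _ _ two_ne_zero]
    have h3 := h1.const_mul (Real.sign u)
    refine (h3.congr_of_eventuallyEq ?_).hasDerivWithinAt
    have : ∀ᶠ v in 𝓝 u, Real.sign v = Real.sign u := by
      rcases lt_or_gt_of_ne (h0 u hu) with h | h
      · filter_upwards [eventually_lt_nhds h] with v hv
        rw [Real.sign_of_neg hv, Real.sign_of_neg h]
      · filter_upwards [eventually_gt_nhds h] with v hv
        rw [Real.sign_of_pos hv, Real.sign_of_pos h]
    filter_upwards [this] with v hv
    rw [hv]
  have sq1 : ∀ u : ℝ, c < u ^ 2 → u = Real.sign (Real.sign u * √(u ^ 2 - c)) * √((Real.sign u * √(u ^ 2 - c)) ^ 2 + c) := by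
    intro u hu
    have hs : 0 < √(u ^ 2 - c) := Real.sqrt_pos.2 (by linarith)
    have := Real.sq_sqrt (show 0 ≤ u ^ 2 - c by linarith)
    rcases lt_or_gt_of_ne (h0 u hu) with h | h
    · rw [Real.sign_of_neg h, Real.sign_of_neg (show -1 * √(u ^ 2 - c) < 0 by linarith), mul_pow, this]
      rw [show (-1:ℝ) ^ 2 * (u ^ 2 - c) + c = u ^ 2 by ring, Real.sqrt_sq_eq_abs, abs_of_neg h]; ring
    · rw [Real.sign_of_pos h, Real.sign_of_pos (show 0 < 1 * √(u ^ 2 - c) by linarith), mul_pow, this]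
      rw [show (1:ℝ) ^ 2 * (u ^ 2 - c) + c = u ^ 2 by ring, Real.sqrt_sq_eq_abs, abs_of_pos h]; ring
  have inj : InjOn (fun u => Real.sign u * √(u ^ 2 - c)) {u : ℝ | c < u ^ 2} := by
    intro a ha b hb hab
    simp only at hab
    rw [sq1 a ha, sq1 b hb, hab]
  have im : (fun u => Real.sign u * √(u ^ 2 - c)) '' {u : ℝ | c < u ^ 2} = {0}ᶜ := by
    ext w; constructor
    · rintro ⟨u, hu, rfl⟩ h
      have hu : c < u ^ 2 := hu
      have hs : 0 < √(u ^ 2 - c) := Real.sqrt_pos.2 (by linarith)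
      rcases mul_eq_zero.1 h with h | h
      · exact h0 u hu (Real.sign_eq_zero_iff.1 h)
      · exact hs.ne' h
    · intro hw
      have hw : w ≠ 0 := hw
      have hw2 : 0 < w ^ 2 := by positivity
      have e : (Real.sign w * √(w ^ 2 + c)) ^ 2 = w ^ 2 + c := by
        rw [mul_pow, Real.sq_sqrt (by positivity)]
        rcases Real.sign_apply_eq_of_ne_zero w hw with h | h <;> rw [h] <;> ring
      refine ⟨Real.sign w * √(w ^ 2 + c), ?_, ?_⟩
      · rw [mem_ofPred_eq, e]; linarith
      · simp only [e, add_sub_cancel_right]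
        have hs : 0 < √(w ^ 2 + c) := Real.sqrt_pos.2 (by positivity)
        rw [Real.sqrt_sq_eq_abs]
        rcases lt_or_gt_of_ne hw with h | h
        · rw [Real.sign_of_neg h, Real.sign_of_neg (by linarith), abs_of_neg h]; ring
        · rw [Real.sign_of_pos h, Real.sign_of_pos (by linarith), abs_of_pos h]; ring
  have := lintegral_image_eq_lintegral_abs_deriv_mul ms hd inj g
  rw [im] at this
  rw [← setLIntegral_univ g, ← setLIntegral_congr (s := {(0:ℝ)}ᶜ) (ae_eq_univ.2 (by simp)), this]
  refine setLIntegral_congr_fun ms fun u hu => ?_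
  congr 2
  rw [abs_mul, abs_div, abs_of_nonneg (Real.sqrt_nonneg _)]
  rcases Real.sign_apply_eq_of_ne_zero u (h0 u hu) with h | h <;> rw [h] <;> simp

theorem PP_meas : Measurable (fun p : ℝ × ℝ × ℝ => PP p.1 p.2.1 p.2.2) := by
  unfold PP; fun_prop

theorem muDist_eq {f : Phase → ℝ} (hf : Measurable f) (s : ℝ) {l : ℝ} (hl : 0 < l) :
    muDist f s l = ENNReal.ofReal (4 * π ^ 2) * ∫⁻ r in Ioi (0:ℝ), ∫⁻ w, chi s (f (PP r w l)) := by
  have hs := meas_sign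
  have mS : MeasurableSet {p : ℝ × ℝ | s < f (radPoint p.1 p.2 l)} := by
    refine measurableSet_lt measurable_const (hf.comp ?_)
    unfold radPoint; fun_prop
  have mn : Measurable (nuDens l) := by
    unfold nuDens
    have m1 : MeasurableSet {a : ℝ × ℝ | 0 < a.1 ∧ l < a.1 ^ 2 * a.2 ^ 2} :=
      (measurableSet_lt (f := fun _ : ℝ × ℝ => (0:ℝ)) (g := fun a => a.1) (by fun_prop) (by fun_prop)).inter
        (measurableSet_lt (f := fun _ : ℝ × ℝ => l) (g := fun a => a.1 ^ 2 * a.2 ^ 2) (by fun_prop) (by fun_prop))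
    exact Measurable.ite m1 (by fun_prop) measurable_const
  unfold muDist nuMeas
  rw [withDensity_apply _ mS, ← lintegral_indicator mS, Measure.volume_eq_prod, lintegral_prod _ (mn.indicator mS).aemeasurable,
    ← lintegral_const_mul' _ _ ENNReal.ofReal_ne_top, ← lintegral_indicator measurableSet_Ioi]
  congr 1; ext r
  by_cases hr : 0 < r
  · rw [indicator_of_mem (by exact hr), ← subst_u (c := l / r ^ 2) (by positivity) (fun w => chi s (f (PP r w l))), ← lintegral_const_mul' _ _ ENNReal.ofReal_ne_top,
      ← lintegral_indicator (measurableSet_lt (by fun_prop) (by fun_prop))]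
    congr 1; ext u
    have iff1 : l / r ^ 2 < u ^ 2 ↔ l < r ^ 2 * u ^ 2 := by rw [div_lt_iff₀ (by positivity), mul_comm]
    have e1 : √(r ^ 2 * u ^ 2 - l) / r = √(u ^ 2 - l / r ^ 2) := by
      rw [div_eq_iff hr.ne']
      have : r ^ 2 * u ^ 2 - l = (u ^ 2 - l / r ^ 2) * r ^ 2 := by field_simp
      rw [this, Real.sqrt_mul' _ (by positivity), Real.sqrt_sq hr.le]
    have e2 : radPoint r u l = PP r (Real.sign u * √(u ^ 2 - l / r ^ 2)) l := by
      rw [radPoint, PP, mul_div_assoc, e1]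
    by_cases hu : l < r ^ 2 * u ^ 2
    · rw [indicator_of_mem (s := {u : ℝ | l / r ^ 2 < u ^ 2}) (iff1.2 hu)]
      by_cases hm : s < f (radPoint r u l)
      · rw [indicator_of_mem (by exact hm), ← e2, chi, if_pos hm, mul_one, nuDens, if_pos ⟨hr, hu⟩, ← ENNReal.ofReal_mul (by positivity), ← e1]
        congr 1
        have : √(r ^ 2 * u ^ 2 - l) ≠ 0 := (Real.sqrt_pos.2 (by linarith)).ne'
        field_simp
      · rw [indicator_of_notMem (by exact hm), ← e2, chi, if_neg hm]; simp
    · rw [indicator_of_notMem (s := {u : ℝ | l / r ^ 2 < u ^ 2}) (by exact fun h => hu (iff1.1 h))]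
      apply indicator_apply_eq_zero.2
      intro _
      rw [nuDens, if_neg (by tauto)]
  · rw [indicator_of_notMem (by exact hr)]
    refine (lintegral_congr fun u => ?_).trans lintegral_zero
    apply indicator_apply_eq_zero.2
    intro _
    rw [nuDens, if_neg (by tauto)]

theorem lint_mu {f : Phase → ℝ} (hf : Measurable f) (hs : SphSym f) {ζ : ℝ → ℝ≥0∞} (hζ : Measurable ζ) (s : ℝ) :
    ∫⁻ z : Phase, ζ (ellOf z) * chi s (f z) = ∫⁻ l in Ioi (0:ℝ), ζ l * muDist f s l := by
  have hc := chi_meas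
  have hp := PP_meas
  have mP : Measurable (fun p : ℝ × ℝ × ℝ => chi s (f (PP p.1 p.2.1 p.2.2))) :=
    hc.comp ((measurable_const (a := s)).prodMk (hf.comp hp))
  have mG : Measurable (fun p : ℝ × ℝ × ℝ => ζ p.2.2 * chi s (f (PP p.1 p.2.1 p.2.2))) := by fun_prop
  have ae0 : ∀ᵐ z : Phase, z.1 ≠ 0 := by
    have : ∀ᵐ x : E3, x ≠ 0 := by rw [ae_iff]; simp
    exact Measure.quasiMeasurePreserving_fst.ae this
  rw [lintegral_congr_ae (ae0.mono fun z hz => by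
    show _ = (fun z => ζ (ellOf z) * chi s (f (PP ‖z.1‖ (inner ℝ z.1 z.2 / ‖z.1‖) (ellOf z)))) z
    simp only; rw [← sph_PP hs hz])]
  rw [phase_lint (G := fun r w l => ζ l * chi s (f (PP r w l))) mG]
  rw [setLIntegral_congr_fun measurableSet_Ioi (f := fun l => ζ l * muDist f s l) (g := fun l => ENNReal.ofReal (4 * π ^ 2) * ∫⁻ r in Ioi (0:ℝ), ∫⁻ w, ζ l * chi s (f (PP r w l)))]
  · rw [lintegral_const_mul' _ _ ENNReal.ofReal_ne_top]
    congr 1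
    have sw : ∀ r, ∫⁻ w, ∫⁻ l in Ioi (0:ℝ), ζ l * chi s (f (PP r w l)) = ∫⁻ l in Ioi (0:ℝ), ∫⁻ w, ζ l * chi s (f (PP r w l)) := by
      intro r
      rw [lintegral_lintegral_swap]
      exact (mG.comp (by fun_prop : Measurable fun p : ℝ × ℝ => (r, p.1, p.2))).aemeasurable
    simp only [sw]
    rw [lintegral_lintegral_swap]
    have : Measurable (fun p : (ℝ × ℝ) × ℝ => ζ p.1.2 * chi s (f (PP p.1.1 p.2 p.1.2))) :=
      mG.comp (by fun_prop : Measurable fun p : (ℝ × ℝ) × ℝ => (p.1.1, p.2, p.1.2))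
    exact (this.lintegral_prod_right' (ν := volume)).aemeasurable
  · intro l hl
    simp only
    rw [muDist_eq hf s hl, mul_left_comm]
    congr 1
    have m3 : Measurable (fun p : ℝ × ℝ => chi s (f (PP p.1 p.2 l))) := mP.comp (by fun_prop : Measurable fun p : ℝ × ℝ => (p.1, p.2, l))
    rw [← lintegral_const_mul _ m3.lintegral_prod_right']
    congr 1; ext r
    exact (lintegral_const_mul _ (m3.comp (by fun_prop : Measurable fun w : ℝ => (r, w)))).symm

theorem eqm_lint {f g : Phase → ℝ} (hf : Measurable f) (hs : SphSym f) (hg : Measurable g) (he : EqMeas f g)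
    {ζ : ℝ → ℝ≥0∞} (hζ : Measurable ζ) {s : ℝ} (h0 : 0 < s) :
    ∫⁻ z : Phase, ζ (ellOf z) * chi s (g z) = ∫⁻ z : Phase, ζ (ellOf z) * chi s (f z) := by
  rw [lint_mu hf hs hζ, lint_mu hg he.2.1 hζ]
  exact lintegral_congr_ae ((he.2.2 s h0).mono fun l hl => by simp only; rw [hl])

theorem eqm_sup {f g : Phase → ℝ} (hf : Measurable f) (hf0 : ∀ z, 0 ≤ f z) (hs : SphSym f) (hg : Measurable g) (he : EqMeas f g) :
    eLpNorm g ⊤ volume ≤ eLpNorm f ⊤ volume := by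
  rw [eLpNorm_exponent_top, eLpNorm_exponent_top]
  by_cases ht : eLpNormEssSup f volume = ⊤
  · rw [ht]; exact le_top
  have hv : ∀ s, 0 < s → volume {z | s < g z} = volume {z | s < f z} := by
    intro s h0
    have := eqm_lint hf hs hg he (ζ := fun _ => 1) measurable_const h0
    simp only [one_mul] at this
    have e : ∀ k : Phase → ℝ, Measurable k → ∫⁻ z, chi s (k z) = volume {z | s < k z} := by
      intro k hk
      have : (fun z => chi s (k z)) = {z | s < k z}.indicator 1 := by
        ext z; by_cases h : s < k z <;> simp [chi, h]
      rw [this, lintegral_indicator_one (measurableSet_lt measurable_const hk)]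
    rw [← e g hg, ← e f hf, this]
  set S := (eLpNormEssSup f volume).toReal with hS
  have S0 : 0 ≤ S := ENNReal.toReal_nonneg
  have hfS : ∀ᵐ z, f z ≤ S := by
    filter_upwards [enorm_ae_le_eLpNormEssSup f volume] with z hz
    rw [hS, ← ENNReal.ofReal_le_iff_le_toReal ht, ← Real.enorm_of_nonneg (hf0 z)]; exact hz
  have key : ∀ k : ℕ, ∀ᵐ z, g z ≤ S + 1 / ((k:ℝ) + 1) := by
    intro k
    have hp : 0 < S + 1 / ((k:ℝ) + 1) := by positivity
    rw [ae_iff]; simp only [not_le]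
    rw [hv _ hp]
    have : ∀ᵐ z, f z ≤ S + 1 / ((k:ℝ) + 1) := hfS.mono fun z hz => hz.trans (le_add_of_nonneg_right (by positivity))
    rw [ae_iff] at this; simpa only [not_le] using this
  refine essSup_le_of_ae_le _ ?_
  filter_upwards [ae_all_iff.2 key] with z hz
  have : g z ≤ S := by
    have t : Tendsto (fun k : ℕ => S + 1 / ((k:ℝ) + 1)) atTop (𝓝 (S + 0)) := tendsto_const_nhds.add tendsto_one_div_add_atTop_nhds_zero_nat
    rw [add_zero] at t
    exact ge_of_tendsto' t hz
  rw [Real.enorm_of_nonneg (he.1 z)]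
  exact (ENNReal.ofReal_le_iff_le_toReal ht).2 this
end

section
def mF (f : Phase → ℝ) (s : ℝ) : ℝ := ∫ z in {z : Phase | ‖z.1‖ < s}, f z
def Prad (f : Phase → ℝ) (r : ℝ) : ℝ := - ∫ s in Ioi r, mF f s / (4 * π * s ^ 2)

theorem ms_lt (s : ℝ) : MeasurableSet {z : Phase | ‖z.1‖ < s} := measurableSet_lt (by fun_prop) (by fun_prop)

theorem memE.integ {f : Phase → ℝ} (hf : memE f) : Integrable f := by
  refine ⟨hf.1.aestronglyMeasurable, ?_⟩
  have := hf.2.2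
  unfold eNormE at this
  rw [hasFiniteIntegral_iff_enorm, ← eLpNorm_one_eq_lintegral_enorm]
  exact lt_of_le_of_lt (le_trans le_self_add le_self_add) this

theorem memE.integv {f : Phase → ℝ} (hf : memE f) : Integrable (fun z : Phase => ‖z.2‖ ^ 2 * f z) := by
  have hm := hf.1
  refine ⟨by fun_prop, ?_⟩
  have := hf.2.2
  unfold eNormE at this
  rw [hasFiniteIntegral_iff_enorm]
  refine lt_of_le_of_lt (le_trans (le_of_eq ?_) le_add_self) this
  congr 1; ext z
  rw [enorm_mul, enorm_pow, enorm_norm]; rfl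

theorem memE.bdd {f : Phase → ℝ} (hf : memE f) {B : ℝ} (hB : eLpNorm f ⊤ volume ≤ ENNReal.ofReal B) (h0 : 0 ≤ B) : ∀ᵐ z, f z ≤ B := by
  filter_upwards [enorm_ae_le_eLpNormEssSup f volume] with z hz
  rw [← eLpNorm_exponent_top] at hz
  have := hz.trans hB
  rw [Real.enorm_of_nonneg (hf.2.1 z)] at this
  exact (ENNReal.ofReal_le_ofReal_iff h0).1 this

theorem memE.ess {f : Phase → ℝ} (hf : memE f) : eLpNorm f ⊤ volume ≤ ENNReal.ofReal (eLpNorm f ⊤ volume).toReal := by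
  rw [ENNReal.ofReal_toReal]
  have := hf.2.2
  unfold eNormE at this
  exact (lt_of_le_of_lt (le_trans le_add_self le_self_add) this).ne

theorem mF_nonneg {f : Phase → ℝ} (hf : memE f) (s : ℝ) : 0 ≤ mF f s := integral_nonneg hf.2.1

theorem mF_le_mass {f : Phase → ℝ} (hf : memE f) (s : ℝ) : mF f s ≤ mass f :=
  setIntegral_le_integral hf.integ (Eventually.of_forall hf.2.1)

theorem mass_nonneg {f : Phase → ℝ} (hf : memE f) : 0 ≤ mass f := integral_nonneg hf.2.1
theorem kin_nonneg {f : Phase → ℝ} (hf : memE f) : 0 ≤ kineticE f := integral_nonneg fun z => mul_nonneg (sq_nonneg _) (hf.2.1 z)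

theorem mF_cont {f : Phase → ℝ} (hf : memE f) : Continuous (mF f) := by
  rw [continuous_iff_continuousAt]
  intro s0
  have e : mF f = fun s => ∫ z, {z : Phase | ‖z.1‖ < s}.indicator f z := by
    ext s; rw [mF, integral_indicator (ms_lt s)]
  rw [e]
  refine continuousAt_of_dominated (bound := fun z => f z) (Eventually.of_forall fun s => (hf.1.indicator (ms_lt s)).aestronglyMeasurable)
    (Eventually.of_forall fun s => Eventually.of_forall fun z => ?_) hf.integ ?_
  · rw [Real.norm_of_nonneg (indicator_nonneg (fun z _ => hf.2.1 z) z)]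
    exact indicator_le_self' (fun z _ => hf.2.1 z) z
  · have ae0 : ∀ᵐ z : Phase, ‖z.1‖ ≠ s0 := by
      have : ∀ᵐ x : E3, ‖x‖ ≠ s0 := by
        rw [ae_iff]; simp only [not_not]
        have := Measure.addHaar_sphere (volume : Measure E3) 0 s0
        convert this using 2
        ext x; simp
      exact Measure.quasiMeasurePreserving_fst.ae this
    filter_upwards [ae0] with z hz
    rcases lt_or_gt_of_ne hz with h | h
    · refine (continuousAt_const (y := f z)).congr ?_
      filter_upwards [eventually_gt_nhds h] with s hs
      rw [indicator_of_mem (by exact hs)]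
    · refine (continuousAt_const (y := (0:ℝ))).congr ?_
      filter_upwards [eventually_lt_nhds h] with s hs
      rw [indicator_of_notMem (by exact not_lt.2 (le_of_lt hs))]

theorem ofReal_mF {f : Phase → ℝ} (hf : memE f) (s : ℝ) :
    ENNReal.ofReal (mF f s) = ∫⁻ z in {z : Phase | ‖z.1‖ < s}, ENNReal.ofReal (f z) :=
  ofReal_integral_eq_lintegral_ofReal hf.integ.integrableOn (Eventually.of_forall hf.2.1)

def CB : ℝ := (volume (Metric.ball (0:E3) 1)).toReal ^ 2

theorem CB_nonneg : 0 ≤ CB := sq_nonneg _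

theorem mF_bound {f : Phase → ℝ} (hf : memE f) {B : ℝ} (h0 : 0 ≤ B) (hB : ∀ᵐ z, f z ≤ B) {s : ℝ} (hs : 0 < s) :
    mF f s ≤ (CB * B + kineticE f) * s ^ (6/5 : ℝ) := by
  set V := s ^ (-(3/5) : ℝ) with hV
  have V0 : 0 < V := Real.rpow_pos_of_pos hs _
  set b := (volume (Metric.ball (0:E3) 1)) with hb
  have bt : b ≠ ⊤ := measure_ball_lt_top.ne
  set S : Set Phase := Metric.ball (0:E3) s ×ˢ Metric.ball (0:E3) V with hS
  have mS : MeasurableSet S := Metric.isOpen_ball.measurableSet.prod Metric.isOpen_ball.measurableSet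
  have fr : Module.finrank ℝ E3 = 3 := by simp
  have vS : volume S = ENNReal.ofReal (s ^ 3 * V ^ 3) * b ^ 2 := by
    rw [hS, Measure.volume_eq_prod, Measure.prod_prod, Measure.addHaar_ball _ _ hs.le, Measure.addHaar_ball _ _ V0.le, fr,
      ENNReal.ofReal_mul (by positivity)]
    ring
  have vSt : volume S ≠ ⊤ := by rw [vS]; exact ENNReal.mul_ne_top ENNReal.ofReal_ne_top (ENNReal.pow_ne_top bt)
  have i1 : Integrable (S.indicator (fun _ => B)) := by
    rw [integrable_indicator_iff mS]; exact integrableOn_const (by exact vSt)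
  have i2 : Integrable (fun z : Phase => ‖z.2‖ ^ 2 * f z / V ^ 2) := hf.integv.div_const _
  have e : mF f s = ∫ z, {z : Phase | ‖z.1‖ < s}.indicator f z := by
    rw [mF, integral_indicator (ms_lt s)]
  have h1 : mF f s ≤ ∫ z, (S.indicator (fun _ => B) z + ‖z.2‖ ^ 2 * f z / V ^ 2) := by
    rw [e]
    refine integral_mono_ae (hf.integ.indicator (ms_lt s)) (i1.add i2) ?_
    filter_upwards [hB] with z hz
    have n2 : 0 ≤ ‖z.2‖ ^ 2 * f z / V ^ 2 := by have := hf.2.1 z; positivity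
    by_cases hz1 : ‖z.1‖ < s
    · rw [indicator_of_mem (by exact hz1)]
      by_cases hz2 : ‖z.2‖ < V
      · rw [indicator_of_mem (by exact ⟨by simpa using hz1, by simpa using hz2⟩)]; linarith
      · have : f z ≤ ‖z.2‖ ^ 2 * f z / V ^ 2 := by
          rw [le_div_iff₀ (by positivity), mul_comm]
          gcongr
          · exact hf.2.1 z
          · exact not_lt.1 hz2
        have : 0 ≤ S.indicator (fun _ => B) z := indicator_nonneg (fun _ _ => h0) z
        linarith
    · rw [indicator_of_notMem (by exact hz1)]
      exact add_nonneg (indicator_nonneg (fun _ _ => h0) z) n2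
  rw [integral_add i1 i2, integral_indicator mS, setIntegral_const, integral_div, smul_eq_mul, measureReal_def, vS] at h1
  refine h1.trans (le_of_eq ?_)
  rw [ENNReal.toReal_mul, ENNReal.toReal_ofReal (by positivity), ENNReal.toReal_pow]
  have e1 : s ^ 3 * V ^ 3 = s ^ (6/5:ℝ) := by
    rw [hV, ← Real.rpow_natCast, ← Real.rpow_natCast, ← Real.rpow_mul hs.le, ← Real.rpow_add hs]; norm_num
  have e2 : V ^ 2 = (s ^ (6/5:ℝ))⁻¹ := by
    rw [hV, ← Real.rpow_natCast, ← Real.rpow_mul hs.le, ← Real.rpow_neg hs.le]; norm_num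
  rw [e1, e2, div_inv_eq_mul, CB]
  change _ + kineticE f * _ = _
  ring

-- integrability
theorem int_inv_sq {a : ℝ} (ha : 0 < a) : IntegrableOn (fun s : ℝ => (s ^ 2)⁻¹) (Ioi a) ∧ ∫ s in Ioi a, (s ^ 2)⁻¹ = 1 / a := by
  have e : ∀ s ∈ Ioi a, s ^ (-2:ℝ) = (s ^ 2)⁻¹ := by
    intro s hs
    rw [Real.rpow_neg (ha.trans hs).le]; norm_cast
  constructor
  · exact (integrableOn_Ioi_rpow_of_lt (by norm_num : (-2:ℝ) < -1) ha).congr_fun e measurableSet_Ioi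
  · rw [← setIntegral_congr_fun measurableSet_Ioi e, integral_Ioi_rpow_of_lt (by norm_num) ha]
    norm_num [Real.rpow_neg_one]

theorem int_head {a : ℝ} (ha : 0 < a) : IntegrableOn (fun s : ℝ => s ^ (-(4/5):ℝ)) (Ioc 0 a) ∧ ∫ s in Ioc 0 a, s ^ (-(4/5):ℝ) = 5 * a ^ (1/5:ℝ) := by
  constructor
  · have := (intervalIntegral.intervalIntegrable_rpow' (a := 0) (b := a) (r := (-(4/5) : ℝ)) (by norm_num))
    rwa [intervalIntegrable_iff_integrableOn_Ioc_of_le ha.le] at this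
  · rw [← intervalIntegral.integral_of_le ha.le, integral_rpow (Or.inl (by norm_num))]
    norm_num; ring

-- general: 0 ≤ u, u ≤ c1 s^{6/5}, u ≤ c2 => u/(4 pi s^2) integrable with bounds
theorem rad_bound {u : ℝ → ℝ} (hu : ContinuousOn u (Ioi 0)) {c1 c2 : ℝ} (u0 : ∀ s, 0 < s → 0 ≤ u s) (h1 : ∀ s, 0 < s → u s ≤ c1 * s ^ (6/5:ℝ))
    (h2 : ∀ s, 0 < s → u s ≤ c2) {a : ℝ} (ha : 0 < a) :
    IntegrableOn (fun s => u s / (4 * π * s ^ 2)) (Ioi 0) ∧ ∫ s in Ioi 0, u s / (4 * π * s ^ 2) ≤ c1 * a ^ (1/5:ℝ) + c2 / a := by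
  have hpi := Real.pi_gt_three
  have cu : ContinuousOn (fun s => u s / (4 * π * s ^ 2)) (Ioi 0) :=
    hu.div (by fun_prop) (fun s hs => by have : 0 < s := hs; positivity)
  have b1 : ∀ s ∈ Ioc 0 a, u s / (4 * π * s ^ 2) ≤ c1 / (4 * π) * s ^ (-(4/5):ℝ) := by
    intro s hs
    have hs := hs.1
    rw [div_le_iff₀ (by positivity)]
    refine (h1 s hs).trans (le_of_eq ?_)
    have : s ^ (6/5:ℝ) = s ^ (-(4/5):ℝ) * s ^ 2 := by
      rw [← Real.rpow_natCast, ← Real.rpow_add hs]; norm_num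
    rw [this]; field_simp
  have b2 : ∀ s ∈ Ioi a, u s / (4 * π * s ^ 2) ≤ c2 / (4 * π) * (s ^ 2)⁻¹ := by
    intro s hs
    have hs : 0 < s := ha.trans hs
    have := h2 s hs
    rw [← div_eq_mul_inv, div_div]
    gcongr
  have n0 : ∀ s, 0 < s → 0 ≤ u s / (4 * π * s ^ 2) := fun s hs => div_nonneg (u0 s hs) (by positivity)
  have g1 : IntegrableOn (fun s : ℝ => c1 / (4 * π) * s ^ (-(4/5):ℝ)) (Ioc 0 a) := (int_head ha).1.const_mul _
  have g2 : IntegrableOn (fun s : ℝ => c2 / (4 * π) * (s ^ 2)⁻¹) (Ioi a) := (int_inv_sq ha).1.const_mul _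
  have i1 : IntegrableOn (fun s => u s / (4 * π * s ^ 2)) (Ioc 0 a) := by
    refine Integrable.mono' g1 ((cu.mono Ioc_subset_Ioi_self).aestronglyMeasurable measurableSet_Ioc) ?_
    filter_upwards [ae_restrict_mem measurableSet_Ioc] with s hs
    rw [Real.norm_of_nonneg (n0 s hs.1)]; exact b1 s hs
  have i2 : IntegrableOn (fun s => u s / (4 * π * s ^ 2)) (Ioi a) := by
    refine Integrable.mono' g2 ((cu.mono (Ioi_subset_Ioi ha.le)).aestronglyMeasurable measurableSet_Ioi) ?_
    filter_upwards [ae_restrict_mem measurableSet_Ioi] with s hs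
    rw [Real.norm_of_nonneg (n0 s (ha.trans hs))]; exact b2 s hs
  have un : Ioc 0 a ∪ Ioi a = Ioi 0 := Ioc_union_Ioi_eq_Ioi ha.le
  constructor
  · rw [← un]; exact i1.union i2
  · rw [← un, setIntegral_union (Ioc_disjoint_Ioi le_rfl) measurableSet_Ioi i1 i2]
    have c10 : 0 ≤ c1 := by have := (u0 1 one_pos).trans (h1 1 one_pos); simpa using this
    have c20 : 0 ≤ c2 := (u0 1 one_pos).trans (h2 1 one_pos)
    have j1 := setIntegral_mono_on i1 g1 measurableSet_Ioc b1
    have j2 := setIntegral_mono_on i2 g2 measurableSet_Ioi b2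
    rw [integral_const_mul, (int_head ha).2] at j1
    rw [integral_const_mul, (int_inv_sq ha).2] at j2
    have k1 : c1 / (4 * π) * (5 * a ^ (1/5:ℝ)) ≤ c1 * a ^ (1/5:ℝ) := by
      rw [div_mul_eq_mul_div, div_le_iff₀ (by positivity)]
      have : 0 ≤ c1 * a ^ (1/5:ℝ) := by positivity
      nlinarith
    have k2 : c2 / (4 * π) * (1 / a) ≤ c2 / a := by
      rw [mul_one_div]
      gcongr
      exact div_le_self c20 (by linarith)
    linarith
end

section
theorem rho_rad {f : Phase → ℝ} (hs : SphSym f) (y : E3) : rhoF f y = rhoF f (‖y‖ • ea) := by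
  obtain ⟨R, hd, hx, -⟩ := rot (x := y) (v := 0) (a := ‖y‖ • ea) (b := 0) (by rw [norm_smul]; simp) rfl (by simp)
    (by simp [inner_smul_right, EuclideanSpace.inner_single_left]) (by simp)
  rw [← hx]; unfold rhoF
  rw [← R.measurePreserving.integral_comp R.toHomeomorph.measurableEmbedding (fun v => f (R y, v))]
  exact integral_congr_ae (Eventually.of_forall fun v => (hs R hd (y, v)).symm)

theorem rho_nonneg {f : Phase → ℝ} (hf : memE f) (y : E3) : 0 ≤ rhoF f y := integral_nonneg fun v => hf.2.1 _

theorem rho_meas {f : Phase → ℝ} (hf : memE f) : Measurable (rhoF f) :=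
  (StronglyMeasurable.integral_prod_right (f := fun x v => f (x, v)) hf.1.stronglyMeasurable).measurable

theorem lint_rho {f : Phase → ℝ} (hf : memE f) {G : E3 → ℝ≥0∞} (hG : Measurable G) :
    ∫⁻ y, ENNReal.ofReal (rhoF f y) * G y = ∫⁻ z : Phase, ENNReal.ofReal (f z) * G z.1 := by
  have := hf.1
  rw [Measure.volume_eq_prod, lintegral_prod _ (by fun_prop)]
  have h1 : ∀ᵐ y : E3, Integrable (fun v => f (y, v)) := by
    have := hf.integ
    rw [Measure.volume_eq_prod] at this
    exact this.prod_right_ae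
  refine lintegral_congr_ae (h1.mono fun y hy => ?_)
  simp only
  rw [lintegral_mul_const _ (by fun_prop), rhoF, ofReal_integral_eq_lintegral_ofReal hy (Eventually.of_forall fun v => hf.2.1 _)]

theorem lint_inv_max {r : ℝ} (hr : 0 < r) (σ : ℝ) :
    ∫⁻ s in Ioi r, (if σ < s then ENNReal.ofReal ((s ^ 2)⁻¹) else 0) = ENNReal.ofReal (1 / max r σ) := by
  have hm : 0 < max r σ := lt_max_of_lt_left hr
  have := int_inv_sq hm
  rw [← this.2, ofReal_integral_eq_lintegral_ofReal this.1 (Eventually.of_forall fun s => by positivity)]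
  have e : (fun s : ℝ => if σ < s then ENNReal.ofReal ((s ^ 2)⁻¹) else 0) = (Ioi σ).indicator (fun s => ENNReal.ofReal ((s ^ 2)⁻¹)) := by
    ext s; simp [indicator_apply]
  rw [e, lintegral_indicator measurableSet_Ioi, Measure.restrict_restrict measurableSet_Ioi, Ioi_inter_Ioi, sup_comm]

theorem int_w {r σ : ℝ} (hr : 0 < r) (hσ : 0 < σ) (hne : σ ≠ r) :
    ∫⁻ w in Ioo (-σ) σ, ENNReal.ofReal (1 / √(r ^ 2 + σ ^ 2 - 2 * r * w)) = ENNReal.ofReal (2 * σ / max r σ) := by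
  have pos : ∀ w ∈ Icc (-σ) σ, 0 < r ^ 2 + σ ^ 2 - 2 * r * w := by
    intro w hw
    have : 0 < (r - σ) ^ 2 := by
      have : r - σ ≠ 0 := sub_ne_zero.2 (Ne.symm hne)
      positivity
    nlinarith [hw.2]
  have cont : ContinuousOn (fun w => 1 / √(r ^ 2 + σ ^ 2 - 2 * r * w)) (Icc (-σ) σ) := by
    refine continuousOn_const.div (by fun_prop) fun w hw => (Real.sqrt_pos.2 (pos w hw)).ne'
  have ii : IntervalIntegrable (fun w => 1 / √(r ^ 2 + σ ^ 2 - 2 * r * w)) volume (-σ) σ := by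
    apply ContinuousOn.intervalIntegrable
    rwa [uIcc_of_le (by linarith)]
  have ftc := intervalIntegral.integral_eq_sub_of_hasDerivAt (f := fun w => - √(r ^ 2 + σ ^ 2 - 2 * r * w) / r) (a := -σ) (b := σ)
    (f' := fun w => 1 / √(r ^ 2 + σ ^ 2 - 2 * r * w)) (fun w hw => by
      rw [uIcc_of_le (by linarith)] at hw
      have h2 : HasDerivAt (fun w : ℝ => r ^ 2 + σ ^ 2 - 2 * r * w) (-(2 * r)) w := by
        have := ((hasDerivAt_id w).const_mul (2 * r)).const_sub (r ^ 2 + σ ^ 2)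
        simpa using this
      have := ((h2.sqrt (pos w hw).ne').neg).div_const r
      have hp := Real.sqrt_pos.2 (pos w hw)
      have hq : 1 / √(r ^ 2 + σ ^ 2 - 2 * r * w) = -(-(2 * r) / (2 * √(r ^ 2 + σ ^ 2 - 2 * r * w))) / r := by
        field_simp
      rw [hq]; exact this) ii
  rw [← ofReal_integral_eq_lintegral_ofReal, ← integral_Ioc_eq_integral_Ioo, ← intervalIntegral.integral_of_le (by linarith), ftc]
  · congr 1
    rw [show r ^ 2 + σ ^ 2 - 2 * r * σ = (r - σ) ^ 2 by ring, show r ^ 2 + σ ^ 2 - 2 * r * (-σ) = (r + σ) ^ 2 by ring,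
      Real.sqrt_sq_eq_abs, Real.sqrt_sq (by positivity)]
    rcases le_total r σ with h | h
    · rw [max_eq_right h, abs_of_nonpos (by linarith)]; field_simp; ring
    · rw [max_eq_left h, abs_of_nonneg (by linarith)]; field_simp; ring
  · rw [intervalIntegrable_iff_integrableOn_Ioo_of_le (by linarith)] at ii
    exact ii
  · exact Eventually.of_forall fun w => by positivity

theorem newton_l {f : Phase → ℝ} (hf : memErad f) {x : E3} (hx : x ≠ 0) :
    ∫⁻ y, ENNReal.ofReal (rhoF f y / (4 * π * ‖x - y‖)) = ∫⁻ s in Ioi ‖x‖, ENNReal.ofReal (mF f s / (4 * π * s ^ 2)) := by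
  set r := ‖x‖ with hr
  have r0 : 0 < r := norm_pos_iff.2 hx
  have hm := rho_meas hf.1
  set rr : ℝ → ℝ := fun σ => rhoF f (σ • ea) with hrr
  have mrr : Measurable rr := hm.comp (by fun_prop)
  have rr0 : ∀ σ, 0 ≤ rr σ := fun σ => rho_nonneg hf.1 _
  set n := r⁻¹ • x with hn
  have n1 : ‖n‖ = 1 := by rw [hn, norm_smul, ← hr, norm_inv, Real.norm_of_nonneg r0.le]; field_simp
  have e1 : ∀ y : E3, ENNReal.ofReal (rhoF f y / (4 * π * ‖x - y‖)) =
      ENNReal.ofReal (rr ‖y‖ / (4 * π)) * ENNReal.ofReal (1 / √(r ^ 2 + ‖y‖ ^ 2 - 2 * r * (inner ℝ n y : ℝ))) := by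
    intro y
    have : ‖x - y‖ = √(r ^ 2 + ‖y‖ ^ 2 - 2 * r * (inner ℝ n y : ℝ)) := by
      rw [← Real.sqrt_sq (norm_nonneg (x - y)), norm_sub_sq_real]
      congr 1
      rw [hn, inner_smul_left]
      simp
      field_simp; ring
    rw [this, rho_rad hf.2 y, ← ENNReal.ofReal_mul (div_nonneg (rr0 _) (by positivity))]
    congr 1
    rw [div_mul_div_comm, mul_one]
  simp only [e1]
  rw [cylS (G := fun w σ => ENNReal.ofReal (rr σ / (4 * π)) * ENNReal.ofReal (1 / √(r ^ 2 + σ ^ 2 - 2 * r * w))) (by fun_prop) n1]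
  have e2 : ∫⁻ σ in Ioi (0:ℝ), ENNReal.ofReal σ * ∫⁻ w in Ioo (-σ) σ, ENNReal.ofReal (rr σ / (4 * π)) * ENNReal.ofReal (1 / √(r ^ 2 + σ ^ 2 - 2 * r * w)) =
      ∫⁻ σ in Ioi (0:ℝ), ENNReal.ofReal 2 * (ENNReal.ofReal (σ ^ 2) * (ENNReal.ofReal (rr σ) * ENNReal.ofReal ((1 / max r σ) / (4 * π)))) := by
    refine setLIntegral_congr_fun_ae measurableSet_Ioi ?_
    have : ∀ᵐ σ : ℝ, σ ≠ r := by rw [ae_iff]; simp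
    filter_upwards [this] with σ hne hσ
    have hσ : 0 < σ := hσ
    have := rr0 σ
    rw [lintegral_const_mul' _ _ ENNReal.ofReal_ne_top, int_w r0 hσ hne]
    rw [← ENNReal.ofReal_mul (by positivity), ← ENNReal.ofReal_mul (by positivity), ← ENNReal.ofReal_mul (by positivity), ← ENNReal.ofReal_mul (by positivity), ← ENNReal.ofReal_mul (by positivity)]
    congr 1; ring
  rw [e2, lintegral_const_mul' _ _ ENNReal.ofReal_ne_top, ← mul_assoc, ← ENNReal.ofReal_mul (by positivity), show 2 * π * 2 = 4 * π by ring,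
    ← radial (g := fun σ => ENNReal.ofReal (rr σ) * ENNReal.ofReal ((1 / max r σ) / (4 * π))) (by fun_prop)]
  have e3 : ∀ y : E3, ENNReal.ofReal (rr ‖y‖) = ENNReal.ofReal (rhoF f y) := fun y => by rw [rho_rad hf.2 y]
  simp only [e3]
  rw [lint_rho hf.1 (G := fun y => ENNReal.ofReal (1 / max r ‖y‖ / (4 * π))) (by fun_prop)]
  have hfm := hf.1.1
  have hfi : AEMeasurable (Function.uncurry fun (z : Phase) (s : ℝ) => ENNReal.ofReal (1 / (4 * π)) * (ENNReal.ofReal (f z) * if ‖z.1‖ < s then ENNReal.ofReal (s ^ 2)⁻¹ else 0)) (volume.prod (volume.restrict (Ioi r))) := by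
    refine ((measurable_const).mul (Measurable.mul (by fun_prop) (Measurable.ite (measurableSet_lt (by fun_prop) (by fun_prop)) (by fun_prop) measurable_const))).aemeasurable
  calc _ = ∫⁻ z : Phase, ∫⁻ s in Ioi r, ENNReal.ofReal (1 / (4 * π)) * (ENNReal.ofReal (f z) * if ‖z.1‖ < s then ENNReal.ofReal (s ^ 2)⁻¹ else 0) := by
        congr 1; ext z
        rw [lintegral_const_mul' _ _ ENNReal.ofReal_ne_top, lintegral_const_mul' _ _ ENNReal.ofReal_ne_top, lint_inv_max r0, mul_left_comm (ENNReal.ofReal (1 / (4 * π))),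
          ← ENNReal.ofReal_mul (by positivity : (0:ℝ) ≤ 1 / (4 * π))]
        congr 2; field_simp
    _ = _ := by
        rw [lintegral_lintegral_swap hfi]
        refine setLIntegral_congr_fun measurableSet_Ioi fun s hs => ?_
        have hs : 0 < s := r0.trans hs
        rw [lintegral_const_mul' _ _ ENNReal.ofReal_ne_top]
        have : ∀ z : Phase, (ENNReal.ofReal (f z) * if ‖z.1‖ < s then ENNReal.ofReal (s ^ 2)⁻¹ else 0) = {z : Phase | ‖z.1‖ < s}.indicator (fun z => ENNReal.ofReal (f z) * ENNReal.ofReal (s ^ 2)⁻¹) z := by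
          intro z; by_cases h : ‖z.1‖ < s <;> simp [indicator_apply, h]
        simp only [this]
        rw [lintegral_indicator (ms_lt s), lintegral_mul_const' _ _ ENNReal.ofReal_ne_top, ← ofReal_mF hf.1,
          ← ENNReal.ofReal_mul (mF_nonneg hf.1 s), ← ENNReal.ofReal_mul (by positivity)]
        congr 1; field_simp

theorem newton {f : Phase → ℝ} (hf : memErad f) {x : E3} (hx : x ≠ 0) : phiF f x = Prad f ‖x‖ := by
  unfold phiF Prad
  have hm := rho_meas hf.1
  have hc := (mF_cont hf.1).measurable
  rw [integral_eq_lintegral_of_nonneg_ae, integral_eq_lintegral_of_nonneg_ae, newton_l hf hx]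
  · exact Eventually.of_forall fun s => div_nonneg (mF_nonneg hf.1 s) (by positivity)
  · exact (by fun_prop : Measurable _).aestronglyMeasurable
  · exact Eventually.of_forall fun s => div_nonneg (rho_nonneg hf.1 s) (by positivity)
  · exact (by fun_prop : Measurable _).aestronglyMeasurable
end

section
theorem memE.bd {f : Phase → ℝ} (hf : memE f) : ∀ᵐ z, f z ≤ (eLpNorm f ⊤ volume).toReal := hf.bdd hf.ess ENNReal.toReal_nonneg

theorem m_int {f : Phase → ℝ} (hf : memE f) {B : ℝ} (h0 : 0 ≤ B) (hB : ∀ᵐ z, f z ≤ B) {a : ℝ} (ha : 0 < a) :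
    IntegrableOn (fun s => mF f s / (4 * π * s ^ 2)) (Ioi 0) ∧
    ∫ s in Ioi 0, mF f s / (4 * π * s ^ 2) ≤ (CB * B + kineticE f) * a ^ (1/5:ℝ) + mass f / a :=
  rad_bound (mF_cont hf).continuousOn (fun s _ => mF_nonneg hf s) (fun _ hs => mF_bound hf h0 hB hs)
    (fun s _ => mF_le_mass hf s) ha

theorem m_int1 {f : Phase → ℝ} (hf : memE f) : IntegrableOn (fun s => mF f s / (4 * π * s ^ 2)) (Ioi 0) :=
  (m_int hf ENNReal.toReal_nonneg hf.bd one_pos).1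

theorem mm_int {f g : Phase → ℝ} (hf : memE f) (hg : memE g) {B : ℝ} (h0 : 0 ≤ B) (hB : ∀ᵐ z, f z ≤ B) {a : ℝ} (ha : 0 < a) :
    IntegrableOn (fun s => mF f s * mF g s / (4 * π * s ^ 2)) (Ioi 0) ∧
    ∫ s in Ioi 0, mF f s * mF g s / (4 * π * s ^ 2) ≤ ((CB * B + kineticE f) * mass g) * a ^ (1/5:ℝ) + mass f * mass g / a := by
  have := CB_nonneg
  have := kin_nonneg hf
  refine rad_bound ((mF_cont hf).mul (mF_cont hg)).continuousOn (fun s _ => mul_nonneg (mF_nonneg hf s) (mF_nonneg hg s))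
    (fun s hs => ?_) (fun s _ => mul_le_mul (mF_le_mass hf s) (mF_le_mass hg s) (mF_nonneg hg s) (mass_nonneg hf)) ha
  rw [mul_right_comm]
  exact mul_le_mul (mF_bound hf h0 hB hs) (mF_le_mass hg s) (mF_nonneg hg s) (by positivity)

theorem mm_int1 {f g : Phase → ℝ} (hf : memE f) (hg : memE g) : IntegrableOn (fun s => mF f s * mF g s / (4 * π * s ^ 2)) (Ioi 0) :=
  (mm_int hf hg ENNReal.toReal_nonneg hf.bd one_pos).1

theorem Prad_eq {f : Phase → ℝ} (hf : memE f) {r : ℝ} (hr : 0 ≤ r) :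
    Prad f r = Prad f 0 + ∫ s in (0:ℝ)..r, mF f s / (4 * π * s ^ 2) := by
  have hi := m_int1 hf
  have := intervalIntegral.integral_Ioi_sub_Ioi hi hr
  unfold Prad; linarith

theorem Prad_deriv {f : Phase → ℝ} (hf : memE f) {r : ℝ} (hr : 0 < r) :
    HasDerivAt (Prad f) (mF f r / (4 * π * r ^ 2)) r := by
  have hi := m_int1 hf
  have hc : ContinuousAt (fun s => mF f s / (4 * π * s ^ 2)) r :=
    (mF_cont hf).continuousAt.div (by fun_prop) (by positivity)
  have mm := (mF_cont hf).measurable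
  have h1 := (intervalIntegral.integral_hasDerivAt_right (a := 0) (b := r)
    ((intervalIntegrable_iff_integrableOn_Ioc_of_le hr.le).2 (hi.mono_set Ioc_subset_Ioi_self))
    (Measurable.stronglyMeasurable (by fun_prop)).stronglyMeasurableAtFilter hc).const_add (Prad f 0)
  refine h1.congr_of_eventuallyEq ?_
  filter_upwards [lt_mem_nhds hr] with s hs
  exact Prad_eq hf hs.le

theorem Prad_meas {f : Phase → ℝ} (hf : memE f) : Measurable (Prad f) := by
  have mm := (mF_cont hf).measurable
  have : Prad f = fun r => - ∫ s, (Ioi r).indicator (fun s => mF f s / (4 * π * s ^ 2)) s := by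
    ext r; rw [integral_indicator measurableSet_Ioi]; rfl
  rw [this]
  refine Measurable.neg (StronglyMeasurable.integral_prod_right
    (f := fun r s => (Ioi r).indicator (fun s => mF f s / (4 * π * s ^ 2)) s) ?_).measurable
  refine Measurable.stronglyMeasurable ?_
  have : (Function.uncurry fun r s => (Ioi r).indicator (fun s => mF f s / (4 * π * s ^ 2)) s) =
    fun p : ℝ × ℝ => if p.1 < p.2 then mF f p.2 / (4 * π * p.2 ^ 2) else 0 := by
    ext p; simp [Function.uncurry, indicator_apply]
  rw [this]
  exact Measurable.ite (measurableSet_lt (by fun_prop) (by fun_prop)) (by fun_prop) measurable_const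

theorem Prad_le0 {f : Phase → ℝ} (hf : memE f) (r : ℝ) : Prad f r ≤ 0 :=
  neg_nonpos.2 (integral_nonneg fun s => div_nonneg (mF_nonneg hf s) (by positivity))

theorem Prad_mono0 {f : Phase → ℝ} (hf : memE f) {r : ℝ} (hr : 0 ≤ r) : Prad f 0 ≤ Prad f r := by
  rw [Prad_eq hf hr]
  have : 0 ≤ ∫ s in (0:ℝ)..r, mF f s / (4 * π * s ^ 2) :=
    intervalIntegral.integral_nonneg hr fun s _ => div_nonneg (mF_nonneg hf s) (by positivity)
  linarith

theorem Prad_ge {f : Phase → ℝ} (hf : memE f) {r : ℝ} (hr : 0 < r) : -(mass f / r) ≤ Prad f r := by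
  unfold Prad
  have h4 : (1:ℝ) ≤ 4 * π := by linarith [Real.pi_gt_three]
  have := int_inv_sq hr
  have h := setIntegral_mono_on ((m_int1 hf).mono_set (Ioi_subset_Ioi hr.le)) (this.1.const_mul (mass f)) measurableSet_Ioi
    (fun s hs => by
      have hs : 0 < s := hr.trans hs
      rw [← div_eq_mul_inv]
      have := mF_le_mass hf s
      have := mass_nonneg hf
      gcongr
      nlinarith [sq_nonneg s])
  rw [integral_const_mul, this.2, mul_one_div] at h
  linarith

theorem norm_fderiv {x : E3} (hx : x ≠ 0) : HasFDerivAt (fun y : E3 => ‖y‖) (‖x‖⁻¹ • innerSL ℝ x) x := by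
  have h := (hasStrictFDerivAt_norm_sq x).hasFDerivAt.sqrt (pow_ne_zero 2 (norm_ne_zero_iff.2 hx))
  have e : (fun y : E3 => √(‖y‖ ^ 2)) = fun y => ‖y‖ := by ext y; exact Real.sqrt_sq (norm_nonneg y)
  rw [e, Real.sqrt_sq (norm_nonneg x)] at h
  have hh : (1 / (2 * ‖x‖)) • 2 • (innerSL ℝ) x = ‖x‖⁻¹ • innerSL ℝ x := by
    rw [← Nat.cast_smul_eq_nsmul ℝ, smul_smul]
    congr 1
    have := norm_pos_iff.2 hx
    push_cast
    field_simp
  rw [← hh]; exact h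

theorem grad_eq {f : Phase → ℝ} (hf : memErad f) {x : E3} (hx : x ≠ 0) :
    gradPhi f x = (mF f ‖x‖ / (4 * π * ‖x‖ ^ 3)) • x := by
  have hn := norm_pos_iff.2 hx
  have h1 := (Prad_deriv hf.1 hn).comp_hasFDerivAt x (norm_fderiv hx)
  have h2 : HasFDerivAt (phiF f) ((mF f ‖x‖ / (4 * π * ‖x‖ ^ 2)) • ‖x‖⁻¹ • innerSL ℝ x) x := by
    refine h1.congr_of_eventuallyEq ?_
    filter_upwards [isOpen_ne.mem_nhds hx] with y hy
    exact newton hf hy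
  refine HasGradientAt.gradient ?_
  rw [hasGradientAt_iff_hasFDerivAt]
  have hh : (InnerProductSpace.toDual ℝ E3) ((mF f ‖x‖ / (4 * π * ‖x‖ ^ 3)) • x) = (mF f ‖x‖ / (4 * π * ‖x‖ ^ 2)) • ‖x‖⁻¹ • innerSL ℝ x := by
    ext y
    simp only [InnerProductSpace.toDual_apply_apply, inner_smul_left, FunLike.coe_smul, Pi.smul_apply, innerSL_apply_apply, smul_eq_mul]
    simp
    field_simp
  rw [hh]; exact h2

theorem rad_int {u : ℝ → ℝ} (hu : Continuous u) :
    ∫ x : E3, ‖(u ‖x‖ / (4 * π * ‖x‖ ^ 3)) • x‖ ^ 2 = ∫ s in Ioi 0, u s ^ 2 / (4 * π * s ^ 2) := by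
  have hm := hu.measurable
  rw [integral_eq_lintegral_of_nonneg_ae, integral_eq_lintegral_of_nonneg_ae]
  · congr 1
    have e : ∀ x : E3, ENNReal.ofReal (‖(u ‖x‖ / (4 * π * ‖x‖ ^ 3)) • x‖ ^ 2) = (fun s => ENNReal.ofReal ((u s / (4 * π * s ^ 3)) ^ 2 * s ^ 2)) ‖x‖ := by
      intro x; rw [norm_smul, mul_pow, Real.norm_eq_abs, sq_abs]
    simp only [e]
    rw [radial (g := fun s => ENNReal.ofReal ((u s / (4 * π * s ^ 3)) ^ 2 * s ^ 2)) (by fun_prop), ← lintegral_const_mul' _ _ ENNReal.ofReal_ne_top]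
    refine setLIntegral_congr_fun measurableSet_Ioi fun s hs => ?_
    have hs : 0 < s := hs
    rw [← ENNReal.ofReal_mul (by positivity), ← ENNReal.ofReal_mul (by positivity)]
    congr 1; field_simp
  · exact Eventually.of_forall fun s => by positivity
  · exact (by fun_prop : Measurable _).aestronglyMeasurable
  · exact Eventually.of_forall fun s => by positivity
  · exact (by fun_prop : Measurable _).aestronglyMeasurable

theorem ae_ne0 : ∀ᵐ x : E3, x ≠ 0 := by rw [ae_iff]; simp

theorem fieldSq_eq {f : Phase → ℝ} (hf : memErad f) : fieldSq f = ∫ s in Ioi 0, mF f s ^ 2 / (4 * π * s ^ 2) := by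
  rw [← rad_int (mF_cont hf.1)]
  exact integral_congr_ae (ae_ne0.mono fun x hx => by simp only [grad_eq hf hx])

def DD (f g : Phase → ℝ) : ℝ := ∫ s in Ioi 0, (mF f s - mF g s) ^ 2 / (4 * π * s ^ 2)

theorem DD_nonneg (f g : Phase → ℝ) : 0 ≤ DD f g := integral_nonneg fun s => by positivity

theorem fieldDist_eq {f g : Phase → ℝ} (hf : memErad f) (hg : memErad g) : fieldDist f g = √(DD f g) := by
  unfold DD fieldDist
  rw [← rad_int (u := fun s => mF f s - mF g s) ((mF_cont hf.1).sub (mF_cont hg.1))]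
  congr 1
  refine integral_congr_ae (ae_ne0.mono fun x hx => ?_)
  simp only [grad_eq hf hx, grad_eq hg hx]
  rw [← sub_smul, sub_div]

theorem m2_int {f : Phase → ℝ} (hf : memE f) : IntegrableOn (fun s => mF f s ^ 2 / (4 * π * s ^ 2)) (Ioi 0) := by
  simpa only [sq (mF f _)] using mm_int1 hf hf

theorem DD_int {f g : Phase → ℝ} (hf : memE f) (hg : memE g) :
    IntegrableOn (fun s => (mF f s - mF g s) ^ 2 / (4 * π * s ^ 2)) (Ioi 0) := by
  have := ((m2_int hf).add (m2_int hg)).sub ((mm_int1 hf hg).const_mul 2)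
  refine this.congr (Eventually.of_forall fun s => ?_)
  simp only [Pi.sub_apply, Pi.add_apply]; ring

theorem DD_eq {f g : Phase → ℝ} (hf : memErad f) (hg : memErad g) :
    DD f g = fieldSq f + fieldSq g - 2 * ∫ s in Ioi 0, mF f s * mF g s / (4 * π * s ^ 2) := by
  rw [fieldSq_eq hf, fieldSq_eq hg, DD, ← integral_const_mul, ← integral_add (m2_int hf.1) (m2_int hg.1), ← integral_sub (f := fun s => mF f s ^ 2 / (4 * π * s ^ 2) + mF g s ^ 2 / (4 * π * s ^ 2)) (Integrable.add (m2_int hf.1) (m2_int hg.1)) ((mm_int1 hf.1 hg.1).const_mul 2)]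
  congr 1; ext s; ring
end

section
def mm (f g : Phase → ℝ) : ℝ := ∫ s in Ioi 0, mF f s * mF g s / (4 * π * s ^ 2)

theorem Prad_abs {f : Phase → ℝ} (hf : memE f) {r : ℝ} (hr : 0 ≤ r) : |Prad f r| ≤ -Prad f 0 := by
  rw [abs_of_nonpos (Prad_le0 hf r)]; linarith [Prad_mono0 hf hr]

theorem pair_int {f g : Phase → ℝ} (hf : memE f) (hg : memE g) : Integrable (fun z : Phase => Prad f ‖z.1‖ * g z) := by
  have := Prad_meas hf
  refine hg.integ.bdd_mul (c := -Prad f 0) (by fun_prop : Measurable fun z : Phase => Prad f ‖z.1‖).aestronglyMeasurable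
    (Eventually.of_forall fun z => ?_)
  exact Prad_abs hf (norm_nonneg _)

theorem pair_eq {f g : Phase → ℝ} (hf : memE f) (hg : memE g) : ∫ z : Phase, Prad f ‖z.1‖ * g z = - mm f g := by
  rw [← neg_eq_iff_eq_neg, ← integral_neg]
  have hP := Prad_meas hf
  have hgm := hg.1
  have hmf := (mF_cont hf).measurable
  have hmg := (mF_cont hg).measurable
  unfold mm
  rw [integral_eq_lintegral_of_nonneg_ae, integral_eq_lintegral_of_nonneg_ae]
  · congr 1
    have e : ∀ z : Phase, ENNReal.ofReal (-(Prad f ‖z.1‖ * g z)) =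
        ∫⁻ s in Ioi 0, ENNReal.ofReal (g z) * (if ‖z.1‖ < s then ENNReal.ofReal (mF f s / (4 * π * s ^ 2)) else 0) := by
      intro z
      rw [lintegral_const_mul' _ _ ENNReal.ofReal_ne_top, ← neg_mul, mul_comm, ENNReal.ofReal_mul (hg.2.1 z)]
      congr 1
      unfold Prad
      rw [neg_neg, ofReal_integral_eq_lintegral_ofReal ((m_int1 hf).mono_set (Ioi_subset_Ioi (norm_nonneg _)))
        (Eventually.of_forall fun s => div_nonneg (mF_nonneg hf s) (by positivity))]
      have e : (fun s : ℝ => if ‖z.1‖ < s then ENNReal.ofReal (mF f s / (4 * π * s ^ 2)) else 0) = (Ioi ‖z.1‖).indicator (fun s => ENNReal.ofReal (mF f s / (4 * π * s ^ 2))) := by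
        ext s; simp [indicator_apply]
      rw [e, lintegral_indicator measurableSet_Ioi, Measure.restrict_restrict measurableSet_Ioi, Ioi_inter_Ioi, sup_eq_left.2 (norm_nonneg _)]
    simp only [e]
    rw [lintegral_lintegral_swap]
    · refine setLIntegral_congr_fun measurableSet_Ioi fun s hs => ?_
      have hs : 0 < s := hs
      have : ∀ z : Phase, (ENNReal.ofReal (g z) * if ‖z.1‖ < s then ENNReal.ofReal (mF f s / (4 * π * s ^ 2)) else 0) = {z : Phase | ‖z.1‖ < s}.indicator (fun z => ENNReal.ofReal (g z) * ENNReal.ofReal (mF f s / (4 * π * s ^ 2))) z := by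
        intro z; by_cases h : ‖z.1‖ < s <;> simp [h]
      simp only [this]
      rw [lintegral_indicator (ms_lt s), lintegral_mul_const' _ _ ENNReal.ofReal_ne_top, ← ofReal_mF hg,
          ← ENNReal.ofReal_mul (mF_nonneg hg s)]
      congr 1; ring
    · exact (Measurable.mul (by fun_prop) (Measurable.ite (measurableSet_lt (by fun_prop) (by fun_prop)) (by fun_prop) measurable_const)).aemeasurable
  · exact Eventually.of_forall fun s => div_nonneg (mul_nonneg (mF_nonneg hf s) (mF_nonneg hg s)) (by positivity)
  · exact (by fun_prop : Measurable _).aestronglyMeasurable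
  · refine Eventually.of_forall fun z => ?_
    have := mul_nonneg (neg_nonneg.2 (Prad_le0 hf ‖z.1‖)) (hg.2.1 z)
    simp only [Pi.zero_apply]; linarith
  · exact (by fun_prop : Measurable _).aestronglyMeasurable

theorem e_int {p g : Phase → ℝ} (hp : memE p) (hg : memE g) : Integrable (fun z : Phase => (‖z.2‖ ^ 2 / 2 + Prad p ‖z.1‖) * g z) := by
  refine ((hg.integv.const_mul (1/2)).add (pair_int hp hg)).congr (Eventually.of_forall fun z => ?_)
  simp only [Pi.add_apply]; ring

theorem e_eq {p g : Phase → ℝ} (hp : memE p) (hg : memE g) : ∫ z : Phase, (‖z.2‖ ^ 2 / 2 + Prad p ‖z.1‖) * g z = kineticE g / 2 - mm p g := by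
  have : ∀ z : Phase, (‖z.2‖ ^ 2 / 2 + Prad p ‖z.1‖) * g z = (1/2) * (‖z.2‖ ^ 2 * g z) + Prad p ‖z.1‖ * g z := fun z => by ring
  simp only [this]
  rw [integral_add (hg.integv.const_mul _) (pair_int hp hg), pair_eq hp hg, integral_const_mul, kineticE]; ring

theorem mm_comm (f g : Phase → ℝ) : mm f g = mm g f := by unfold mm; congr 1; ext s; ring

theorem mm_self {f : Phase → ℝ} (hf : memErad f) : mm f f = fieldSq f := by
  rw [fieldSq_eq hf]; unfold mm; congr 1; ext s; ring

theorem Ham2 {p g Q : Phase → ℝ} (hp : memErad p) (hg : memErad g) (hQ : memErad Q) :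
    ∫ z : Phase, (‖z.2‖ ^ 2 / 2 + Prad p ‖z.1‖) * (g z - Q z) = kineticE g / 2 - mm p g - (kineticE Q / 2 - mm p Q) := by
  have : ∀ z : Phase, (‖z.2‖ ^ 2 / 2 + Prad p ‖z.1‖) * (g z - Q z) = (‖z.2‖ ^ 2 / 2 + Prad p ‖z.1‖) * g z - (‖z.2‖ ^ 2 / 2 + Prad p ‖z.1‖) * Q z := fun z => by ring
  simp only [this]
  rw [integral_sub (e_int hp.1 hg.1) (e_int hp.1 hQ.1), e_eq hp.1 hg.1, e_eq hp.1 hQ.1]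

theorem HamQ {g Q : Phase → ℝ} (hg : memErad g) (hQ : memErad Q) :
    Ham g - Ham Q = (∫ z : Phase, (‖z.2‖ ^ 2 / 2 + Prad Q ‖z.1‖) * (g z - Q z)) - DD g Q / 2 := by
  rw [Ham2 hQ hg hQ, DD_eq hg hQ, mm_self hQ]; change _ = _ - (_ - 2 * mm g Q) / 2
  rw [mm_comm Q g]; unfold Ham; ring

theorem Hamg {g Q : Phase → ℝ} (hg : memErad g) (hQ : memErad Q) :
    Ham g - Ham Q = (∫ z : Phase, (‖z.2‖ ^ 2 / 2 + Prad g ‖z.1‖) * (g z - Q z)) + DD g Q / 2 := by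
  rw [Ham2 hg hg hQ, DD_eq hg hQ, mm_self hg]; change _ = _ + (_ - 2 * mm g Q) / 2
  unfold Ham; ring

theorem h_bound {f g : Phase → ℝ} (hf : memE f) (hg : memE g) {c : ℝ} (hc : 0 ≤ c) (h1 : ∀ s, 0 < s → mF f s ≤ c * s ^ (6/5:ℝ))
    (h2 : ∀ s, 0 < s → mF g s ≤ c * s ^ (6/5:ℝ)) {a τ : ℝ} (ha : 0 < a) (hτ : 0 < τ) {r : ℝ} (hr : 0 ≤ r) :
    |Prad f r - Prad g r| ≤ c * a ^ (1/5:ℝ) + 1 / (2 * τ) / a + τ / 2 * DD f g := by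
  have sub := Ioi_subset_Ioi hr
  have key : ∀ s ∈ Ioi (0:ℝ), |mF f s - mF g s| / (4 * π * s ^ 2) ≤ min (c * s ^ (6/5:ℝ)) (1 / (2 * τ)) / (4 * π * s ^ 2) + τ / 2 * ((mF f s - mF g s) ^ 2 / (4 * π * s ^ 2)) := by
    intro s hs
    have hs : 0 < s := hs
    rw [← mul_div_assoc, ← add_div]
    gcongr
    have q1 : |mF f s - mF g s| ≤ c * s ^ (6/5:ℝ) := by
      rw [abs_le]; constructor <;> linarith [h1 s hs, h2 s hs, mF_nonneg hf s, mF_nonneg hg s]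
    have q2 : |mF f s - mF g s| ≤ 1 / (2 * τ) + τ / 2 * (mF f s - mF g s) ^ 2 := by
      rw [← sq_abs]
      set x := |mF f s - mF g s|
      have : 1 / (2 * τ) + τ / 2 * x ^ 2 - x = (τ * x - 1) ^ 2 / (2 * τ) := by field_simp; ring
      have : 0 ≤ (τ * x - 1) ^ 2 / (2 * τ) := by positivity
      linarith
    have q3 : 0 ≤ τ / 2 * (mF f s - mF g s) ^ 2 := by positivity
    rw [min_def]; split_ifs <;> linarith
  obtain ⟨b1, b2⟩ := rad_bound (u := fun s => min (c * s ^ (6/5:ℝ)) (1 / (2 * τ))) (c1 := c) (c2 := 1 / (2 * τ))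
    (ContinuousOn.inf (continuousOn_const.mul (continuousOn_id.rpow_const fun s hs => Or.inl (ne_of_gt hs))) continuousOn_const)
    (fun s hs => by positivity) (fun s _ => min_le_left _ _) (fun s _ => min_le_right _ _) ha
  have i1 := (m_int1 hf).mono_set sub
  have i2 := (m_int1 hg).mono_set sub
  have i3 : IntegrableOn (fun s => |mF f s - mF g s| / (4 * π * s ^ 2)) (Ioi 0) := by
    refine (Integrable.abs (Integrable.sub (m_int1 hf) (m_int1 hg))).congr (Eventually.of_forall fun s => ?_)
    simp only [Pi.sub_apply]
    rw [← sub_div, abs_div, abs_of_nonneg (by positivity : 0 ≤ 4 * π * s ^ 2)]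
  have e : Prad f r - Prad g r = - ∫ s in Ioi r, (mF f s - mF g s) / (4 * π * s ^ 2) := by
    unfold Prad
    have : ∀ s, (mF f s - mF g s) / (4 * π * s ^ 2) = mF f s / (4 * π * s ^ 2) - mF g s / (4 * π * s ^ 2) := fun s => by ring
    simp only [this]
    rw [integral_sub i1 i2]; ring
  rw [e, abs_neg]
  have s1 : |∫ s in Ioi r, (mF f s - mF g s) / (4 * π * s ^ 2)| ≤ ∫ s in Ioi r, |mF f s - mF g s| / (4 * π * s ^ 2) := by
    refine (abs_integral_le_integral_abs).trans (le_of_eq ?_)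
    congr 1; ext s
    rw [abs_div, abs_of_nonneg (by positivity : 0 ≤ 4 * π * s ^ 2)]
  have s2 : ∫ s in Ioi r, |mF f s - mF g s| / (4 * π * s ^ 2) ≤ ∫ s in Ioi 0, |mF f s - mF g s| / (4 * π * s ^ 2) :=
    setIntegral_mono_set i3 (Eventually.of_forall fun s => by positivity) (LE.le.eventuallyLE sub)
  have s3 := setIntegral_mono_on i3 (Integrable.add b1 ((DD_int hf hg).const_mul (τ/2))) measurableSet_Ioi key
  simp only [Pi.add_apply] at s3
  rw [integral_add b1 ((DD_int hf hg).const_mul (τ/2)), integral_const_mul] at s3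
  unfold DD
  linarith

theorem fieldSq_le {f : Phase → ℝ} (hf : memErad f) {B : ℝ} (h0 : 0 ≤ B) (hB : ∀ᵐ z, f z ≤ B) {a : ℝ} (ha : 0 < a) :
    fieldSq f ≤ (CB * B + kineticE f) * mass f * a ^ (1/5:ℝ) + mass f * mass f / a := by
  rw [← mm_self hf]; exact (mm_int hf.1 hf.1 h0 hB ha).2

theorem mF_diff {f g : Phase → ℝ} (hf : memE f) (hg : memE g) (s : ℝ) : |mF f s - mF g s| ≤ distL1 f g := by
  unfold mF distL1
  rw [← integral_sub hf.integ.integrableOn hg.integ.integrableOn]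
  refine abs_integral_le_integral_abs.trans ?_
  exact setIntegral_le_integral (hf.integ.sub hg.integ).abs (Eventually.of_forall fun z => abs_nonneg _)

theorem DD_small {f g : Phase → ℝ} (hf : memE f) (hg : memE g) :
    DD f g ≤ distL1 f g * (- Prad f 0 - Prad g 0) := by
  unfold DD Prad
  rw [neg_neg, sub_neg_eq_add, ← integral_add (m_int1 hf) (m_int1 hg), ← integral_const_mul]
  refine setIntegral_mono_on (DD_int hf hg) ((Integrable.add (m_int1 hf) (m_int1 hg)).const_mul _) measurableSet_Ioi fun s hs => ?_
  have hs : 0 < s := hs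
  rw [← add_div, ← mul_div_assoc, ← sq_abs, sq]
  have := mF_diff hf hg s
  have h1 := mF_nonneg hf s
  have h2 := mF_nonneg hg s
  have : |mF f s - mF g s| ≤ mF f s + mF g s := by rw [abs_le]; constructor <;> linarith
  gcongr
  exact (abs_nonneg _).trans ‹_›

theorem Prad0_ge {f : Phase → ℝ} (hf : memE f) {B : ℝ} (h0 : 0 ≤ B) (hB : ∀ᵐ z, f z ≤ B) :
    - Prad f 0 ≤ CB * B + kineticE f + mass f := by
  have := (m_int hf h0 hB one_pos).2
  simp only [one_rpow, mul_one, div_one] at this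
  unfold Prad; linarith

theorem DD_tri {f g k : Phase → ℝ} (hf : memE f) (hg : memE g) (hk : memE k) : DD f k ≤ 2 * DD f g + 2 * DD g k := by
  unfold DD
  rw [← integral_const_mul, ← integral_const_mul, ← integral_add ((DD_int hf hg).const_mul 2) ((DD_int hg hk).const_mul 2)]
  refine setIntegral_mono_on (DD_int hf hk) (Integrable.add ((DD_int hf hg).const_mul 2) ((DD_int hg hk).const_mul 2)) measurableSet_Ioi fun s hs => ?_
  have hs : 0 < s := hs
  rw [← mul_div_assoc, ← mul_div_assoc, ← add_div]
  gcongr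
  nlinarith [sq_nonneg ((mF f s - mF g s) - (mF g s - mF k s))]

theorem DD_comm (f g : Phase → ℝ) : DD f g = DD g f := by unfold DD; congr 1; ext s; ring

theorem kin_eq (f : Phase → ℝ) : kineticE f = 2 * Ham f + fieldSq f := by unfold Ham; ring

theorem kin_bd {f : Phase → ℝ} (hf : memErad f) {B m : ℝ} (h0 : 0 ≤ B) (hB : ∀ᵐ z, f z ≤ B) (hm : mass f ≤ m) {a : ℝ} (ha : 0 < a)
    (ham : m * a ^ (1/5:ℝ) ≤ 1/2) : kineticE f ≤ 4 * Ham f + CB * B + 2 * (m * m / a) := by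
  have h1 := fieldSq_le hf h0 hB ha
  have h2 := kin_eq f
  have k0 := kin_nonneg hf.1
  have m0 := mass_nonneg hf.1
  have c0 := CB_nonneg
  have h3 : (CB * B + kineticE f) * mass f * a ^ (1/5:ℝ) ≤ (CB * B + kineticE f) * (1/2) := by
    rw [mul_assoc]; gcongr
    refine le_trans ?_ ham; gcongr
  have h4 : mass f * mass f / a ≤ m * m / a := by gcongr; exact m0.trans hm
  linarith

-- fieldSq g in terms of DD
theorem fieldSq_DD {g Q : Phase → ℝ} (hg : memErad g) (hQ : memErad Q) : fieldSq g ≤ 2 * DD g Q + 2 * fieldSq Q := by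
  rw [fieldSq_eq hg, fieldSq_eq hQ]
  unfold DD
  rw [← integral_const_mul, ← integral_const_mul, ← integral_add ((DD_int hg.1 hQ.1).const_mul 2) ((m2_int hQ.1).const_mul 2)]
  refine setIntegral_mono_on (m2_int hg.1) (Integrable.add ((DD_int hg.1 hQ.1).const_mul 2) ((m2_int hQ.1).const_mul 2)) measurableSet_Ioi fun s hs => ?_
  have hs : 0 < s := hs
  rw [← mul_div_assoc, ← mul_div_assoc, ← add_div]
  gcongr
  nlinarith [sq_nonneg ((mF g s - mF Q s) - mF Q s)]
end

section
section
variable {Q : Phase → ℝ} {F : ℝ → ℝ → ℝ} {e₀ : ℝ}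

theorem F_ce (hQ : AssumptionA Q F e₀) {l : ℝ} (hl : 0 ≤ l) : Continuous (fun e => F e l) := by
  have := hQ.Fcont.comp (f := fun e : ℝ => (e, l)) (s := univ) (by fun_prop) (fun e _ => hl)
  exact continuousOn_univ.1 this

theorem F_cl (hQ : AssumptionA Q F e₀) (e : ℝ) : Continuous (fun l => F e (max l 0)) := by
  have := hQ.Fcont.comp (f := fun l : ℝ => (e, max l 0)) (s := univ) (by fun_prop) (fun l _ => show (0:ℝ) ≤ max l 0 from le_max_right _ _)
  exact continuousOn_univ.1 this

theorem F_anti (hQ : AssumptionA Q F e₀) {l : ℝ} (hl : 0 ≤ l) {a b : ℝ} (hab : a < b) (hb : 0 < F b l) : F b l < F a l := by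
  have hc := F_ce hQ hl
  have key : ∀ c, c < b → (∀ x ∈ Ioo c b, 0 < F x l) → F b l < F c l := by
    intro c hcb hpos
    have := strictAntiOn_of_deriv_neg (convex_Icc c b) hc.continuousOn (fun x hx => by
      rw [interior_Icc] at hx; exact hQ.FeNeg x l hl (hpos x hx))
    exact this (left_mem_Icc.2 hcb.le) (right_mem_Icc.2 hcb.le) hcb
  by_contra hcon
  have hz : ∃ x ∈ Ioo a b, F x l = 0 := by
    by_contra h
    push Not at h
    exact hcon (key a hab fun x hx => lt_of_le_of_ne (hQ.Fnonneg x l hl) (Ne.symm (h x hx)))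
  obtain ⟨x, hx, hx0⟩ := hz
  set Z := {y | F y l = 0} ∩ Icc x b with hZ
  have cZ : IsClosed Z := (isClosed_eq hc continuous_const).inter isClosed_Icc
  have bZ : BddAbove Z := ⟨b, fun y hy => hy.2.2⟩
  have nZ : Z.Nonempty := ⟨x, hx0, left_mem_Icc.2 hx.2.le⟩
  have hs := cZ.csSup_mem nZ bZ
  set c := sSup Z with hcdef
  have cb : c < b := lt_of_le_of_ne hs.2.2 (by rintro h; rw [h] at hs; have : F b l = 0 := hs.1; linarith)
  have := key c cb (fun y hy => by
    refine lt_of_le_of_ne (hQ.Fnonneg y l hl) fun h => ?_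
    have : y ≤ c := le_csSup bZ ⟨h.symm, (hs.2.1.trans hy.1.le), hy.2.le⟩
    exact absurd hy.1 (not_lt.2 this))
  have h0 : F c l = 0 := hs.1
  linarith

def Elev (F : ℝ → ℝ → ℝ) (C0 S : ℝ) (q : ℝ × ℝ) : ℝ :=
  if 0 ≤ q.1 ∧ 0 < q.2 ∧ q.2 < S then sSup (insert (-C0) {e | -C0 ≤ e ∧ q.2 < F e q.1}) else -C0

variable {C0 S : ℝ}

theorem Elev_bdd (hQ : AssumptionA Q F e₀) (h0 : -C0 ≤ e₀) {l s : ℝ} (hl : 0 ≤ l) (hs : 0 < s) :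
    ∀ e ∈ insert (-C0) {e | -C0 ≤ e ∧ s < F e l}, e ≤ e₀ := by
  rintro e (rfl | he)
  · exact h0
  · exact (hQ.Fsupp e l hl (hs.trans he.2)).le

theorem Elev_le (hQ : AssumptionA Q F e₀) (h0 : -C0 ≤ e₀) (q : ℝ × ℝ) : Elev F C0 S q ≤ e₀ := by
  unfold Elev
  split_ifs with h
  · exact csSup_le ⟨_, mem_insert _ _⟩ (Elev_bdd hQ h0 h.1 h.2.1)
  · exact h0

theorem Elev_ge (hQ : AssumptionA Q F e₀) (h0 : -C0 ≤ e₀) (q : ℝ × ℝ) : -C0 ≤ Elev F C0 S q := by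
  unfold Elev
  split_ifs with h
  · exact le_csSup ⟨e₀, Elev_bdd hQ h0 h.1 h.2.1⟩ (mem_insert _ _)
  · exact le_rfl

theorem Elev_iff (hQ : AssumptionA Q F e₀) (h0 : -C0 ≤ e₀) {l s e : ℝ} (he : -C0 ≤ e) :
    e < Elev F C0 S (l, s) ↔ 0 ≤ l ∧ 0 < s ∧ s < S ∧ s < F e l := by
  unfold Elev
  split_ifs with h
  · obtain ⟨hl, hs, hS⟩ := h
    simp only at hl hs hS ⊢
    constructor
    · intro h
      obtain ⟨e', he', hlt⟩ := exists_lt_of_lt_csSup ⟨_, mem_insert _ _⟩ h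
      rcases he' with rfl | he'
      · exact absurd hlt (not_lt.2 he)
      · exact ⟨hl, hs, hS, he'.2.trans (F_anti hQ hl hlt (hs.trans he'.2))⟩
    · rintro ⟨-, -, -, h⟩
      have : ∀ᶠ e' in 𝓝[>] e, s < F e' l := (F_ce hQ hl).continuousAt.continuousWithinAt.eventually (lt_mem_nhds h)
      obtain ⟨e', h1, h2⟩ := (this.and self_mem_nhdsWithin).exists
      have h2 : e < e' := h2
      exact h2.trans_le (le_csSup ⟨e₀, Elev_bdd hQ h0 hl hs⟩ (Or.inr ⟨he.trans h2.le, h1⟩))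
  · constructor
    · intro h; exact absurd h (not_lt.2 he)
    · rintro ⟨a, b, c, d⟩; exact absurd ⟨a, b, c⟩ h

theorem Elev_meas (hQ : AssumptionA Q F e₀) (h0 : -C0 ≤ e₀) : Measurable (Elev F C0 S) := by
  refine measurable_of_Ioi fun c => ?_
  by_cases hc : -C0 ≤ c
  · have : Elev F C0 S ⁻¹' Ioi c = {q | 0 ≤ q.1} ∩ {q | 0 < q.2} ∩ {q | q.2 < S} ∩ {q | q.2 < F c (max q.1 0)} := by
      ext ⟨l, s⟩
      simp only [mem_preimage, mem_Ioi, mem_inter_iff, mem_ofPred_eq]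
      rw [Elev_iff hQ h0 hc]
      constructor
      · rintro ⟨a, b, c, d⟩; exact ⟨⟨⟨a, b⟩, c⟩, by rwa [max_eq_left a]⟩
      · rintro ⟨⟨⟨a, b⟩, c⟩, d⟩; exact ⟨a, b, c, by rwa [max_eq_left a] at d⟩
    rw [this]
    have := (F_cl hQ c).measurable
    refine (((measurableSet_le ?_ ?_).inter (measurableSet_lt ?_ ?_)).inter (measurableSet_lt ?_ ?_)).inter (measurableSet_lt ?_ (this.comp measurable_fst)) <;> fun_prop
  · have : Elev F C0 S ⁻¹' Ioi c = univ := by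
      ext q; simp only [mem_preimage, mem_Ioi, mem_univ, iff_true]
      exact (not_le.1 hc).trans_le (Elev_ge hQ h0 q)
    rw [this]; exact MeasurableSet.univ

theorem Elev_eq (hQ : AssumptionA Q F e₀) (h0 : -C0 ≤ e₀) {l s e : ℝ} (he : -C0 < e) (h : e = Elev F C0 S (l, s)) : s = F e l := by
  have hh : 0 ≤ l ∧ 0 < s ∧ s < S := by
    by_contra hn
    rw [Elev, if_neg hn] at h
    linarith
  obtain ⟨hl, hs, hS⟩ := hh
  apply le_antisymm
  · have : ∀ᶠ e' in 𝓝[<] e, s ≤ F e' l := by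
      filter_upwards [self_mem_nhdsWithin, nhdsWithin_le_nhds (lt_mem_nhds he)] with e' h1 h2
      have : e' < Elev F C0 S (l, s) := by rw [← h]; exact h1
      exact ((Elev_iff hQ h0 (le_of_lt h2)).1 this).2.2.2.le
    exact ge_of_tendsto ((F_ce hQ hl).continuousAt.continuousWithinAt (s := Iio e)) this
  · by_contra hn
    have := (Elev_iff (S := S) hQ h0 he.le).2 ⟨hl, hs, hS, not_le.1 hn⟩
    linarith
end

section
section
variable {Q : Phase → ℝ} {F : ℝ → ℝ → ℝ} {e₀ : ℝ}

theorem Q_memE (hQ : AssumptionA Q F e₀) : memErad Q := by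
  refine ⟨⟨hQ.contQ.measurable, hQ.nonneg, ?_⟩, hQ.sph⟩
  unfold eNormE
  refine ENNReal.add_lt_top.2 ⟨ENNReal.add_lt_top.2 ⟨?_, ?_⟩, ?_⟩
  · exact (hQ.contQ.memLp_of_hasCompactSupport hQ.cpt).2
  · exact (hQ.contQ.memLp_of_hasCompactSupport hQ.cpt).2
  · have hc : Continuous (fun z : Phase => ‖z.2‖ ^ 2 * Q z) := by have := hQ.contQ; fun_prop
    have hi : Integrable (fun z : Phase => ‖z.2‖ ^ 2 * Q z) := hc.integrable_of_hasCompactSupport hQ.cpt.mul_left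
    have := hi.2
    unfold HasFiniteIntegral at this
    refine lt_of_eq_of_lt ?_ this
    congr 1; ext z
    rw [enorm_mul, enorm_pow]
    simp [enorm_eq_nnnorm]

theorem Q_bound (hQ : AssumptionA Q F e₀) : ∃ S, 0 < S ∧ ∀ z, Q z ≤ S := by
  obtain ⟨C, hC⟩ := hQ.cpt.exists_bound_of_continuous hQ.contQ
  exact ⟨|C| + 1, by positivity, fun z => (le_abs_self _).trans ((hC z).trans ((le_abs_self C).trans (by linarith)))⟩

theorem Q_rad (hQ : AssumptionA Q F e₀) : ∃ R, 0 < R ∧ ∀ z, Q z ≠ 0 → ‖z‖ ≤ R := by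
  obtain ⟨R, h0, hR⟩ := hQ.cpt.isCompact.isBounded.exists_pos_norm_le
  exact ⟨R, h0, fun z hz => hR z (subset_tsupport _ hz)⟩

theorem Q_rho_cont (hQ : AssumptionA Q F e₀) : Continuous (rhoF Q) := by
  obtain ⟨R, h0, hR⟩ := Q_rad hQ
  have := continuous_parametric_integral_of_continuous (μ := (volume : Measure E3)) (f := fun x v => Q (x, v)) hQ.contQ (isCompact_closedBall (0:E3) R)
  have e : rhoF Q = fun x => ∫ v in Metric.closedBall (0:E3) R, Q (x, v) := by
    ext x
    unfold rhoF
    rw [setIntegral_eq_integral_of_forall_compl_eq_zero]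
    intro v hv
    by_contra h
    exact hv (by rw [mem_closedBall_zero_iff]; exact (norm_snd_le (x, v)).trans (hR _ h))
  rw [e]; exact this

theorem Q_rho_bdd (hQ : AssumptionA Q F e₀) : ∃ ρm, ∀ x, rhoF Q x ≤ ρm := by
  have hc : HasCompactSupport (rhoF Q) := by
    obtain ⟨R, h0, hR⟩ := Q_rad hQ
    refine HasCompactSupport.of_support_subset_isCompact (isCompact_closedBall (0:E3) R) fun x hx => ?_
    rw [mem_closedBall_zero_iff]
    by_contra h
    apply hx
    unfold rhoF
    rw [← integral_zero E3 ℝ (μ := volume)]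
    congr 1; ext v
    by_contra h2
    exact h ((norm_fst_le (x, v)).trans (hR _ h2))
  obtain ⟨C, hC⟩ := hc.exists_bound_of_continuous (Q_rho_cont hQ)
  exact ⟨C, fun x => (le_abs_self _).trans (hC x)⟩

def nQ (Q : Phase → ℝ) (r : ℝ) : ℝ := 4 * π * r ^ 2 * rhoF Q (r • ea)

theorem nQ_cont (hQ : AssumptionA Q F e₀) : Continuous (nQ Q) := by
  have := Q_rho_cont hQ
  unfold nQ; fun_prop

theorem nQ_nonneg (hQ : AssumptionA Q F e₀) (r : ℝ) : 0 ≤ nQ Q r := by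
  have := rho_nonneg (Q_memE hQ).1 (r • ea)
  unfold nQ; positivity

theorem mF_nQ (hQ : AssumptionA Q F e₀) {s : ℝ} (hs : 0 ≤ s) : mF Q s = ∫ σ in (0:ℝ)..s, nQ Q σ := by
  have hE := Q_memE hQ
  have hrm := (Q_rho_cont hQ).measurable
  have hi : IntegrableOn (nQ Q) (Ioc 0 s) := (nQ_cont hQ).integrableOn_Ioc
  have key : ENNReal.ofReal (mF Q s) = ENNReal.ofReal (∫ σ in (0:ℝ)..s, nQ Q σ) := by
    rw [ofReal_mF hE.1, intervalIntegral.integral_of_le hs, ofReal_integral_eq_lintegral_ofReal hi (Eventually.of_forall fun σ => nQ_nonneg hQ σ),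
      ← lintegral_indicator (ms_lt s)]
    have e1 : ∀ z : Phase, {z : Phase | ‖z.1‖ < s}.indicator (fun z => ENNReal.ofReal (Q z)) z = ENNReal.ofReal (Q z) * (Iio s).indicator 1 ‖z.1‖ := by
      intro z; by_cases h : ‖z.1‖ < s <;> simp [indicator_apply, h]
    simp only [e1]
    have hI : Measurable ((Iio s).indicator (1 : ℝ → ℝ≥0∞)) := measurable_one.indicator measurableSet_Iio
    rw [← lint_rho hE.1 (G := fun y => (Iio s).indicator 1 ‖y‖) (hI.comp measurable_norm)]
    have e2 : ∀ y : E3, ENNReal.ofReal (rhoF Q y) * (Iio s).indicator 1 ‖y‖ = (fun σ => ENNReal.ofReal (rhoF Q (σ • ea)) * (Iio s).indicator 1 σ) ‖y‖ := by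
      intro y; rw [rho_rad hE.2 y]
    simp only [e2]
    rw [radial (g := fun σ => ENNReal.ofReal (rhoF Q (σ • ea)) * (Iio s).indicator 1 σ) (Measurable.mul (by fun_prop) hI),
      ← lintegral_const_mul' _ _ ENNReal.ofReal_ne_top, setLIntegral_congr Ioo_ae_eq_Ioc.symm]
    rw [show Ioo 0 s = Iio s ∩ Ioi 0 by ext; simp [and_comm], ← Measure.restrict_restrict measurableSet_Iio, ← lintegral_indicator measurableSet_Iio]
    congr 1; ext σ
    by_cases h : σ < s
    · simp only [indicator_apply, mem_Iio, h, if_true, Pi.one_apply, mul_one]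
      rw [← mul_assoc, ← ENNReal.ofReal_mul (by positivity), ← ENNReal.ofReal_mul (by positivity)]; rfl
    · simp [h]
  have h1 : 0 ≤ ∫ σ in (0:ℝ)..s, nQ Q σ := intervalIntegral.integral_nonneg hs fun σ _ => nQ_nonneg hQ σ
  exact (ENNReal.ofReal_eq_ofReal_iff (mF_nonneg hE.1 s) h1).1 key

theorem mF_deriv (hQ : AssumptionA Q F e₀) {r : ℝ} (hr : 0 < r) : HasDerivAt (mF Q) (nQ Q r) r := by
  have hc := nQ_cont hQ
  refine (intervalIntegral.integral_hasDerivAt_right (hc.intervalIntegrable 0 r) (hc.stronglyMeasurable.stronglyMeasurableAtFilter) hc.continuousAt).congr_of_eventuallyEq ?_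
  filter_upwards [lt_mem_nhds hr] with s hs
  exact mF_nQ hQ hs.le

def C0Q (Q : Phase → ℝ) (e₀ : ℝ) : ℝ := 1 - Prad Q 0 - e₀

theorem C0Q_le (hQ : AssumptionA Q F e₀) : -C0Q Q e₀ < e₀ := by
  have := Prad_le0 (Q_memE hQ).1 0
  unfold C0Q; linarith [hQ.e₀neg]

theorem C0Q_pot (hQ : AssumptionA Q F e₀) {r : ℝ} (hr : 0 ≤ r) : -C0Q Q e₀ < Prad Q r := by
  have := Prad_mono0 (Q_memE hQ).1 hr
  unfold C0Q; linarith [hQ.e₀neg]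

theorem Q_pot (hQ : AssumptionA Q F e₀) : ∃ R, PotData (Prad Q) (mF Q) (nQ Q) (C0Q Q e₀) R e₀ := by
  have hE := (Q_memE hQ).1
  have hm := mass_nonneg hE
  have h0 := hQ.e₀neg
  refine ⟨(2 * mass Q + 1) / (-e₀), fun r hr => mF_deriv hQ hr, fun r _ => nQ_nonneg hQ r, (nQ_cont hQ).continuousOn,
    fun r _ => mF_nonneg hE r, fun r hr => Prad_deriv hE hr, fun r hr => (C0Q_pot hQ hr.le).le, div_pos (by positivity) (by linarith),
    fun r hr => ?_, h0⟩
  have hr0 : 0 < r := lt_of_lt_of_le (div_pos (by positivity) (by linarith)) hr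
  have := Prad_ge hE hr0
  rw [div_le_iff₀ (by linarith)] at hr
  have : mass Q / r ≤ -(e₀ / 2) := by rw [div_le_iff₀ hr0]; nlinarith
  linarith

def eQ (Q : Phase → ℝ) (z : Phase) : ℝ := ‖z.2‖ ^ 2 / 2 + Prad Q ‖z.1‖

theorem eQ_gt (hQ : AssumptionA Q F e₀) (z : Phase) : -C0Q Q e₀ < eQ Q z := by
  have := C0Q_pot hQ (norm_nonneg z.1)
  unfold eQ; nlinarith [sq_nonneg ‖z.2‖]

theorem eQ_F (hQ : AssumptionA Q F e₀) {z : Phase} (hz : z.1 ≠ 0) : Q z = F (eQ Q z) (ellOf z) := by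
  rw [hQ.eqF, microE, newton (Q_memE hQ) hz]; rfl

theorem lev_iff (hQ : AssumptionA Q F e₀) {S : ℝ} (hS : ∀ z, Q z ≤ S) {z : Phase} (hz : z.1 ≠ 0) {s : ℝ} (hs : 0 < s) :
    eQ Q z < Elev F (C0Q Q e₀) S (ellOf z, s) ↔ s < Q z := by
  rw [Elev_iff hQ (C0Q_le hQ).le (eQ_gt hQ z).le, ← eQ_F hQ hz]
  exact ⟨fun h => h.2.2.2, fun h => ⟨ellOf_nonneg z, hs, h.trans_le (hS z), h⟩⟩

theorem PP_facts {r w l : ℝ} (hr : 0 < r) (hl : 0 ≤ l) : ‖(PP r w l).1‖ = r ∧ (PP r w l).1 ≠ 0 ∧ ‖(PP r w l).2‖ ^ 2 = w ^ 2 + l / r ^ 2 ∧ ellOf (PP r w l) = l ∧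
    (inner ℝ (PP r w l).1 (PP r w l).2 : ℝ) = r * w := by
  have h1 : ‖(PP r w l).1‖ = r := by unfold PP; simp [norm_smul, abs_of_pos hr]
  have h2 : ‖(PP r w l).2‖ ^ 2 = w ^ 2 + l / r ^ 2 := by
    unfold PP
    rw [norm_sq3]
    simp [div_pow, Real.sq_sqrt hl]
  have h3 : (inner ℝ (PP r w l).1 (PP r w l).2 : ℝ) = r * w := by
    unfold PP
    simp [inner_smul_left, inner_add_right, inner_smul_right, EuclideanSpace.inner_single_left]
    ring
  refine ⟨h1, ?_, h2, ?_, h3⟩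
  · rw [← norm_pos_iff, h1]; exact hr
  · unfold ellOf; rw [h1, h2, h3]; field_simp; ring

theorem nQ_eq (hQ : AssumptionA Q F e₀) {S : ℝ} (hS : ∀ z, Q z ≤ S) {r : ℝ} (hr : 0 < r) :
    ∫⁻ q in quad, ENNReal.ofReal (√(2 * yF (Prad Q) (Elev F (C0Q Q e₀) S q) q.1 r)) = ENNReal.ofReal (nQ Q r / (8 * π ^ 2)) := by
  have hE := Q_memE hQ
  have hcQ := hQ.contQ.measurable
  have hEm : Measurable (Elev F (C0Q Q e₀) S) := Elev_meas hQ (C0Q_le hQ).le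
  -- rho as integral
  have hi : Integrable (fun v : E3 => Q (r • ea, v)) := by
    have hc : Continuous (fun v : E3 => Q (r • ea, v)) := hQ.contQ.comp (by fun_prop)
    refine hc.integrable_of_hasCompactSupport ?_
    obtain ⟨R, h0, hR⟩ := Q_rad hQ
    refine HasCompactSupport.of_support_subset_isCompact (isCompact_closedBall (0:E3) R) fun v hv => ?_
    rw [mem_closedBall_zero_iff]
    exact (norm_snd_le (r • ea, v)).trans (hR _ hv)
  have e1 : ENNReal.ofReal (rhoF Q (r • ea)) = ENNReal.ofReal π * ∫⁻ w, ∫⁻ t in Ioi (0:ℝ), ENNReal.ofReal (Q (PP r w (r ^ 2 * t))) := by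
    unfold rhoF
    rw [ofReal_integral_eq_lintegral_ofReal hi (Eventually.of_forall fun v => hQ.nonneg _),
      ← cyl (n := ea) (G := fun w t => ENNReal.ofReal (Q (PP r w (r ^ 2 * t)))) (by have := PP_meas; unfold PP; fun_prop) (by simp)]
    congr 1; ext v
    congr 1
    have hz : ((r • ea, v) : Phase).1 ≠ 0 := by
      rw [← norm_pos_iff]; simp [norm_smul, hr.ne']
    rw [sph_PP hQ.sph hz]
    have hn : ‖((r • ea, v) : Phase).1‖ = r := by simp [norm_smul, abs_of_pos hr]
    rw [hn]
    have i1 : (inner ℝ ((r • ea, v) : Phase).1 ((r • ea, v) : Phase).2 : ℝ) = r * inner ℝ ea v := by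
      simp only [inner_smul_left]; simp
    have i2 : ellOf ((r • ea, v) : Phase) = r ^ 2 * (‖v‖ ^ 2 - (inner ℝ ea v : ℝ) ^ 2) := by
      unfold ellOf; rw [hn, i1]; ring
    rw [i1, i2, mul_div_cancel_left₀ _ hr.ne']
  have e2 : ∀ w : ℝ, ∫⁻ t in Ioi (0:ℝ), ENNReal.ofReal (Q (PP r w (r ^ 2 * t))) = ENNReal.ofReal (1 / r ^ 2) * ∫⁻ l in Ioi (0:ℝ), ENNReal.ofReal (Q (PP r w l)) := by
    intro w
    have im : (fun t : ℝ => r ^ 2 * t) '' Ioi 0 = Ioi 0 := by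
      rw [image_mul_left_Ioi (by positivity), mul_zero]
    have h4 := lintegral_image_eq_lintegral_abs_deriv_mul (f := fun t : ℝ => r ^ 2 * t) (f' := fun _ => r ^ 2) (s := Ioi 0) measurableSet_Ioi
      (fun x hx => by simpa using ((hasDerivAt_id x).const_mul (r ^ 2)).hasDerivWithinAt)
      (fun a ha b hb hab => by
        have : r ^ 2 ≠ 0 := by positivity
        exact mul_left_cancel₀ this hab) (fun l => ENNReal.ofReal (Q (PP r w l)))
    rw [im, lintegral_const_mul' _ _ ENNReal.ofReal_ne_top, abs_of_pos (by positivity)] at h4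
    rw [h4, ← mul_assoc, ← ENNReal.ofReal_mul (by positivity), one_div, inv_mul_cancel₀ (by positivity)]; simp
  have e3 : ∀ w l : ℝ, 0 < l → ENNReal.ofReal (Q (PP r w l)) = ∫⁻ s in Ioi (0:ℝ), if w ^ 2 / 2 < yF (Prad Q) (Elev F (C0Q Q e₀) S (l, s)) l r then 1 else 0 := by
    intro w l hl
    obtain ⟨p1, p2, p3, p4, -⟩ := PP_facts (w := w) hr hl.le
    have : ∀ s ∈ Ioi (0:ℝ), (if w ^ 2 / 2 < yF (Prad Q) (Elev F (C0Q Q e₀) S (l, s)) l r then (1:ℝ≥0∞) else 0) = (Iio (Q (PP r w l))).indicator 1 s := by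
      intro s hs
      have h := lev_iff hQ hS p2 hs
      rw [p4] at h
      have h2 : w ^ 2 / 2 < yF (Prad Q) (Elev F (C0Q Q e₀) S (l, s)) l r ↔ eQ Q (PP r w l) < Elev F (C0Q Q e₀) S (l, s) := by
        unfold yF eQ; rw [p1, p3]
        rw [show l / (2 * r ^ 2) = l / r ^ 2 / 2 by field_simp]
        constructor <;> intro h <;> linarith
      simp only [h2, h, indicator_apply, mem_Iio, Pi.one_apply]
    rw [setLIntegral_congr_fun measurableSet_Ioi this, lintegral_indicator_one measurableSet_Iio, Measure.restrict_apply measurableSet_Iio,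
      Iio_inter_Ioi, Real.volume_Ioo, sub_zero]
  have mT : Measurable (fun p : ℝ × ℝ × ℝ => if p.1 ^ 2 / 2 < yF (Prad Q) (Elev F (C0Q Q e₀) S p.2) p.2.1 r then (1:ℝ≥0∞) else 0) := by
    refine Measurable.ite (measurableSet_lt (by fun_prop) ?_) measurable_const measurable_const
    unfold yF; fun_prop
  have e4 : ∫⁻ w, ∫⁻ l in Ioi (0:ℝ), ENNReal.ofReal (Q (PP r w l)) = ENNReal.ofReal 2 * ∫⁻ q in quad, ENNReal.ofReal (√(2 * yF (Prad Q) (Elev F (C0Q Q e₀) S q) q.1 r)) := by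
    calc _ = ∫⁻ w : ℝ, ∫⁻ q in quad, (if w ^ 2 / 2 < yF (Prad Q) (Elev F (C0Q Q e₀) S q) q.1 r then (1:ℝ≥0∞) else 0) := by
          congr 1; ext w
          unfold quad
          have mw : Measurable (fun q : ℝ × ℝ => if w ^ 2 / 2 < yF (Prad Q) (Elev F (C0Q Q e₀) S q) q.1 r then (1:ℝ≥0∞) else 0) :=
            mT.comp (by fun_prop : Measurable fun q : ℝ × ℝ => (w, q))
          rw [Measure.volume_eq_prod, ← Measure.prod_restrict, lintegral_prod _ mw.aemeasurable]
          exact setLIntegral_congr_fun measurableSet_Ioi fun l hl => e3 w l hl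
      _ = _ := by
          rw [lintegral_lintegral_swap mT.aemeasurable, ← lintegral_const_mul' _ _ ENNReal.ofReal_ne_top]
          congr 1; ext q
          simp only [half_sq_lt_iff]
          have : (fun w : ℝ => if w ∈ Ioo (-√(2 * yF (Prad Q) (Elev F (C0Q Q e₀) S q) q.1 r)) (√(2 * yF (Prad Q) (Elev F (C0Q Q e₀) S q) q.1 r)) then (1:ℝ≥0∞) else 0) = (Ioo (-√(2 * yF (Prad Q) (Elev F (C0Q Q e₀) S q) q.1 r)) (√(2 * yF (Prad Q) (Elev F (C0Q Q e₀) S q) q.1 r))).indicator 1 := by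
            ext w; simp only [indicator_apply, Pi.one_apply]
          rw [this, lintegral_indicator_one measurableSet_Ioo, Real.volume_Ioo, ← ENNReal.ofReal_mul (by norm_num)]
          congr 1; ring
  simp only [e2] at e1
  rw [lintegral_const_mul' _ _ ENNReal.ofReal_ne_top, e4] at e1
  have : ENNReal.ofReal (nQ Q r / (8 * π ^ 2)) = ENNReal.ofReal (r ^ 2 / (2 * π)) * ENNReal.ofReal (rhoF Q (r • ea)) := by
    rw [← ENNReal.ofReal_mul (by positivity)]; congr 1; unfold nQ; field_simp; ring
  rw [this, e1, ← mul_assoc, ← mul_assoc, ← mul_assoc, ← ENNReal.ofReal_mul (by positivity), ← ENNReal.ofReal_mul (by positivity), ← ENNReal.ofReal_mul (by positivity)]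
  have : r ^ 2 / (2 * π) * π * (1 / r ^ 2) * 2 = 1 := by field_simp
  rw [this]; simp

theorem Q_lev (hQ : AssumptionA Q F e₀) {S : ℝ} (h0 : 0 < S) (hS : ∀ z, Q z ≤ S) :
    ∃ ρm, LevData (Prad Q) (nQ Q) (Elev F (C0Q Q e₀) S) (C0Q Q e₀) e₀ S ρm := by
  obtain ⟨ρm, hρ⟩ := Q_rho_bdd hQ
  have h := (C0Q_le hQ).le
  refine ⟨ρm, Elev_meas hQ h, Elev_le hQ h, Elev_ge hQ h, fun q hq => ?_, fun r hr => nQ_eq hQ hS hr, fun r hr => ?_, h0.le⟩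
  · unfold Elev; rw [if_neg]; rintro ⟨-, -, h⟩; linarith
  · unfold nQ; rw [mul_div_assoc, mul_div_cancel₀]
    · exact hρ _
    · positivity
end

section
def lay : Measure (Phase × ℝ) := (volume : Measure Phase).prod (volume.restrict (Ioi (0:ℝ)))
def iB (f : Phase → ℝ) (p : Phase × ℝ) : ℝ := if p.2 < f p.1 then 1 else 0
def dd (f g : Phase → ℝ) (p : Phase × ℝ) : ℝ := iB f p - iB g p

instance lay_sf : SFinite lay := by unfold lay; infer_instance

theorem iB_meas {f : Phase → ℝ} (hf : Measurable f) : Measurable (iB f) := by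
  unfold iB
  exact Measurable.ite (measurableSet_lt (by fun_prop) (by fun_prop)) measurable_const measurable_const

theorem dd_meas {f g : Phase → ℝ} (hf : Measurable f) (hg : Measurable g) : Measurable (dd f g) := (iB_meas hf).sub (iB_meas hg)

theorem iB_nonneg (f : Phase → ℝ) (p : Phase × ℝ) : 0 ≤ iB f p := by unfold iB; split_ifs <;> norm_num

theorem iB_slice {f : Phase → ℝ} {z : Phase} (h : 0 ≤ f z) :
    IntegrableOn (fun s => iB f (z, s)) (Ioi 0) ∧ ∫ s in Ioi (0:ℝ), iB f (z, s) = f z := by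
  have e : (fun s => iB f (z, s)) = (Iio (f z)).indicator 1 := by
    ext s; simp only [iB, indicator_apply, mem_Iio, Pi.one_apply]
  rw [e]
  constructor
  · rw [integrableOn_indicator_iff measurableSet_Iio] <;> try exact measurableSet_Ioi
    rw [Iio_inter_Ioi]; exact integrableOn_const (by simp)
  · rw [integral_indicator_one measurableSet_Iio, measureReal_restrict_apply measurableSet_Iio, Iio_inter_Ioi, Real.volume_real_Ioo_of_le h, sub_zero]

theorem dd_abs_eq (f g : Phase → ℝ) (z : Phase) : (fun s => ENNReal.ofReal |dd f g (z, s)|) = (Ico (min (f z) (g z)) (max (f z) (g z))).indicator 1 := by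
  ext s
  simp only [dd, iB, indicator_apply, mem_Ico, Pi.one_apply, min_le_iff, lt_max_iff]
  by_cases h1 : s < f z <;> by_cases h2 : s < g z
  · rw [if_pos h1, if_pos h2, if_neg (by rintro ⟨a | a, -⟩ <;> linarith)]; simp
  · rw [if_pos h1, if_neg h2, if_pos ⟨Or.inr (not_lt.1 h2), Or.inl h1⟩]; simp
  · rw [if_neg h1, if_pos h2, if_pos ⟨Or.inl (not_lt.1 h1), Or.inr h2⟩]; simp
  · rw [if_neg h1, if_neg h2, if_neg (by rintro ⟨-, a | a⟩ <;> contradiction)]; simp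

theorem dd_slice {f g : Phase → ℝ} {z : Phase} (hf : 0 ≤ f z) (hg : 0 ≤ g z) :
    ∫⁻ s in Ioi (0:ℝ), ENNReal.ofReal |dd f g (z, s)| = ENNReal.ofReal |f z - g z| := by
  rw [dd_abs_eq, setLIntegral_congr Ioi_ae_eq_Ici, lintegral_indicator_one measurableSet_Ico, Measure.restrict_apply measurableSet_Ico]
  rw [inter_eq_left.2 (show Ico (min (f z) (g z)) (max (f z) (g z)) ⊆ Ici 0 from fun s hs => (le_min hf hg).trans hs.1), Real.volume_Ico, max_sub_min_eq_abs']

theorem lay_lint {f g : Phase → ℝ} (hf : memE f) (hg : memE g) {φ : Phase → ℝ} (hφ : Measurable φ) :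
    ∫⁻ p, ENNReal.ofReal |φ p.1 * dd f g p| ∂lay = ∫⁻ z, ENNReal.ofReal |φ z * (f z - g z)| := by
  have md := dd_meas hf.1 hg.1
  unfold lay
  rw [lintegral_prod _ (by fun_prop)]
  congr 1; ext z
  simp only [abs_mul, ENNReal.ofReal_mul (abs_nonneg _)]
  rw [lintegral_const_mul' _ _ ENNReal.ofReal_ne_top, dd_slice (hf.2.1 z) (hg.2.1 z)]

theorem lay_integ {f g : Phase → ℝ} (hf : memE f) (hg : memE g) {φ : Phase → ℝ} (hφ : Measurable φ)
    (hi : Integrable (fun z => φ z * (f z - g z))) : Integrable (fun p => φ p.1 * dd f g p) lay := by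
  have md := dd_meas hf.1 hg.1
  refine ⟨by fun_prop, ?_⟩
  rw [hasFiniteIntegral_iff_norm]
  simp only [Real.norm_eq_abs]
  rw [lay_lint hf hg hφ]
  simpa only [Real.norm_eq_abs] using (hasFiniteIntegral_iff_norm _).1 hi.2

theorem lay_eq {f g : Phase → ℝ} (hf : memE f) (hg : memE g) {φ : Phase → ℝ} (hφ : Measurable φ)
    (hi : Integrable (fun z => φ z * (f z - g z))) : ∫ p, φ p.1 * dd f g p ∂lay = ∫ z, φ z * (f z - g z) := by
  have := lay_integ hf hg hφ hi
  unfold lay at this ⊢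
  rw [integral_prod _ this]
  congr 1; ext z
  simp only [dd]
  rw [integral_const_mul, integral_sub (iB_slice (hf.2.1 z)).1 (iB_slice (hg.2.1 z)).1, (iB_slice (hf.2.1 z)).2, (iB_slice (hg.2.1 z)).2]

theorem lay_abs {f g : Phase → ℝ} (hf : memE f) (hg : memE g) {φ : Phase → ℝ} (hφ : Measurable φ) (h0 : ∀ z, 0 ≤ φ z)  :
    ∫ p, φ p.1 * |dd f g p| ∂lay = ∫ z, φ z * |f z - g z| := by
  have md := dd_meas hf.1 hg.1
  have hfm := hf.1
  have hgm := hg.1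
  rw [integral_eq_lintegral_of_nonneg_ae (Eventually.of_forall fun p => mul_nonneg (h0 _) (abs_nonneg _)) (by fun_prop),
    integral_eq_lintegral_of_nonneg_ae (Eventually.of_forall fun p => mul_nonneg (h0 _) (abs_nonneg _)) (by fun_prop)]
  have := lay_lint hf hg hφ
  simp only [abs_mul, abs_of_nonneg (h0 _)] at this
  rw [this]

theorem dd_integ {f g : Phase → ℝ} (hf : memE f) (hg : memE g) : Integrable (dd f g) lay := by
  simpa using lay_integ hf hg (φ := fun _ => 1) measurable_const (by simp only [one_mul]; exact hf.integ.sub hg.integ)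

theorem dd_abs_int {f g : Phase → ℝ} (hf : memE f) (hg : memE g) : ∫ p, |dd f g p| ∂lay = distL1 f g := by
  simpa [distL1] using lay_abs hf hg (φ := fun _ => 1) measurable_const (fun _ => zero_le_one)

theorem iB_integ {f : Phase → ℝ} (hf : memE f) : Integrable (iB f) lay := by
  have h0 : memE (fun _ : Phase => (0:ℝ)) := ⟨measurable_const, fun _ => le_rfl, by
    have : eLpNorm (fun _ : Phase => (0:ℝ)) ⊤ volume = 0 := eLpNorm_zero
    unfold eNormE; rw [this]; simp⟩
  have h := dd_integ hf h0
  refine h.congr ?_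
  have hs : ∀ᵐ p ∂lay, 0 < p.2 := by
    unfold lay
    exact (Measure.quasiMeasurePreserving_snd).ae (p := fun s : ℝ => 0 < s) (ae_restrict_mem measurableSet_Ioi)
  filter_upwards [hs] with p hp
  have : iB (fun _ : Phase => (0:ℝ)) p = 0 := by unfold iB; rw [if_neg (by linarith)]
  rw [dd, this, sub_zero]

theorem zeta_int {f' : Phase × ℝ → ℝ} (hf : Integrable f' lay) {ζ : ℝ × ℝ → ℝ} (hζ : Measurable ζ) {C : ℝ} (hC : ∀ q, |ζ q| ≤ C) :
    Integrable (fun p : Phase × ℝ => ζ (ellOf p.1, p.2) * f' p) lay := by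
  refine hf.bdd_mul (c := C) ?_ (Eventually.of_forall fun p => hC _)
  unfold ellOf
  exact (hζ.comp (by fun_prop : Measurable fun p : Phase × ℝ => (‖p.1.1‖ ^ 2 * ‖p.1.2‖ ^ 2 - (inner ℝ p.1.1 p.1.2 : ℝ) ^ 2, p.2))).aestronglyMeasurable

theorem ell_meas : Measurable ellOf := by unfold ellOf; fun_prop

theorem eq_pos {f g : Phase → ℝ} (hf : memErad f) (hg : memE g) (he : EqMeas f g) {ζ : ℝ × ℝ → ℝ} (hζ : Measurable ζ) (h0 : ∀ q, 0 ≤ ζ q) :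
    ∫ p : Phase × ℝ, ζ (ellOf p.1, p.2) * iB g p ∂lay = ∫ p : Phase × ℝ, ζ (ellOf p.1, p.2) * iB f p ∂lay := by
  have ml := ell_meas
  have mf := iB_meas hf.1.1
  have mg := iB_meas hg.1
  rw [integral_eq_lintegral_of_nonneg_ae (Eventually.of_forall fun p => mul_nonneg (h0 _) (iB_nonneg _ _)) (by fun_prop),
    integral_eq_lintegral_of_nonneg_ae (Eventually.of_forall fun p => mul_nonneg (h0 _) (iB_nonneg _ _)) (by fun_prop)]
  congr 1
  unfold lay
  rw [lintegral_prod_symm _ (by fun_prop), lintegral_prod_symm _ (by fun_prop)]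
  refine setLIntegral_congr_fun measurableSet_Ioi fun s hs => ?_
  have hs : 0 < s := hs
  have h := eqm_lint hf.1.1 hf.2 hg.1 he (ζ := fun l => ENNReal.ofReal (ζ (l, s))) (by fun_prop) hs
  have e : ∀ (k : Phase → ℝ) (z : Phase), ENNReal.ofReal (ζ (ellOf z, s) * iB k (z, s)) = ENNReal.ofReal (ζ (ellOf z, s)) * chi s (k z) := by
    intro k z
    rw [ENNReal.ofReal_mul (h0 _)]; congr 1
    unfold iB chi; simp only; split_ifs <;> simp
  simp only [e]; exact h

theorem eq_zeta {f g Q : Phase → ℝ} (hf : memErad f) (hg : memE g) (hQ : memE Q) (he : EqMeas f g) {ζ : ℝ × ℝ → ℝ} (hζ : Measurable ζ) {C : ℝ} (hC : ∀ q, |ζ q| ≤ C) :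
    ∫ p : Phase × ℝ, ζ (ellOf p.1, p.2) * dd g Q p ∂lay = ∫ p : Phase × ℝ, ζ (ellOf p.1, p.2) * dd f Q p ∂lay := by
  have key : ∫ p : Phase × ℝ, ζ (ellOf p.1, p.2) * iB g p ∂lay = ∫ p : Phase × ℝ, ζ (ellOf p.1, p.2) * iB f p ∂lay := by
    have h1 := eq_pos hf hg he (ζ := fun q => ζ q + C) (by fun_prop) (fun q => by linarith [neg_abs_le (ζ q), hC q])
    have h2 := eq_pos hf hg he (ζ := fun q => 1) (by fun_prop) (fun q => zero_le_one)
    simp only [one_mul, add_mul] at h1 h2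
    rw [integral_add (zeta_int (iB_integ hg) hζ hC) ((iB_integ hg).const_mul _), integral_add (zeta_int (iB_integ hf.1) hζ hC) ((iB_integ hf.1).const_mul _),
      integral_const_mul, integral_const_mul, h2] at h1
    linarith
  simp only [dd, mul_sub]
  rw [integral_sub (zeta_int (iB_integ hg) hζ hC) (zeta_int (iB_integ hQ) hζ hC),
    integral_sub (zeta_int (iB_integ hf.1) hζ hC) (zeta_int (iB_integ hQ) hζ hC), key]

theorem zeta_bd {f g Q : Phase → ℝ} (hf : memErad f) (hg : memE g) (hQ : memE Q) (he : EqMeas f g) {ζ : ℝ × ℝ → ℝ} (hζ : Measurable ζ) {C : ℝ} (hC : ∀ q, |ζ q| ≤ C) :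
    |∫ p : Phase × ℝ, ζ (ellOf p.1, p.2) * dd g Q p ∂lay| ≤ C * distL1 f Q := by
  rw [eq_zeta hf hg hQ he hζ hC, ← dd_abs_int hf.1 hQ, ← integral_const_mul]
  refine abs_integral_le_integral_abs.trans (integral_mono (zeta_int (dd_integ hf.1 hQ) hζ hC).abs ((dd_integ hf.1 hQ).abs.const_mul C) fun p => ?_)
  simp only [abs_mul]
  exact mul_le_mul_of_nonneg_right (hC _) (abs_nonneg _)

theorem eq_mass {f g : Phase → ℝ} (hf : memErad f) (hg : memE g) (he : EqMeas f g) : mass g = mass f := by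
  have h := eq_zeta hf hg hf.1 he (ζ := fun _ => 1) measurable_const (C := 1) (by simp)
  have h1 := lay_eq hg hf.1 (φ := fun _ => 1) measurable_const (by simp only [one_mul]; exact hg.integ.sub hf.1.integ)
  simp only [one_mul] at h h1
  have : ∫ p, dd f f p ∂lay = 0 := by simp [dd]
  rw [h, this, integral_sub hg.integ hf.1.integ] at h1
  unfold mass; linarith
end

section
theorem lay_phase {K : (ℝ × ℝ) → ℝ → ℝ → ℝ≥0∞} (hK : Measurable fun p : (ℝ × ℝ) × ℝ × ℝ => K p.1 p.2.1 p.2.2) :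
    ∫⁻ p, K (ellOf p.1, p.2) ‖p.1.1‖ (inner ℝ p.1.1 p.1.2 / ‖p.1.1‖) ∂lay =
      ENNReal.ofReal (4 * π ^ 2) * ∫⁻ q in quad, ∫⁻ r in Ioi (0:ℝ), ∫⁻ w, K q r w := by
  have ml := ell_meas
  have m0 : Measurable (fun p : Phase × ℝ => K (ellOf p.1, p.2) ‖p.1.1‖ (inner ℝ p.1.1 p.1.2 / ‖p.1.1‖)) :=
    hK.comp (by fun_prop : Measurable fun p : Phase × ℝ => ((ellOf p.1, p.2), ‖p.1.1‖, (inner ℝ p.1.1 p.1.2 : ℝ) / ‖p.1.1‖))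
  have ma : Measurable (fun p : ((ℝ × ℝ) × ℝ) × ℝ => K p.1.1 p.1.2 p.2) :=
    hK.comp (by fun_prop : Measurable fun p : ((ℝ × ℝ) × ℝ) × ℝ => (p.1.1, p.1.2, p.2))
  have m1 : Measurable (fun p : (ℝ × ℝ) × ℝ => ∫⁻ w, K p.1 p.2 w) := ma.lintegral_prod_right'
  have m2 : Measurable (fun q : ℝ × ℝ => ∫⁻ r in Ioi (0:ℝ), ∫⁻ w, K q r w) := m1.lintegral_prod_right'
  unfold lay quad
  rw [lintegral_prod_symm _ m0.aemeasurable, Measure.volume_eq_prod ℝ ℝ, ← Measure.prod_restrict, lintegral_prod_symm _ m2.aemeasurable,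
    ← lintegral_const_mul' _ _ ENNReal.ofReal_ne_top]
  congr 1; ext s
  have ms : Measurable (fun p : ℝ × ℝ × ℝ => K (p.2.2, s) p.1 p.2.1) :=
    hK.comp (by fun_prop : Measurable fun p : ℝ × ℝ × ℝ => ((p.2.2, s), p.1, p.2.1))
  rw [phase_lint (G := fun r w l => K (l, s) r w) ms]
  congr 1
  have e1 : ∀ r : ℝ, ∫⁻ w, ∫⁻ l in Ioi (0:ℝ), K (l, s) r w = ∫⁻ l in Ioi (0:ℝ), ∫⁻ w, K (l, s) r w := by
    intro r
    refine lintegral_lintegral_swap (f := fun w l => K (l, s) r w) (Measurable.aemeasurable ?_)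
    exact hK.comp (by fun_prop : Measurable fun p : ℝ × ℝ => ((p.2, s), r, p.1))
  simp only [e1]
  refine lintegral_lintegral_swap (f := fun r l => ∫⁻ w, K (l, s) r w) (Measurable.aemeasurable ?_)
  exact m1.comp (by fun_prop : Measurable fun p : ℝ × ℝ => ((p.2, s), p.1))

variable {Q : Phase → ℝ} {F : ℝ → ℝ → ℝ} {e₀ : ℝ}

theorem lay_ne0 : ∀ᵐ p ∂lay, p.1.1 ≠ 0 ∧ 0 < p.2 := by
  unfold lay
  have h1 : ∀ᵐ z : Phase, z.1 ≠ 0 := (Measure.quasiMeasurePreserving_fst (μ := (volume : Measure E3)) (ν := (volume : Measure E3))).ae ae_ne0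
  have h2 := (Measure.quasiMeasurePreserving_fst (μ := (volume : Measure Phase)) (ν := (volume.restrict (Ioi (0:ℝ))))).ae h1
  have h3 := (Measure.quasiMeasurePreserving_snd (μ := (volume : Measure Phase)) (ν := (volume.restrict (Ioi (0:ℝ))))).ae (p := fun s : ℝ => 0 < s) (ae_restrict_mem measurableSet_Ioi)
  filter_upwards [h2, h3] with p a b using ⟨a, b⟩

theorem core_N {g Q : Phase → ℝ} (hg : memE g) (hQ : memE Q) :
    ∫⁻ r in Ioi 0, ENNReal.ofReal ((mF g r / (4 * π * r ^ 2) - mF Q r / (4 * π * r ^ 2)) ^ 2 * r ^ 2) ≤ ENNReal.ofReal (DD g Q / (4 * π)) := by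
  have h := (DD_int hg hQ).const_mul (1 / (4 * π))
  have e : DD g Q / (4 * π) = ∫ s in Ioi 0, 1 / (4 * π) * ((mF g s - mF Q s) ^ 2 / (4 * π * s ^ 2)) := by
    rw [integral_const_mul]; unfold DD; ring
  rw [e, ofReal_integral_eq_lintegral_ofReal h (Eventually.of_forall fun s => by positivity)]
  refine le_of_eq (setLIntegral_congr_fun measurableSet_Ioi fun r hr => ?_)
  have hr : 0 < r := hr
  congr 1; field_simp

theorem t_ptw (hQ : AssumptionA Q F e₀) {S : ℝ} (hS : ∀ z, Q z ≤ S) (g : Phase → ℝ) {p : Phase × ℝ} (hp : p.1.1 ≠ 0 ∧ 0 < p.2) (lam h : ℝ) :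
    (Elev F (C0Q Q e₀) S (ellOf p.1, p.2) + lam) * dd g Q p - tInt (yF (Prad Q) (Elev F (C0Q Q e₀) S (ellOf p.1, p.2)) (ellOf p.1) ‖p.1.1‖) (lam - h) (inner ℝ p.1.1 p.1.2 / ‖p.1.1‖)
      ≤ (eQ Q p.1 + h) * dd g Q p := by
  obtain ⟨z, s⟩ := p
  obtain ⟨hz, hs⟩ := hp
  simp only at hz hs ⊢
  have r0 : 0 < ‖z.1‖ := norm_pos_iff.2 hz
  set E := Elev F (C0Q Q e₀) S (ellOf z, s) with hE
  set w : ℝ := inner ℝ z.1 z.2 / ‖z.1‖ with hw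
  have e1 : yF (Prad Q) E (ellOf z) ‖z.1‖ - w ^ 2 / 2 = E - eQ Q z := by
    unfold yF eQ ellOf; rw [hw]; field_simp; ring
  have hl := lev_iff hQ hS hz hs
  rw [← hE] at hl
  have h2 : w ^ 2 / 2 < yF (Prad Q) E (ellOf z) ‖z.1‖ ↔ s < Q z := by
    rw [← hl]; constructor <;> intro <;> linarith
  unfold tInt dd iB
  simp only [h2]
  rw [show yF (Prad Q) E (ellOf z) ‖z.1‖ + (lam - h) - w ^ 2 / 2 = E + lam - (eQ Q z + h) by linarith]
  have ma := le_max_left (E + lam - (eQ Q z + h)) 0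
  have mb := le_max_right (E + lam - (eQ Q z + h)) 0
  split_ifs <;> linarith

theorem Elev_abs (hQ : AssumptionA Q F e₀) (S : ℝ) (q : ℝ × ℝ) : |Elev F (C0Q Q e₀) S q| ≤ C0Q Q e₀ := by
  have h := (C0Q_le hQ).le
  have h1 := Elev_le (S := S) hQ h q
  have h2 := Elev_ge (S := S) hQ h q
  rw [abs_le]; constructor <;> linarith [hQ.e₀neg]

def tz (Φ : ℝ → ℝ) (E lam : ℝ × ℝ → ℝ) (h : ℝ → ℝ) (p : Phase × ℝ) : ℝ :=
  tInt (yF Φ (E (ellOf p.1, p.2)) (ellOf p.1) ‖p.1.1‖) (lam (ellOf p.1, p.2) - h ‖p.1.1‖) (inner ℝ p.1.1 p.1.2 / ‖p.1.1‖)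

set_option maxHeartbeats 1000000 in
theorem tz_all {Φ h : ℝ → ℝ} {E lam : ℝ × ℝ → ℝ} (hΦ : Measurable Φ) (hh : Measurable h) (hE : Measurable E) (hl : Measurable lam) :
    Measurable (tz Φ E lam h) ∧ ∫⁻ p, ENNReal.ofReal (tz Φ E lam h p) ∂lay =
      ENNReal.ofReal (4 * π ^ 2) * ∫⁻ q in quad, ∫⁻ r in Ioi (0:ℝ), ∫⁻ w, ENNReal.ofReal (tInt (yF Φ (E q) q.1 r) (lam q - h r) w) := by
  have mK0 : Measurable fun p : (ℝ × ℝ) × ℝ × ℝ => tInt (yF Φ (E p.1) p.1.1 p.2.1) (lam p.1 - h p.2.1) p.2.2 := by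
    have my : Measurable fun p : (ℝ × ℝ) × ℝ × ℝ => yF Φ (E p.1) p.1.1 p.2.1 := by unfold yF; fun_prop
    unfold tInt
    refine Measurable.sub (by fun_prop) (Measurable.ite (measurableSet_lt (by fun_prop) my) (by fun_prop) measurable_const)
  have mel := ell_meas
  refine ⟨mK0.comp (by fun_prop : Measurable fun p : Phase × ℝ => ((ellOf p.1, p.2), ‖p.1.1‖, (inner ℝ p.1.1 p.1.2 : ℝ) / ‖p.1.1‖)), ?_⟩
  exact lay_phase (K := fun q r w => ENNReal.ofReal (tInt (yF Φ (E q) q.1 r) (lam q - h r) w)) mK0.ennreal_ofReal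

set_option maxHeartbeats 1000000 in
theorem stab (hQ : AssumptionA Q F e₀) : ∃ ε1 : ℝ, 0 < ε1 ∧ ∃ δ : ℝ, 0 < δ ∧ ∃ C : ℝ, 0 ≤ C ∧ ∀ f g : Phase → ℝ, memErad f → memErad g → EqMeas f g →
    (∀ r, 0 < r → |Prad g r - Prad Q r| ≤ ε1) → δ * DD g Q ≤ 2 * (Ham g - Ham Q) + C * distL1 f Q := by
  obtain ⟨S, S0, hS⟩ := Q_bound hQ
  obtain ⟨R, P⟩ := Q_pot hQ
  obtain ⟨ρm, L⟩ := Q_lev hQ S0 hS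
  obtain ⟨ε1, ε0, δ, δ0, δ1, hcore⟩ := core P L
  have C0 : 0 ≤ C0Q Q e₀ := (abs_nonneg _).trans (Elev_abs hQ S (0, 0))
  refine ⟨ε1, ε0, δ, δ0, 2 * (C0Q Q e₀ + ε1), by positivity, fun f g hf hg he hh => ?_⟩
  have hE := Q_memE hQ
  have hmg := Prad_meas hg.1
  have hmQ := Prad_meas hE.1
  have hEm : Measurable (Elev F (C0Q Q e₀) S) := Elev_meas hQ (C0Q_le hQ).le
  obtain ⟨lam, ml, bl, hT⟩ := hcore (fun r => Prad g r - Prad Q r) (fun r => mF g r / (4 * π * r ^ 2) - mF Q r / (4 * π * r ^ 2)) (DD g Q / (4 * π))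
    (div_nonneg (DD_nonneg _ _) (by positivity)) (fun r hr => (Prad_deriv hg.1 hr).sub (Prad_deriv hE.1 hr))
    (by
      have c1 := mF_cont hg.1
      have c2 := mF_cont hE.1
      have hp : ∀ r ∈ Ioi (0:ℝ), 4 * π * r ^ 2 ≠ 0 := fun r hr => by
        have hr : 0 < r := hr
        positivity
      exact (c1.continuousOn.div (by fun_prop) hp).sub (c2.continuousOn.div (by fun_prop) hp)) (core_N hg.1 hE.1) hh
  obtain ⟨mt, hlt⟩ := tz_all hmQ (hmg.sub hmQ) hEm ml
  set t : Phase × ℝ → ℝ := tz (Prad Q) (Elev F (C0Q Q e₀) S) lam (Prad g - Prad Q) with ht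
  have t0 : ∀ p, 0 ≤ t p := fun p => tInt_nonneg _ _ _
  have hDD := DD_nonneg g Q
  have hTT : ∫⁻ p, ENNReal.ofReal (t p) ∂lay ≤ ENNReal.ofReal ((1 - δ) * DD g Q / 2) := by
    rw [hlt]
    refine (mul_le_mul_right hT _).trans ?_
    rw [← ENNReal.ofReal_mul (by positivity)]
    refine ENNReal.ofReal_le_ofReal (le_of_eq ?_)
    field_simp
  have it : Integrable t lay := ⟨mt.aestronglyMeasurable, by
    rw [hasFiniteIntegral_iff_norm]
    simp only [Real.norm_eq_abs, abs_of_nonneg (t0 _)]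
    exact hTT.trans_lt ENNReal.ofReal_lt_top⟩
  have hT2 : ∫ p, t p ∂lay ≤ (1 - δ) * DD g Q / 2 := by
    rw [integral_eq_lintegral_of_nonneg_ae (Eventually.of_forall t0) mt.aestronglyMeasurable]
    exact ENNReal.toReal_le_of_le_ofReal (div_nonneg (mul_nonneg (by linarith) hDD) (by norm_num)) hTT
  have ie : Integrable (fun z : Phase => (‖z.2‖ ^ 2 / 2 + Prad g ‖z.1‖) * (g z - Q z)) := by
    simp only [mul_sub]; exact (e_int hg.1 hg.1).sub (e_int hg.1 hE.1)
  have me : Measurable (fun z : Phase => ‖z.2‖ ^ 2 / 2 + Prad g ‖z.1‖) := by fun_prop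
  have mζ : Measurable (fun q => Elev F (C0Q Q e₀) S q + lam q) := by fun_prop
  have bζ : ∀ q, |Elev F (C0Q Q e₀) S q + lam q| ≤ C0Q Q e₀ + ε1 := fun q => (abs_add_le _ _).trans (add_le_add (Elev_abs hQ S q) (bl q))
  have hz := zeta_bd hf hg.1 hE.1 he mζ bζ
  have iz := zeta_int (dd_integ hg.1 hE.1) mζ bζ
  have hm : ∫ p : Phase × ℝ, ((Elev F (C0Q Q e₀) S (ellOf p.1, p.2) + lam (ellOf p.1, p.2)) * dd g Q p - t p) ∂lay ≤ ∫ p : Phase × ℝ, (‖p.1.2‖ ^ 2 / 2 + Prad g ‖p.1.1‖) * dd g Q p ∂lay := by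
    refine integral_mono_ae (iz.sub it) (lay_integ hg.1 hE.1 me ie) ?_
    filter_upwards [lay_ne0] with p hp
    have := t_ptw hQ hS g hp (lam (ellOf p.1, p.2)) (Prad g ‖p.1.1‖ - Prad Q ‖p.1.1‖)
    unfold eQ at this
    rw [add_assoc, add_sub_cancel] at this
    exact this
  rw [integral_sub iz it, lay_eq hg.1 hE.1 me ie] at hm
  have h1 := Hamg hg hE
  have h2 := (abs_le.1 hz).1
  nlinarith

theorem excess (hQ : AssumptionA Q F e₀) {S : ℝ} (hS : ∀ z, Q z ≤ S) {f g : Phase → ℝ} (hf : memErad f) (hg : memErad g) (he : EqMeas f g) :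
    Integrable (fun p : Phase × ℝ => |eQ Q p.1 - Elev F (C0Q Q e₀) S (ellOf p.1, p.2)| * |dd g Q p|) lay ∧
    ∫ p : Phase × ℝ, |eQ Q p.1 - Elev F (C0Q Q e₀) S (ellOf p.1, p.2)| * |dd g Q p| ∂lay ≤ Ham g - Ham Q + DD g Q / 2 + C0Q Q e₀ * distL1 f Q := by
  have hE := Q_memE hQ
  have hmQ := Prad_meas hE.1
  have hEm : Measurable (Elev F (C0Q Q e₀) S) := Elev_meas hQ (C0Q_le hQ).le
  have ie : Integrable (fun z : Phase => eQ Q z * (g z - Q z)) := by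
    unfold eQ
    simp only [mul_sub]; exact (e_int hE.1 hg.1).sub (e_int hE.1 hE.1)
  have me : Measurable (eQ Q) := by unfold eQ; fun_prop
  have hz := zeta_bd hf hg.1 hE.1 he hEm (Elev_abs hQ S)
  have iz := zeta_int (dd_integ hg.1 hE.1) hEm (Elev_abs hQ S)
  have il := lay_integ hg.1 hE.1 me ie
  have hae : (fun p : Phase × ℝ => eQ Q p.1 * dd g Q p - Elev F (C0Q Q e₀) S (ellOf p.1, p.2) * dd g Q p) =ᵐ[lay]
      (fun p : Phase × ℝ => |eQ Q p.1 - Elev F (C0Q Q e₀) S (ellOf p.1, p.2)| * |dd g Q p|) := by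
    filter_upwards [lay_ne0] with p hp
    obtain ⟨z, s⟩ := p
    have hl := lev_iff hQ hS hp.1 hp.2
    simp only at hl ⊢
    rw [← sub_mul]
    unfold dd iB
    simp only [← hl]
    split_ifs with h1 h2 h2
    · simp
    · rw [abs_of_nonneg (by linarith)]; simp
    · rw [abs_of_neg (by linarith)]; simp
    · simp
  refine ⟨(il.sub iz).congr hae, ?_⟩
  rw [← integral_congr_ae hae, integral_sub il iz, lay_eq hg.1 hE.1 me ie]
  have h1 := HamQ hg hE
  have h2 := (abs_le.1 hz).1
  unfold eQ; linarith
end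

section
variable {Q : Phase → ℝ} {F : ℝ → ℝ → ℝ} {e₀ : ℝ}

theorem tie_null (hQ : AssumptionA Q F e₀) (S : ℝ) : ∀ᵐ p ∂lay, eQ Q p.1 ≠ Elev F (C0Q Q e₀) S (ellOf p.1, p.2) := by
  have hmQ := Prad_meas (Q_memE hQ).1
  have me : Measurable (eQ Q) := by unfold eQ; fun_prop
  have hEm : Measurable (Elev F (C0Q Q e₀) S) := Elev_meas hQ (C0Q_le hQ).le
  have ml := ell_meas
  have ms : MeasurableSet {p : Phase × ℝ | eQ Q p.1 = Elev F (C0Q Q e₀) S (ellOf p.1, p.2)} := measurableSet_eq_fun (by fun_prop) (by fun_prop)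
  rw [ae_iff]
  simp only [ne_eq, not_not]
  unfold lay
  rw [Measure.measure_prod_null ms]
  refine Eventually.of_forall fun z => ?_
  simp only [Pi.zero_apply]
  refine measure_mono_null (t := {F (eQ Q z) (ellOf z)}) (fun s hs => ?_) (by simp)
  exact Elev_eq hQ (C0Q_le hQ).le (eQ_gt hQ z) hs

theorem region (hQ : AssumptionA Q F e₀) : ∃ X V : ℝ, ∀ z : Phase, eQ Q z < e₀ / 2 → ‖z.1‖ ≤ X ∧ ‖z.2‖ ≤ V := by
  have hE := (Q_memE hQ).1
  have h0 := hQ.e₀neg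
  have hm := mass_nonneg hE
  refine ⟨2 * mass Q / (-e₀), 1 + 2 * C0Q Q e₀, fun z hz => ⟨?_, ?_⟩⟩
  · rcases (norm_nonneg z.1).eq_or_lt with h | h
    · rw [← h]; exact div_nonneg (by positivity) (by linarith)
    · have h1 := Prad_ge hE h
      have h2 : Prad Q ‖z.1‖ < e₀ / 2 := by
        unfold eQ at hz; linarith [sq_nonneg ‖z.2‖]
      have h3 : -(e₀ / 2) < mass Q / ‖z.1‖ := by linarith
      rw [lt_div_iff₀ h] at h3
      rw [le_div_iff₀ (by linarith)]; linarith
  · have := C0Q_pot hQ (norm_nonneg z.1)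
    have c0 : 0 < C0Q Q e₀ := by linarith [C0Q_pot hQ le_rfl, Prad_le0 hE 0]
    unfold eQ at hz
    refine abs_le_of_sq_le_sq' ?_ (by linarith) |>.2
    nlinarith

def Gs (Q : Phase → ℝ) (F : ℝ → ℝ → ℝ) (e₀ S Mx θ : ℝ) : Set (Phase × ℝ) :=
  {p | |eQ Q p.1 - Elev F (C0Q Q e₀) S (ellOf p.1, p.2)| < θ ∧ p.2 < Mx}

theorem Gs_meas (hQ : AssumptionA Q F e₀) (S Mx θ : ℝ) : MeasurableSet (Gs Q F e₀ S Mx θ) := by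
  have hmQ := Prad_meas (Q_memE hQ).1
  have me : Measurable (eQ Q) := by unfold eQ; fun_prop
  have hEm : Measurable (Elev F (C0Q Q e₀) S) := Elev_meas hQ (C0Q_le hQ).le
  have ml := ell_meas
  exact (measurableSet_lt (f := fun p : Phase × ℝ => |eQ Q p.1 - Elev F (C0Q Q e₀) S (ellOf p.1, p.2)|) (by fun_prop) measurable_const).inter
    (measurableSet_lt (f := fun p : Phase × ℝ => p.2) (by fun_prop) measurable_const)

theorem smallG (hQ : AssumptionA Q F e₀) (S Mx : ℝ) {ε : ℝ} (hε : 0 < ε) : ∃ θ : ℝ, 0 < θ ∧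
    Integrable ((Gs Q F e₀ S Mx θ).indicator fun p : Phase × ℝ => 1 + ‖p.1.2‖ ^ 2) lay ∧
    ∫ p, (Gs Q F e₀ S Mx θ).indicator (fun p : Phase × ℝ => 1 + ‖p.1.2‖ ^ 2) p ∂lay < ε := by
  obtain ⟨X, V, hXV⟩ := region hQ
  have h0 := hQ.e₀neg
  set th : ℕ → ℝ := fun n => (-e₀ / 2) / (n + 1) with hth
  have th0 : ∀ n, 0 < th n := fun n => div_pos (by linarith) (by positivity)
  have th1 : ∀ n, th n ≤ -e₀ / 2 := fun n => div_le_self (by linarith) (by linarith [(Nat.cast_nonneg n : (0:ℝ) ≤ n)])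
  set K : Set (Phase × ℝ) := (Metric.closedBall (0:E3) X ×ˢ Metric.closedBall (0:E3) V) ×ˢ Iio Mx with hK
  have mK : MeasurableSet K := (Metric.isClosed_closedBall.measurableSet.prod Metric.isClosed_closedBall.measurableSet).prod measurableSet_Iio
  have fK : lay K < ⊤ := by
    rw [hK]; unfold lay
    rw [Measure.prod_prod, Measure.volume_eq_prod, Measure.prod_prod, Measure.restrict_apply measurableSet_Iio, Iio_inter_Ioi]
    exact ENNReal.mul_lt_top (ENNReal.mul_lt_top measure_closedBall_lt_top measure_closedBall_lt_top) (by simp)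
  have sub : ∀ n, Gs Q F e₀ S Mx (th n) ⊆ K := by
    rintro n ⟨z, s⟩ ⟨h1, h2⟩
    have h3 := Elev_le (S := S) hQ (C0Q_le hQ).le (ellOf z, s)
    have h4 := (abs_lt.1 h1).2
    have h5 := th1 n
    simp only at h4
    have := hXV z (by linarith)
    exact ⟨⟨by simpa using this.1, by simpa using this.2⟩, h2⟩
  have mW : Measurable (fun p : Phase × ℝ => 1 + ‖p.1.2‖ ^ 2) := by fun_prop
  have ib : Integrable (K.indicator fun _ : Phase × ℝ => 1 + V ^ 2) lay :=
    (integrable_indicator_iff mK).2 (integrableOn_const fK.ne)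
  have mG : ∀ n, AEStronglyMeasurable ((Gs Q F e₀ S Mx (th n)).indicator fun p : Phase × ℝ => 1 + ‖p.1.2‖ ^ 2) lay :=
    fun n => (mW.indicator (Gs_meas hQ S Mx (th n))).aestronglyMeasurable
  have bd : ∀ n p, ‖(Gs Q F e₀ S Mx (th n)).indicator (fun p : Phase × ℝ => 1 + ‖p.1.2‖ ^ 2) p‖ ≤ K.indicator (fun _ : Phase × ℝ => 1 + V ^ 2) p := by
    intro n p
    by_cases hp : p ∈ Gs Q F e₀ S Mx (th n)
    · rw [indicator_of_mem hp, indicator_of_mem (sub n hp), Real.norm_of_nonneg (by positivity)]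
      have : ‖p.1.2‖ ≤ V := by simpa using (sub n hp).1.2
      gcongr
    · rw [indicator_of_notMem hp, norm_zero]; exact indicator_nonneg (fun _ _ => by positivity) _
  have lim := tendsto_integral_of_dominated_convergence (μ := lay) (F := fun n => (Gs Q F e₀ S Mx (th n)).indicator fun p : Phase × ℝ => 1 + ‖p.1.2‖ ^ 2)
    (f := fun _ => (0:ℝ)) (K.indicator fun _ : Phase × ℝ => 1 + V ^ 2) mG ib (fun n => Eventually.of_forall (bd n)) (by
      filter_upwards [tie_null hQ S] with p hp
      have hpos : 0 < |eQ Q p.1 - Elev F (C0Q Q e₀) S (ellOf p.1, p.2)| := abs_pos.2 (sub_ne_zero.2 hp)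
      have tl : Tendsto th atTop (𝓝 0) := by
        have := (tendsto_one_div_add_atTop_nhds_zero_nat (𝕜 := ℝ)).const_mul (-e₀ / 2)
        rw [mul_zero] at this
        refine this.congr fun n => ?_
        simp only [hth]; ring
      refine tendsto_const_nhds.congr' ?_
      filter_upwards [tl.eventually (gt_mem_nhds hpos)] with n hn
      rw [indicator_of_notMem]
      rintro ⟨h1, -⟩
      linarith)
  rw [integral_zero] at lim
  obtain ⟨n, hn⟩ := (lim.eventually (gt_mem_nhds hε)).exists
  exact ⟨th n, th0 n, ib.mono' (mG n) (Eventually.of_forall (bd n)), hn⟩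

theorem closing (hQ : AssumptionA Q F e₀) {S : ℝ} (hS : ∀ z, Q z ≤ S) (M : ℝ) {ε : ℝ} (hε : 0 < ε) : ∃ σ : ℝ, 0 < σ ∧
    ∀ g : Phase → ℝ, memErad g → (∀ᵐ z, g z ≤ M) →
      Integrable (fun p : Phase × ℝ => |eQ Q p.1 - Elev F (C0Q Q e₀) S (ellOf p.1, p.2)| * |dd g Q p|) lay →
      ∫ p : Phase × ℝ, |eQ Q p.1 - Elev F (C0Q Q e₀) S (ellOf p.1, p.2)| * |dd g Q p| ∂lay ≤ σ →
      distL1 g Q + distL1v g Q < ε := by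
  obtain ⟨θ, θ0, iG, hG⟩ := smallG hQ S (max M S) (half_pos hε)
  have hE := Q_memE hQ
  have c0 : 0 < C0Q Q e₀ := by linarith [C0Q_pot hQ le_rfl, Prad_le0 hE.1 0]
  set k := 2 + (1 + 4 * C0Q Q e₀) / θ with hk
  have k0 : 0 < k := by positivity
  refine ⟨ε / 2 / k, by positivity, fun g hg hM iX hX => ?_⟩
  have i1 : Integrable (fun z : Phase => g z - Q z) := hg.1.integ.sub hE.1.integ
  have i2 : Integrable (fun z : Phase => ‖z.2‖ ^ 2 * (g z - Q z)) := by
    simp only [mul_sub]; exact hg.1.integv.sub hE.1.integv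
  have i3 : Integrable (fun z : Phase => ‖z.2‖ ^ 2 * |g z - Q z|) := by
    refine i2.abs.congr (Eventually.of_forall fun z => ?_)
    simp only [abs_mul, abs_of_nonneg (sq_nonneg ‖z.2‖)]
  have e1 : distL1 g Q + distL1v g Q = ∫ p : Phase × ℝ, (1 + ‖p.1.2‖ ^ 2) * |dd g Q p| ∂lay := by
    rw [lay_abs hg.1 hE.1 (φ := fun z => 1 + ‖z.2‖ ^ 2) (by fun_prop) (fun z => by positivity)]
    simp only [add_mul, one_mul]
    rw [integral_add i1.abs i3]; rfl
  have i4 : Integrable (fun p : Phase × ℝ => (1 + ‖p.1.2‖ ^ 2) * |dd g Q p|) lay := by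
    refine (lay_integ hg.1 hE.1 (φ := fun z => 1 + ‖z.2‖ ^ 2) (by fun_prop) ?_).abs.congr (Eventually.of_forall fun p => ?_)
    · simp only [add_mul, one_mul]; exact i1.add i2
    · simp only [abs_mul, abs_of_nonneg (by positivity : 0 ≤ 1 + ‖p.1.2‖ ^ 2)]
  have hM2 : ∀ᵐ p ∂lay, g p.1 ≤ M := by
    unfold lay
    exact (Measure.quasiMeasurePreserving_fst (μ := (volume : Measure Phase)) (ν := (volume.restrict (Ioi (0:ℝ))))).ae hM
  rw [e1]
  calc _ ≤ ∫ p : Phase × ℝ, ((Gs Q F e₀ S (max M S) θ).indicator (fun p : Phase × ℝ => 1 + ‖p.1.2‖ ^ 2) p + k * (|eQ Q p.1 - Elev F (C0Q Q e₀) S (ellOf p.1, p.2)| * |dd g Q p|)) ∂lay := by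
        refine integral_mono_ae i4 (iG.add (iX.const_mul k)) ?_
        filter_upwards [hM2] with p hp
        have hW : 0 ≤ 1 + ‖p.1.2‖ ^ 2 := by positivity
        set D := |eQ Q p.1 - Elev F (C0Q Q e₀) S (ellOf p.1, p.2)| with hD
        have D0 : 0 ≤ D := abs_nonneg _
        have hX0 : 0 ≤ k * (D * |dd g Q p|) := by positivity
        by_cases h1 : D < θ
        · by_cases h2 : p.2 < max M S
          · have hd : |dd g Q p| ≤ 1 := by unfold dd iB; split_ifs <;> simp
            rw [indicator_of_mem (show p ∈ Gs Q F e₀ S (max M S) θ from ⟨h1, h2⟩)]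
            nlinarith
          · have hd : dd g Q p = 0 := by
              have h3 := max_le_iff.1 (not_lt.1 h2)
              have h4 := hS p.1
              unfold dd iB
              rw [if_neg (by linarith), if_neg (by linarith), sub_zero]
            have : 0 ≤ (Gs Q F e₀ S (max M S) θ).indicator (fun p : Phase × ℝ => 1 + ‖p.1.2‖ ^ 2) p := indicator_nonneg (fun _ _ => by positivity) _
            rw [hd]; simpa using this
        · have h1 := not_lt.1 h1
          have : 0 ≤ (Gs Q F e₀ S (max M S) θ).indicator (fun p : Phase × ℝ => 1 + ‖p.1.2‖ ^ 2) p := indicator_nonneg (fun _ _ => by positivity) _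
          have hb : 1 + ‖p.1.2‖ ^ 2 ≤ k * D := by
            have a1 := C0Q_pot hQ (norm_nonneg p.1.1)
            have a2 := (abs_le.1 (Elev_abs hQ S (ellOf p.1, p.2))).2
            have a3 : eQ Q p.1 - Elev F (C0Q Q e₀) S (ellOf p.1, p.2) ≤ D := le_abs_self _
            have a4 : 1 + 4 * C0Q Q e₀ ≤ (1 + 4 * C0Q Q e₀) / θ * D := by
              rw [div_mul_eq_mul_div, le_div_iff₀ θ0]
              exact mul_le_mul_of_nonneg_left h1 (by positivity)
            have a5 : ‖p.1.2‖ ^ 2 / 2 + Prad Q ‖p.1.1‖ = eQ Q p.1 := rfl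
            rw [hk, add_mul]; linarith
          have := mul_le_mul_of_nonneg_right hb (abs_nonneg (dd g Q p))
          linarith
    _ < ε := by
        rw [integral_add iG (iX.const_mul k), integral_const_mul]
        have : k * (ε / 2 / k) = ε / 2 := by field_simp
        have := mul_le_mul_of_nonneg_left hX k0.le
        linarith
end

section
variable {Q : Phase → ℝ} {F : ℝ → ℝ → ℝ} {e₀ : ℝ}

theorem fifth {c e : ℝ} (hc : 0 ≤ c) (he : 0 < e) : ∃ a : ℝ, 0 < a ∧ c * a ^ (1/5:ℝ) ≤ e := by
  have hd : 0 < e / (c + 1) := by positivity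
  refine ⟨(e / (c + 1)) ^ (5:ℕ), by positivity, ?_⟩
  rw [show (1/5:ℝ) = ((5:ℕ):ℝ)⁻¹ by norm_num, Real.pow_rpow_inv_natCast hd.le (by norm_num), mul_div_assoc', div_le_iff₀ (by positivity)]
  nlinarith

theorem init_small (hQ : AssumptionA Q F e₀) {M : ℝ} (hM : 0 ≤ M) : ∃ P : ℝ, 0 ≤ P ∧ ∀ (η : ℝ) (f : Phase → ℝ), η ≤ 1 → memErad f → (∀ᵐ z, f z ≤ M) →
    distL1 f Q < η → Ham f < Ham Q + η → DD f Q ≤ P * η := by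
  have hE := Q_memE hQ
  have m0 := mass_nonneg hE.1
  set m := mass Q + 1 with hm
  obtain ⟨a, a0, ha⟩ := fifth (c := m) (e := 1/2) (by positivity) (by norm_num)
  set P := (CB * M + (4 * (Ham Q + 1) + CB * M + 2 * (m * m / a)) + m) + -Prad Q 0 with hP
  refine ⟨|P|, abs_nonneg _, fun η f h1 hf hfM hd hH => ?_⟩
  have hmass : mass f ≤ m := by
    have : mass f - mass Q ≤ distL1 f Q := by
      unfold mass distL1
      rw [← integral_sub hf.1.integ hE.1.integ]
      exact integral_mono (hf.1.integ.sub hE.1.integ) (hf.1.integ.sub hE.1.integ).abs fun z => le_abs_self _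
    linarith
  have hk := kin_bd hf hM hfM hmass a0 ha
  have hp := Prad0_ge hf.1 hM hfM
  have hD := DD_small hf.1 hE.1
  have hd0 : 0 ≤ distL1 f Q := integral_nonneg fun z => abs_nonneg _
  have : -Prad f 0 - Prad Q 0 ≤ |P| := (by rw [hP]; linarith : -Prad f 0 - Prad Q 0 ≤ P).trans (le_abs_self _)
  calc DD f Q ≤ distL1 f Q * (-Prad f 0 - Prad Q 0) := hD
    _ ≤ distL1 f Q * |P| := by gcongr
    _ ≤ |P| * η := by rw [mul_comm]; gcongr

theorem boot (hQ : AssumptionA Q F e₀) {M : ℝ} (hM : 0 ≤ M) : ∃ κ : ℝ, 0 < κ ∧ ∃ D : ℝ, 0 ≤ D ∧ ∀ (η : ℝ) (f g : Phase → ℝ), η ≤ 1 → memErad f → memErad g → EqMeas f g → (∀ᵐ z, g z ≤ M) →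
    distL1 f Q < η → Ham g < Ham Q + η → DD g Q ≤ κ → DD g Q ≤ D * η := by
  obtain ⟨ε1, ε0, δ, δ0, C, C0, hst⟩ := stab hQ
  obtain ⟨S, S0, hS⟩ := Q_bound hQ
  have hE := Q_memE hQ
  have b0 := CB_nonneg
  set K1 := 2 * (Ham Q + 1) + 2 + 2 * fieldSq Q with hK1
  have kQ := kin_nonneg hE.1
  set c := CB * M + CB * S + |K1| + kineticE Q with hc
  have c0 : 0 ≤ c := by positivity
  obtain ⟨a, a0, ha⟩ := fifth (c := c) (e := ε1 / 3) c0 (by positivity)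
  set τ := 3 / (2 * a * ε1) with hτ
  have τ0 : 0 < τ := by positivity
  refine ⟨min 1 (2 * ε1 / (3 * τ)), by positivity, (2 + C) / δ, by positivity, fun η f g h1 hf hg he hgM hd hH hκ => ?_⟩
  have k1 := hκ.trans (min_le_left _ _)
  have k2 := hκ.trans (min_le_right _ _)
  have hK : kineticE g ≤ |K1| := by
    have := kin_eq g
    have := fieldSq_DD hg hE
    refine le_trans ?_ (le_abs_self K1)
    linarith
  have g1 : ∀ s, 0 < s → mF g s ≤ c * s ^ (6/5:ℝ) := fun s hs => by
    refine (mF_bound hg.1 hM hgM hs).trans (mul_le_mul_of_nonneg_right ?_ (by positivity))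
    have : 0 ≤ CB * S := by positivity
    linarith
  have g2 : ∀ s, 0 < s → mF Q s ≤ c * s ^ (6/5:ℝ) := fun s hs => by
    refine (mF_bound hE.1 S0.le (Eventually.of_forall hS) hs).trans (mul_le_mul_of_nonneg_right ?_ (by positivity))
    have : 0 ≤ CB * M := by positivity
    have := abs_nonneg K1
    linarith
  have hh : ∀ r, 0 < r → |Prad g r - Prad Q r| ≤ ε1 := fun r hr => by
    have := h_bound hg.1 hE.1 c0 g1 g2 a0 τ0 hr.le
    have e1 : 1 / (2 * τ) / a = ε1 / 3 := by rw [hτ]; field_simp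
    have e2 : τ / 2 * DD g Q ≤ ε1 / 3 := by
      rw [le_div_iff₀ (by positivity)] at k2
      linarith
    linarith
  have := hst f g hf hg he hh
  rw [div_mul_eq_mul_div, le_div_iff₀ δ0]
  have : C * distL1 f Q ≤ C * η := by gcongr
  linarith

theorem DD_tend {f : ℝ → Phase → ℝ} (hf : ∀ t : ℝ, 0 ≤ t → memErad (f t)) {t : ℝ} (ht : 0 ≤ t)
    (h : Tendsto (fun s => fieldDist (f s) (f t)) (nhdsWithin t (Ici 0)) (nhds 0)) {e : ℝ} (he : 0 < e) :
    ∀ᶠ s in nhdsWithin t (Ici 0), DD (f s) (f t) ≤ e := by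
  filter_upwards [h.eventually (gt_mem_nhds (Real.sqrt_pos.2 he)), self_mem_nhdsWithin] with s hs h0
  rw [fieldDist_eq (hf s h0) (hf t ht)] at hs
  exact ((Real.sqrt_lt_sqrt_iff (DD_nonneg _ _)).1 hs).le
end

/-- Theorem 3: nonlinear stability of `Q` under the Vlasov-Poisson flow. -/
theorem stmt2 (Q : Phase → ℝ) (F : ℝ → ℝ → ℝ) (e₀ : ℝ) (hQ : AssumptionA Q F e₀) :
    ∃ M₀ : ℝ, 0 < M₀ ∧ ∀ M : ℝ, M₀ ≤ M → ∀ ε : ℝ, 0 < ε → ∃ η : ℝ, 0 < η ∧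
      ∀ (f₀ : Phase → ℝ) (f : ℝ → Phase → ℝ),
        memErad f₀ →
        (∀ t : ℝ, 0 ≤ t → memErad (f t)) →
        f 0 = f₀ →
        (∀ t : ℝ, 0 ≤ t →
          Tendsto (fun s => fieldDist (f s) (f t)) (nhdsWithin t (Ici 0)) (nhds 0)) →
        (∀ t : ℝ, 0 ≤ t → EqMeas f₀ (f t)) →
        (∀ t : ℝ, 0 ≤ t → Ham (f t) = Ham f₀) →
        distL1 f₀ Q < η →
        eLpNorm f₀ ⊤ volume < ENNReal.ofReal M →
        Ham f₀ < Ham Q + η →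
        ∀ t : ℝ, 0 ≤ t →
          distL1 (f t) Q + distL1v (f t) Q < ε ∧
          eLpNorm (f t) ⊤ volume < ENNReal.ofReal M := by
  refine ⟨1, one_pos, fun M hM1 ε hε => ?_⟩
  have hM : 0 ≤ M := by linarith
  obtain ⟨S, S0, hS⟩ := Q_bound hQ
  have hE := Q_memE hQ
  obtain ⟨P, P0, hP⟩ := init_small hQ hM
  obtain ⟨κ, κ0, D, D0, hB⟩ := boot hQ hM
  obtain ⟨σ, σ0, hσ⟩ := closing hQ hS M hε
  have c0 : 0 < C0Q Q e₀ := by linarith [C0Q_pot hQ le_rfl, Prad_le0 hE.1 0]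
  obtain ⟨η, η0, h1, hPη, hDη, hση⟩ : ∃ η : ℝ, 0 < η ∧ η ≤ 1 ∧ P * η ≤ κ / 8 ∧ D * η ≤ κ / 8 ∧ (1 + D + C0Q Q e₀) * η ≤ σ := by
    have key : ∀ A e : ℝ, 0 ≤ A → 0 < e → ∀ η : ℝ, η ≤ e / (A + 1) → 0 < η → A * η ≤ e := by
      intro A e hA he η hη h0
      rw [le_div_iff₀ (by positivity)] at hη
      linarith
    have hpos : 0 < min (min 1 (κ / 8 / (P + 1))) (min (κ / 8 / (D + 1)) (σ / ((1 + D + C0Q Q e₀) + 1))) := by positivity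
    refine ⟨_, hpos, (min_le_left _ _).trans (min_le_left _ _), key _ _ P0 (by positivity) _ ((min_le_left _ _).trans (min_le_right _ _)) hpos,
      key _ _ D0 (by positivity) _ ((min_le_right _ _).trans (min_le_left _ _)) hpos, key _ _ (by positivity) σ0 _ ((min_le_right _ _).trans (min_le_right _ _)) hpos⟩
  refine ⟨η, η0, fun f₀ f hf₀ hf hf0 hc he hH hd hs hh => ?_⟩
  have hsup : ∀ t : ℝ, 0 ≤ t → eLpNorm (f t) ⊤ volume < ENNReal.ofReal M := fun t ht =>
    (eqm_sup hf₀.1.1 hf₀.1.2.1 hf₀.2 (hf t ht).1.1 (he t ht)).trans_lt hs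
  have hbd : ∀ t : ℝ, 0 ≤ t → ∀ᵐ z, f t z ≤ M := fun t ht => (hf t ht).1.bdd (hsup t ht).le hM
  have hHt : ∀ t : ℝ, 0 ≤ t → Ham (f t) < Ham Q + η := fun t ht => by rw [hH t ht]; exact hh
  have hboot : ∀ t : ℝ, 0 ≤ t → DD (f t) Q ≤ κ → DD (f t) Q ≤ D * η := fun t ht h =>
    hB η f₀ (f t) h1 hf₀ (hf t ht) (he t ht) (hbd t ht) hd (hHt t ht) h
  have hstart : DD (f 0) Q ≤ κ / 8 := by
    rw [hf0]; exact (hP η f₀ h1 hf₀ (hf₀.1.bdd hs.le hM) hd hh).trans hPη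
  have hall : ∀ t : ℝ, 0 ≤ t → DD (f t) Q ≤ κ / 8 := by
    intro t ht
    refine isPreconnected_Ici.induction₂' (s := Ici (0:ℝ)) (fun x y => DD (f x) Q ≤ κ / 8 → DD (f y) Q ≤ κ / 8) (fun x hx => ?_)
      (fun x y z _ _ _ a b c => b (a c)) (mem_Ici.2 le_rfl) (mem_Ici.2 ht) hstart
    filter_upwards [DD_tend hf hx (hc x hx) (e := κ / 4) (by positivity), self_mem_nhdsWithin] with y hy y0
    refine ⟨fun h => ?_, fun h => ?_⟩
    · have := DD_tri (hf y y0).1 (hf x hx).1 hE.1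
      exact (hboot y y0 (by linarith)).trans hDη
    · have := DD_tri (hf x hx).1 (hf y y0).1 hE.1
      rw [DD_comm (f x) (f y)] at this
      exact (hboot x hx (by linarith)).trans hDη
  intro t ht
  refine ⟨?_, hsup t ht⟩
  have hDt := hboot t ht (by linarith [hall t ht])
  obtain ⟨iX, hX⟩ := excess hQ hS hf₀ (hf t ht) (he t ht)
  refine hσ (f t) (hf t ht) (hbd t ht) iX (hX.trans ?_)
  have a1 := hHt t ht
  have a2 : C0Q Q e₀ * distL1 f₀ Q ≤ C0Q Q e₀ * η := by gcongr
  have a3 : 0 ≤ D * η := by positivity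
  linarith
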